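/- For every positive integer n and every countable abelian group G there exists a compact path connected subset K of ℝ^{n+3} such that πₙ(K) ≅ G. -/

import Mathlib

open scoped Topology
set_option linter.unusedSectionVars false
set_option linter.unusedTactic false
set_option linter.unusedSimpArgs false
set_option linter.unusedVariables false
namespace CAG
open Set Function unitInterval Topology.Homotopy

section Gen
variable {ι : Type*} [Fintype ι] [DecidableEq ι] [Nonempty ι] {X Y : Type*} [TopologicalSpace X]
  [TopologicalSpace Y] {x y : X}

theorem bd (f : GenLoop ι X x) {v} (hv : v ∈ Cube.boundary ι) : f v = x := f.2 v hv

theorem htp_of {f g : GenLoop ι X x} (H : I → (ι → I) → X) (hc : Continuous (uncurry H))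
    (h0 : ∀ v, H 0 v = f v) (h1 : ∀ v, H 1 v = g v)
    (hb : ∀ t, ∀ v ∈ Cube.boundary ι, H t v = x) : GenLoop.Homotopic f g := by
  refine ⟨⟨⟨⟨fun q => H q.1 q.2, hc⟩, h0, h1⟩, ?_⟩⟩
  intro t v hv
  change H t v = f v
  rw [hb t v hv, bd f hv]

theorem htp_to {f g : GenLoop ι X x} (h : GenLoop.Homotopic f g) :
    ∃ H : I → (ι → I) → X, Continuous (uncurry H) ∧
    (∀ v, H 0 v = f v) ∧ (∀ v, H 1 v = g v) ∧
    (∀ t, ∀ v ∈ Cube.boundary ι, H t v = x) := by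
  obtain ⟨K⟩ := h
  refine ⟨fun t v => K (t, v), K.continuous, K.apply_zero, K.apply_one, ?_⟩
  intro t v hv
  have := K.eq_fst t hv
  exact this.trans (f.2 v hv)

/-- class of a loop -/
def cl (f : GenLoop ι X x) : HomotopyGroup ι X x := Quotient.mk _ f

theorem cl_eq {f g : GenLoop ι X x} (h : GenLoop.Homotopic f g) : cl f = cl g := Quotient.sound h
theorem cl_exact {f g : GenLoop ι X x} (h : cl f = cl g) : GenLoop.Homotopic f g :=
  Quotient.exact h
theorem cl_surj (a : HomotopyGroup ι X x) : ∃ f : GenLoop ι X x, cl f = a :=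
  Quotient.exists_rep a
theorem cl_mul (i : ι) (f g : GenLoop ι X x) : cl f * cl g = cl (GenLoop.transAt i g f) :=
  HomotopyGroup.mul_spec
theorem cl_inv (i : ι) (f : GenLoop ι X x) : (cl f)⁻¹ = cl (GenLoop.symmAt i f) :=
  HomotopyGroup.inv_spec
theorem cl_one : (1 : HomotopyGroup ι X x) = cl GenLoop.const := HomotopyGroup.one_def

theorem transAt_apply (i : ι) (f g : GenLoop ι X x) (t : ι → I) :
    GenLoop.transAt i f g t = if (t i : ℝ) ≤ 1 / 2
      then f (Function.update t i <| Set.projIcc 0 1 zero_le_one (2 * t i))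
      else g (Function.update t i <| Set.projIcc 0 1 zero_le_one (2 * t i - 1)) := rfl

theorem symmAt_apply (i : ι) (f : GenLoop ι X x) (t : ι → I) :
    GenLoop.symmAt i f t = f fun j ↦ if j = i then σ (t i) else t j := rfl

/-- pushforward of loops -/
def pushL (φ : C(X, Y)) {y : Y} (h : φ x = y) (f : GenLoop ι X x) : GenLoop ι Y y :=
  ⟨φ.comp f.1, fun v hv => by
    change φ (f v) = y
    rw [bd f hv, h]⟩

theorem pushL_apply (φ : C(X, Y)) {y : Y} (h : φ x = y) (f : GenLoop ι X x) (v) :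
    pushL φ h f v = φ (f v) := rfl

theorem pushL_htp (φ : C(X, Y)) {y : Y} (h : φ x = y) {f g : GenLoop ι X x}
    (hfg : GenLoop.Homotopic f g) : GenLoop.Homotopic (pushL φ h f) (pushL φ h g) := by
  obtain ⟨H, hc, h0, h1, hb⟩ := htp_to hfg
  exact htp_of (fun t v => φ (H t v)) (φ.continuous.comp hc) (fun v => by rw [h0]; rfl)
    (fun v => by rw [h1]; rfl) (fun t v hv => by rw [hb t v hv, h])

/-- induced hom -/
noncomputable def pushH (φ : C(X, Y)) {y : Y} (h : φ x = y) :
    HomotopyGroup ι X x →* HomotopyGroup ι Y y :=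
  MonoidHom.mk' (Quotient.map (pushL φ h) (fun _ _ hab => pushL_htp φ h hab)) (by
    intro a b
    obtain ⟨f, rfl⟩ := cl_surj a
    obtain ⟨g, rfl⟩ := cl_surj b
    have i : ι := Classical.arbitrary ι
    rw [cl_mul i]
    change cl _ = cl _ * cl _
    rw [cl_mul i]
    congr 1
    ext t
    rw [pushL_apply, transAt_apply, transAt_apply]
    split_ifs <;> rfl)

theorem pushH_cl (φ : C(X, Y)) {y : Y} (h : φ x = y) (f : GenLoop ι X x) :
    pushH φ h (cl f) = cl (pushL φ h f) := rfl

/-- excess -/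
noncomputable def mm (v : ι → I) : ℝ := ‖fun j => 2 * (v j : ℝ) - 1‖
theorem mm_cont : Continuous (mm (ι := ι)) := by unfold mm; fun_prop
theorem mm_le (v : ι → I) : mm v ≤ 1 := by
  refine (pi_norm_le_iff_of_nonneg zero_le_one).2 fun j => ?_
  rw [Real.norm_eq_abs, abs_le]
  constructor <;> linarith [(v j).2.1, (v j).2.2]
theorem mm_bd {v : ι → I} (hv : v ∈ Cube.boundary ι) : mm v = 1 := by
  apply le_antisymm (mm_le v)
  obtain ⟨j, hj⟩ := hv
  refine le_trans ?_ (norm_le_pi_norm _ j)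
  rcases hj with h | h <;> rw [h] <;> norm_num
noncomputable def cc (θ : ℝ) (v : ι → I) : ι → I :=
  fun j => projIcc 0 1 zero_le_one (1/2 + (1 + θ) * ((v j : ℝ) - 1/2))
theorem cc_cont : Continuous (fun q : ℝ × (ι → I) => cc q.1 q.2) := by
  unfold cc
  refine continuous_pi fun j => continuous_projIcc.comp ?_
  fun_prop
theorem cc_zero (v : ι → I) : cc 0 v = v := by
  funext j
  have : (1/2 + (1 + 0) * ((v j : ℝ) - 1/2)) = v j := by ring
  simp only [cc, this, projIcc_val]
theorem cc_bd {θ : ℝ} {v : ι → I} (h : 0 ≤ (1 + θ) * mm v - 1) (hθ : 0 ≤ θ) :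
    cc θ v ∈ Cube.boundary ι := by
  obtain ⟨j, hj⟩ : ∃ j, ‖2 * (v j : ℝ) - 1‖ = mm v := by
    obtain ⟨j, -, hj⟩ := Finset.exists_mem_eq_sup Finset.univ Finset.univ_nonempty
      (fun j => ‖2 * (v j : ℝ) - 1‖₊)
    refine ⟨j, ?_⟩
    unfold mm
    rw [Pi.norm_def, hj]; rfl
  rw [← hj, Real.norm_eq_abs] at h
  refine ⟨j, ?_⟩
  rcases abs_cases (2 * (v j : ℝ) - 1) with ⟨h1, h2⟩ | ⟨h1, h2⟩ <;> rw [h1] at h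
  · right; exact projIcc_of_right_le _ (by nlinarith)
  · left; exact projIcc_of_le_left _ (by nlinarith)

/-- transport along a path by time θ -/
noncomputable def Gam (p : Path x y) (f : GenLoop ι X x) (θ : I) (v : ι → I) : X :=
  if (1 + (θ : ℝ)) * mm v - 1 ≤ 0 then f (cc θ v) else p.extend ((1 + (θ : ℝ)) * mm v - 1)

theorem Gam_cont (p : Path x y) (f : GenLoop ι X x) : Continuous (uncurry (Gam p f)) := by
  unfold Gam
  have h1 : Continuous (fun q : I × (ι → I) => (1 + (q.1 : ℝ)) * mm q.2 - 1) := by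
    have := mm_cont (ι := ι)
    fun_prop
  have h2 : Continuous (fun q : I × (ι → I) => f (cc q.1 q.2)) :=
    f.1.continuous.comp (cc_cont.comp (by fun_prop : Continuous fun q : I × (ι → I) =>
      ((q.1 : ℝ), q.2)))
  refine Continuous.if_le h2 (p.continuous_extend.comp h1) h1 continuous_const ?_
  intro q hq
  change _ = p.extend _
  rw [hq, Path.extend_zero]
  exact f.2 _ (cc_bd hq.ge q.1.2.1)

/-- free homotopy along `p` -/
def Rp (p : Path x y) (f : GenLoop ι X x) (g : GenLoop ι X y) : Prop :=
  ∃ H : I → (ι → I) → X, Continuous (uncurry H) ∧ (∀ v, H 0 v = f v) ∧ (∀ v, H 1 v = g v) ∧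
    ∀ t, ∀ v ∈ Cube.boundary ι, H t v = p t

theorem Gam_bd (p : Path x y) (f : GenLoop ι X x) (θ : I) {v} (hv : v ∈ Cube.boundary ι) :
    Gam p f θ v = p θ := by
  unfold Gam
  have e : (1 + (θ : ℝ)) * mm v - 1 = θ := by rw [mm_bd hv]; ring
  split_ifs with h
  · have h0 : θ = 0 := by
      apply Subtype.ext; rw [e] at h; exact le_antisymm h θ.2.1
    subst h0; rw [p.source]; simp only [Icc.coe_zero, cc_zero]; exact bd f hv
  · rw [e, Path.extend_apply p θ.2]

theorem Rp_exists (p : Path x y) (f : GenLoop ι X x) : ∃ g, Rp p f g := by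
  refine ⟨⟨⟨Gam p f 1, (Gam_cont p f).comp (by fun_prop : Continuous fun v : ι → I =>
    ((1 : I), v))⟩, fun v hv => ?_⟩, Gam p f, Gam_cont p f, fun v => ?_, fun v => rfl,
    fun t v hv => Gam_bd p f t hv⟩
  · exact (Gam_bd p f 1 hv).trans p.target
  · unfold Gam
    rw [if_pos]
    · simp [cc_zero]
    · have := mm_le v
      simp; linarith

/-- time slice -/
def slice {x : X} (K : I → (ι → I) → X) (Kc : Continuous (uncurry K))
    (Kb : ∀ t, ∀ v ∈ Cube.boundary ι, K t v = x) (s : I) : GenLoop ι X x :=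
  ⟨⟨K s, Kc.comp (by fun_prop : Continuous fun v : ι → I => (s, v))⟩, Kb s⟩

theorem slice_htp {x : X} (K : I → (ι → I) → X) (Kc : Continuous (uncurry K))
    (Kb : ∀ t, ∀ v ∈ Cube.boundary ι, K t v = x) :
    GenLoop.Homotopic (slice K Kc Kb 0) (slice K Kc Kb 1) :=
  htp_of K Kc (fun _ => rfl) (fun _ => rfl) Kb

/-- collar homotopy -/
noncomputable def coll (p : Path x y) (H : I → (ι → I) → X) (a : I → ℝ) (s : I) (v : ι → I) : X :=
  if 2 * mm v - 1 ≤ 0 then H s (cc 1 v) else p.extend (a s + (2 * mm v - 1) * (1 - a s))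

theorem coll_cont (p : Path x y) (H : I → (ι → I) → X) (a : I → ℝ) (ha : Continuous a)
    (hc : Continuous (uncurry H)) (hb : ∀ t, ∀ v ∈ Cube.boundary ι, H t v = p.extend (a t)) :
    Continuous (uncurry (coll p H a)) := by
  have hcc : Continuous (fun q : I × (ι → I) => (q.1, cc 1 q.2)) :=
    continuous_fst.prodMk (cc_cont.comp (by fun_prop : Continuous fun q : I × (ι → I) =>
      ((1 : ℝ), q.2)))
  have hmm := mm_cont (ι := ι)
  have hm : Continuous (fun q : I × (ι → I) => 2 * mm q.2 - 1) := by
    fun_prop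
  have hm2 : Continuous (fun q : I × (ι → I) => a q.1 + (2 * mm q.2 - 1) * (1 - a q.1)) := by
    fun_prop
  refine Continuous.if_le (hc.comp hcc) (p.continuous_extend.comp hm2) hm continuous_const ?_
  rintro ⟨s, v⟩ hq
  change 2 * mm v - 1 = 0 at hq
  change H s (cc 1 v) = p.extend (a s + (2 * mm v - 1) * (1 - a s))
  rw [hq, zero_mul, add_zero]
  exact hb _ _ (cc_bd (by linarith) zero_le_one)

theorem coll_bd (p : Path x y) (H : I → (ι → I) → X) (a : I → ℝ) (t) (v)
    (hv : v ∈ Cube.boundary ι) : coll p H a t v = y := by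
  unfold coll
  rw [mm_bd hv, if_neg (by norm_num)]
  have : a t + (2 * 1 - 1) * (1 - a t) = 1 := by ring
  rw [this, Path.extend_one]

theorem Gam_eq (p : Path x y) (f : GenLoop ι X x) (H : I → (ι → I) → X) (a : I → ℝ) (s : I)
    (ha : a s = 0) (h : ∀ v, H s v = f v) (v) : coll p H a s v = Gam p f 1 v := by
  unfold coll Gam
  have e : (1 + ((1 : I) : ℝ)) * mm v - 1 = 2 * mm v - 1 := by
    rw [Icc.coe_one]; ring
  rw [e, ha, h]
  simp

theorem Rp_key (p : Path x y) {f : GenLoop ι X x} {g : GenLoop ι X y} (h : Rp p f g)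
    (γ : GenLoop ι X y) (hγ : ∀ v, γ v = Gam p f 1 v) : GenLoop.Homotopic γ g := by
  obtain ⟨H, hc, h0, h1, hb⟩ := h
  have hb' : ∀ t : I, ∀ v ∈ Cube.boundary ι, H t v = p.extend (t : ℝ) := fun t v hv => by
    rw [hb t v hv, Path.extend_apply p t.2]
  have Kc := coll_cont p H (fun t => (t : ℝ)) continuous_subtype_val hc hb'
  have Kb := coll_bd (ι := ι) p H (fun t => (t : ℝ))
  have e0 : γ = slice _ Kc Kb 0 := by
    ext v; rw [hγ]; exact (Gam_eq p f H _ 0 rfl h0 v).symm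
  have hδ : ∀ v, slice _ Kc Kb 1 v = g (cc 1 v) := by
    intro v
    change coll p H (fun t => (t : ℝ)) 1 v = _
    unfold coll
    split_ifs with h
    · rw [h1]
    · push Not at h
      rw [bd g (cc_bd (by linarith) zero_le_one)]; simp
  rw [e0]
  refine (slice_htp _ Kc Kb).trans ?_
  refine GenLoop.Homotopic.symm (htp_of (fun s v => g (cc s v)) ?_ ?_ ?_ ?_)
  · exact g.1.continuous.comp (cc_cont.comp (by fun_prop : Continuous fun q : I × (ι → I) =>
      ((q.1 : ℝ), q.2)))
  · intro v; simp [cc_zero]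
  · intro v; rw [hδ]; rfl
  · intro t v hv
    exact bd g (cc_bd (by rw [mm_bd hv]; linarith [t.2.1]) t.2.1)

theorem Rp_congr (p : Path x y) {f f' : GenLoop ι X x} {g g' : GenLoop ι X y} (h : Rp p f g)
    (h' : Rp p f' g') (hf : GenLoop.Homotopic f f') : GenLoop.Homotopic g g' := by
  obtain ⟨K, kc, k0, k1, kb⟩ := htp_to hf
  have kb' : ∀ t : I, ∀ v ∈ Cube.boundary ι, K t v = p.extend 0 := fun t v hv => by
    rw [kb t v hv, Path.extend_zero]
  have Kc := coll_cont p K (fun t => 0) continuous_const kc kb'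
  have Kb := coll_bd (ι := ι) p K (fun t => 0)
  have := slice_htp _ Kc Kb
  have h1 := Rp_key p h (slice _ Kc Kb 0) (Gam_eq p f K (fun _ => 0) 0 rfl k0)
  have h2 := Rp_key p h' (slice _ Kc Kb 1) (Gam_eq p f' K (fun _ => 0) 1 rfl k1)
  exact h1.symm.trans (this.trans h2)

theorem Rp_symm (p : Path x y) {f : GenLoop ι X x} {g : GenLoop ι X y} (h : Rp p f g) :
    Rp p.symm g f := by
  obtain ⟨H, hc, h0, h1, hb⟩ := h
  refine ⟨fun t => H (σ t), hc.comp (by fun_prop : Continuous fun q : I × (ι → I) =>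
    (σ q.1, q.2)), ?_, ?_, ?_⟩
  · simpa using h1
  · simpa using h0
  · intro t v hv; exact hb _ v hv

theorem Rp_trans (i : ι) (p : Path x y) {f f' : GenLoop ι X x} {g g' : GenLoop ι X y}
    (h : Rp p f g) (h' : Rp p f' g') : Rp p (GenLoop.transAt i f f') (GenLoop.transAt i g g') := by
  obtain ⟨H, hc, h0, h1, hb⟩ := h
  obtain ⟨H', hc', h0', h1', hb'⟩ := h'
  refine ⟨fun s t => if (t i : ℝ) ≤ 1 / 2
      then H s (Function.update t i <| Set.projIcc 0 1 zero_le_one (2 * t i))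
      else H' s (Function.update t i <| Set.projIcc 0 1 zero_le_one (2 * t i - 1)), ?_, ?_, ?_, ?_⟩
  · have a1 : Continuous (fun q : I × (ι → I) => (q.1, Function.update q.2 i <|
        Set.projIcc 0 1 (zero_le_one (α := ℝ)) (2 * q.2 i))) := by
      refine continuous_fst.prodMk (continuous_snd.update i (continuous_projIcc.comp ?_))
      fun_prop
    have a2 : Continuous (fun q : I × (ι → I) => (q.1, Function.update q.2 i <|
        Set.projIcc 0 1 (zero_le_one (α := ℝ)) (2 * q.2 i - 1))) := by
      refine continuous_fst.prodMk (continuous_snd.update i (continuous_projIcc.comp ?_))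
      fun_prop
    refine Continuous.if_le (hc.comp a1) (hc'.comp a2) (by fun_prop) continuous_const ?_
    rintro ⟨s, t⟩ hq
    change (t i : ℝ) = 1 / 2 at hq
    change H s (Function.update t i <| Set.projIcc 0 1 zero_le_one (2 * t i)) =
      H' s (Function.update t i <| Set.projIcc 0 1 zero_le_one (2 * t i - 1))
    rw [hb, hb']
    · exact ⟨i, Or.inl (by rw [Function.update_self]; exact projIcc_of_le_left _ (by linarith))⟩
    · exact ⟨i, Or.inr (by rw [Function.update_self]; exact projIcc_of_right_le _ (by linarith))⟩
  · intro v; dsimp only; rw [transAt_apply, h0, h0']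
  · intro v; dsimp only; rw [transAt_apply, h1, h1']
  · intro s v hv
    obtain ⟨j, hj⟩ := hv
    dsimp only
    by_cases hji : j = i
    · subst hji
      split_ifs with hle
      · refine hb s _ ⟨j, Or.inl ?_⟩
        rcases hj with hj | hj
        · rw [Function.update_self]; exact projIcc_of_le_left _ (by rw [hj]; simp)
        · rw [hj] at hle; norm_num at hle
      · refine hb' s _ ⟨j, Or.inr ?_⟩
        rcases hj with hj | hj
        · rw [hj] at hle; norm_num at hle
        · rw [Function.update_self]; exact projIcc_of_right_le _ (by rw [hj]; norm_num)
    · split_ifs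
      · exact hb s _ ⟨j, by rwa [Function.update_of_ne hji]⟩
      · exact hb' s _ ⟨j, by rwa [Function.update_of_ne hji]⟩

theorem baseChange (p : Path x y) : Nonempty (HomotopyGroup ι X x ≃* HomotopyGroup ι X y) := by
  choose φ hφ using fun f => Rp_exists (ι := ι) p f
  choose ψ hψ using fun f => Rp_exists (ι := ι) p.symm f
  refine ⟨MulEquiv.mk' ⟨Quotient.map φ (fun a b h => Rp_congr p (hφ a) (hφ b) h),
    Quotient.map ψ (fun a b h => Rp_congr p.symm (hψ a) (hψ b) h), ?_, ?_⟩ ?_⟩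
  · intro a
    obtain ⟨f, rfl⟩ := cl_surj a
    exact Quotient.sound (Rp_congr p.symm (hψ _) (Rp_symm p (hφ f)) (GenLoop.Homotopic.refl _))
  · intro a
    obtain ⟨f, rfl⟩ := cl_surj a
    exact Quotient.sound (Rp_congr p (hφ _) (by simpa using Rp_symm p.symm (hψ f))
      (GenLoop.Homotopic.refl _))
  · intro a b
    obtain ⟨f, rfl⟩ := cl_surj a
    obtain ⟨g, rfl⟩ := cl_surj b
    have i : ι := Classical.arbitrary ι
    rw [cl_mul i]
    change cl (φ _) = cl (φ _) * cl (φ _)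
    rw [cl_mul i]
    exact cl_eq (Rp_congr p (hφ _) (Rp_trans i p (hφ _) (hφ _)) (GenLoop.Homotopic.refl _))

theorem split_lem (i : ι) (c : ℝ) (hc0 : 0 ≤ c) (hc1 : c ≤ 1) (f fm fp : GenLoop ι X x)
    (hf : ∀ v : ι → I, (v i : ℝ) = c → f v = x)
    (hm : ∀ v : ι → I, (v i : ℝ) ≤ c → fm v = f v) (hm' : ∀ v : ι → I, c ≤ (v i : ℝ) → fm v = x)
    (hp : ∀ v : ι → I, c ≤ (v i : ℝ) → fp v = f v) (hp' : ∀ v : ι → I, (v i : ℝ) ≤ c → fp v = x) :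
    cl f = cl fp * cl fm := by
  rw [cl_mul i]
  refine (cl_eq ?_).symm
  have a1 : Continuous (fun q : I × (ι → I) => (Function.update q.2 i <|
      Set.projIcc 0 1 (zero_le_one (α := ℝ)) ((2 - (q.1 : ℝ)) * q.2 i))) := by
    refine (continuous_snd.update i (continuous_projIcc.comp ?_))
    fun_prop
  have a2 : Continuous (fun q : I × (ι → I) => (Function.update q.2 i <|
      Set.projIcc 0 1 (zero_le_one (α := ℝ)) ((2 - (q.1 : ℝ)) * q.2 i - (1 - q.1)))) := by
    refine (continuous_snd.update i (continuous_projIcc.comp ?_))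
    fun_prop
  refine htp_of (fun s t => if (t i : ℝ) ≤ 1 / 2 + s * (c - 1 / 2)
      then fm (Function.update t i <| Set.projIcc 0 1 zero_le_one ((2 - (s : ℝ)) * t i))
      else fp (Function.update t i <| Set.projIcc 0 1 zero_le_one
        ((2 - (s : ℝ)) * t i - (1 - s)))) ?_ ?_ ?_ ?_
  · refine Continuous.if_le (fm.1.continuous.comp a1) (fp.1.continuous.comp a2) (by fun_prop)
      (by fun_prop) ?_
    rintro ⟨s, t⟩ hq
    change (t i : ℝ) = _ at hq
    dsimp only at hq
    change fm (Function.update t i <| Set.projIcc 0 1 zero_le_one ((2 - (s : ℝ)) * t i)) =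
      fp (Function.update t i <| Set.projIcc 0 1 zero_le_one ((2 - (s : ℝ)) * t i - (1 - s)))
    have hs0 := s.2.1
    have hs1 := s.2.2
    have hk : 0 ≤ (1 - (s : ℝ)) * (1 - (s : ℝ) / 2) :=
      mul_nonneg (by linarith) (by linarith)
    rw [hm', hp']
    · rw [Function.update_self, coe_projIcc, hq]
      apply max_le hc0 (min_le_of_right_le _)
      nlinarith [mul_nonneg hc0 hk, mul_nonneg (sub_nonneg.2 hc1) hk,
        mul_nonneg hs0 (sub_nonneg.2 hs1)]
    · rw [Function.update_self, coe_projIcc, hq]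
      apply le_max_of_le_right (le_min hc1 _)
      nlinarith [mul_nonneg hc0 hk, mul_nonneg (sub_nonneg.2 hc1) hk,
        mul_nonneg hs0 (sub_nonneg.2 hs1)]
  · intro v; rw [transAt_apply]; simp
  · intro v
    have e1 : (2 - ((1 : I) : ℝ)) * v i = v i := by simp; ring
    have e2 : (2 - ((1 : I) : ℝ)) * v i - (1 - ((1 : I) : ℝ)) = v i := by simp; ring
    have e3 : 1 / 2 + ((1 : I) : ℝ) * (c - 1 / 2) = c := by simp
    rw [e2, e1, e3, projIcc_val, Function.update_eq_self]
    split_ifs with h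
    · exact hm v h
    · exact hp v (not_le.1 h).le
  · intro s v hv
    obtain ⟨j, hj⟩ := hv
    have hs0 := s.2.1
    have hs1 := s.2.2
    show (if _ then _ else _) = _
    by_cases hji : j = i
    · subst hji
      rcases hj with hj | hj
      · have e : (Function.update v j <| Set.projIcc 0 1 zero_le_one ((2 - (s : ℝ)) * v j)) j = 0 := by
          rw [Function.update_self, hj]; simp
        split_ifs with h
        · exact bd fm ⟨j, Or.inl e⟩
        · exfalso; apply h; rw [hj]; simp
          nlinarith
      · split_ifs with h
        · refine bd fm ⟨j, Or.inr ?_⟩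
          rw [Function.update_self, hj]
          exact projIcc_of_right_le _ (by simp; linarith)
        · refine bd fp ⟨j, Or.inr ?_⟩
          rw [Function.update_self, hj]
          exact projIcc_of_right_le _ (by simp; linarith)
    · split_ifs
      · exact bd fm ⟨j, by rwa [Function.update_of_ne hji]⟩
      · exact bd fp ⟨j, by rwa [Function.update_of_ne hji]⟩

end Gen
end CAG
namespace CAG
open Set Function unitInterval Topology.Homotopy

abbrev E (n : ℕ) := ℝ × ℝ × ℝ × (Fin (n + 1) → ℝ)

section Wild
variable {n : ℕ}

noncomputable def Phi (z : E n) : E n :=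
  (1 / (1 + z.1), 1 - Real.cos z.1 + (1 / (1 + z.1)) ^ 3 * z.2.1, (1 / (1 + z.1)) ^ 3 * z.2.2.1,
    (1 / (1 + z.1)) ^ 3 • z.2.2.2)
noncomputable def Psi (z : E n) : E n :=
  (1 / z.1 - 1, (z.2.1 - 1 + Real.cos (1 / z.1 - 1)) / z.1 ^ 3, z.2.2.1 / z.1 ^ 3,
    (z.1 ^ 3)⁻¹ • z.2.2.2)
noncomputable def qq (r : ℝ) : E n := (max r 0, max (-r) 0, 3 * max r 0 * (1 - max r 0), 0)

theorem Psi_Phi (z : E n) (hz : 0 ≤ z.1) : Psi (Phi z) = z := by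
  obtain ⟨s, l, w, a⟩ := z
  have h : (1 : ℝ) + s ≠ 0 := by simp at hz; positivity
  simp only [Psi, Phi]
  refine Prod.ext ?_ (Prod.ext ?_ (Prod.ext ?_ ?_))
  · simp
  · simp; field_simp; ring
  · simp; field_simp
  · simp; rw [smul_smul, mul_inv_cancel₀ (by positivity), one_smul]

theorem Phi_cont : ContinuousOn (Phi (n := n)) {z | 0 ≤ z.1} := by
  unfold Phi
  have : ∀ z ∈ {z : E n | 0 ≤ z.1}, 1 + z.1 ≠ 0 := fun z hz => by
    have : 0 ≤ z.1 := hz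
    positivity
  fun_prop (disch := assumption)

theorem Psi_cont : ContinuousOn (Psi (n := n)) {z | 0 < z.1} := by
  unfold Psi
  have : ∀ z ∈ {z : E n | 0 < z.1}, z.1 ≠ 0 := fun z hz => ne_of_gt hz
  have : ∀ z ∈ {z : E n | 0 < z.1}, z.1 ^ 3 ≠ 0 := fun z hz => pow_ne_zero _ (ne_of_gt hz)
  fun_prop (disch := assumption)

theorem qq_cont : Continuous (qq (n := n)) := by unfold qq; fun_prop

structure WH (T : Set (E n)) : Prop where
  h0 : (0 : E n) ∈ T
  comp : ∀ M, IsCompact (T ∩ {z | z.1 ≤ M})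
  hs : ∀ z ∈ T, 0 ≤ z.1
  l0 : ∀ z ∈ T, 0 ≤ z.2.1
  l1 : ∀ z ∈ T, z.2.1 ≤ (1 + z.1) ^ 2
  w0 : ∀ z ∈ T, 0 ≤ z.2.2.1
  w1 : ∀ z ∈ T, z.2.2.1 ≤ z.1
  a1 : ∀ z ∈ T, ‖z.2.2.2‖ ≤ (1 + z.1) ^ 2
  pc : IsPathConnected T

variable {T : Set (E n)}

def KK (T : Set (E n)) : Set (E n) := Phi '' T ∪ qq '' (Icc (-2) 1)



theorem Phi_contT (hT : WH T) : ContinuousOn Phi T := Phi_cont.mono fun z hz => hT.hs z hz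

theorem Phi_b (hT : WH T) (z : E n) (hz : z ∈ T) : 0 < (Phi z).1 ∧ (Phi z).1 ≤ 1 ∧ 0 ≤ (Phi z).2.2.1 ∧
    (Phi z).2.2.1 ≤ (Phi z).1 * (1 - (Phi z).1) ∧ ‖(Phi z).2.2.2‖ ≤ (Phi z).1 ∧
    1 - Real.cos z.1 ≤ (Phi z).2.1 ∧ (Phi z).2.1 ≤ 1 - Real.cos z.1 + (Phi z).1 := by
  have hs := hT.hs z hz
  set s' := (Phi z).1 with hs'
  have e : s' = 1 / (1 + z.1) := rfl
  have h1 : s' * (1 + z.1) = 1 := by rw [e]; field_simp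
  have hp : 0 < s' := by rw [e]; positivity
  have hle : s' ≤ 1 := by nlinarith
  have hsq : s' ^ 3 * (1 + z.1) ^ 2 = s' := by
    calc s' ^ 3 * (1 + z.1) ^ 2 = s' * (s' * (1 + z.1)) ^ 2 := by ring
      _ = s' := by rw [h1]; ring
  have hsw : s' ^ 3 * z.1 = s' ^ 2 * (1 - s') := by
    have : s' * z.1 = 1 - s' := by linarith
    calc s' ^ 3 * z.1 = s' ^ 2 * (s' * z.1) := by ring
      _ = _ := by rw [this]
  have e2 : (Phi z).2.1 = 1 - Real.cos z.1 + s' ^ 3 * z.2.1 := rfl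
  have e3 : (Phi z).2.2.1 = s' ^ 3 * z.2.2.1 := rfl
  have e4 : (Phi z).2.2.2 = s' ^ 3 • z.2.2.2 := rfl
  have p3 : 0 < s' ^ 3 := by positivity
  refine ⟨hp, hle, ?_, ?_, ?_, ?_, ?_⟩
  · rw [e3]; exact mul_nonneg p3.le (hT.w0 z hz)
  · rw [e3]
    have := mul_le_mul_of_nonneg_left (hT.w1 z hz) p3.le
    nlinarith [mul_nonneg hp.le (sub_nonneg.2 hle)]
  · rw [e4, norm_smul, Real.norm_of_nonneg p3.le]
    have := mul_le_mul_of_nonneg_left (hT.a1 z hz) p3.le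
    linarith
  · rw [e2]; linarith [mul_nonneg p3.le (hT.l0 z hz)]
  · rw [e2]; linarith [mul_le_mul_of_nonneg_left (hT.l1 z hz) p3.le]

theorem Phi_0 (hT : WH T) : Phi (0 : E n) = qq 1 := by
  simp [Phi, qq]

theorem inter_eq (hT : WH T) {z : E n} (h1 : z ∈ Phi '' T) (h2 : z ∈ qq '' (Icc (-2) 1)) : z = qq 1 := by
  obtain ⟨y, hy, rfl⟩ := h1
  obtain ⟨r, hr, hq⟩ := h2
  obtain ⟨b1, b2, b3, b4, -⟩ := Phi_b hT y hy
  rw [← hq] at b1 b2 b3 b4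
  simp only [qq] at b1 b2 b3 b4
  have hr0 : 0 < r := by
    by_contra h
    push Not at h
    rw [max_eq_right h] at b1
    exact lt_irrefl _ b1
  rw [max_eq_left hr0.le] at b4
  have : r = 1 := by nlinarith [hr.2]
  rw [← hq, this]

theorem Phi_inj (hT : WH T) {y z : E n} (hy : y ∈ T) (hz : z ∈ T) (h : Phi y = Phi z) : y = z := by
  rw [← Psi_Phi y (hT.hs y hy), h, Psi_Phi z (hT.hs z hz)]

theorem PhiT_closed (hT : WH T) (z : E n) (hz : 0 < z.1) (h : z ∈ closure (Phi '' T)) : z ∈ Phi '' T := by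
  have hc : IsCompact (Phi '' (T ∩ {y | y.1 ≤ 2 / z.1})) :=
    (hT.comp _).image_of_continuousOn ((Phi_contT hT).mono inter_subset_left)
  have : z ∈ closure (Phi '' (T ∩ {y | y.1 ≤ 2 / z.1})) := by
    have hU : {y : E n | z.1 / 2 < y.1} ∈ 𝓝 z :=
      (isOpen_lt continuous_const continuous_fst).mem_nhds (by simp; linarith)
    rw [mem_closure_iff_nhds] at h ⊢
    intro t ht
    obtain ⟨_, ⟨h1, h2⟩, ⟨y, hy, rfl⟩⟩ := h _ (Filter.inter_mem ht hU)
    refine ⟨Phi y, h1, y, ⟨hy, ?_⟩, rfl⟩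
    have h2 : z.1 / 2 < 1 / (1 + y.1) := h2
    have hs := hT.hs y hy
    have p : 0 < 1 + y.1 := by linarith
    rw [lt_div_iff₀ p] at h2
    change y.1 ≤ 2 / z.1
    rw [le_div_iff₀ hz]
    nlinarith
  rw [hc.isClosed.closure_eq] at this
  exact image_mono inter_subset_left this

theorem KK_b (hT : WH T) {z : E n} (hz : z ∈ KK T) : 0 ≤ z.1 ∧ z.1 ≤ 1 ∧ 0 ≤ z.2.2.1 ∧ z.2.2.1 ≤ 3 * z.1 ∧
    ‖z.2.2.2‖ ≤ z.1 ∧ 0 ≤ z.2.1 ∧ z.2.1 ≤ 2 + z.1 := by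
  rcases hz with ⟨y, hy, rfl⟩ | ⟨r, hr, rfl⟩
  · obtain ⟨b1, b2, b3, b4, b5, b6, b7⟩ := Phi_b hT y hy
    have := Real.cos_le_one y.1
    have := Real.neg_one_le_cos y.1
    refine ⟨b1.le, b2, b3, by nlinarith, b5, by linarith, by linarith⟩
  · have h0 : 0 ≤ max r 0 := le_max_right _ _
    have h1 : max r 0 ≤ 1 := max_le hr.2 zero_le_one
    refine ⟨h0, h1, ?_, ?_, ?_, le_max_right _ _, ?_⟩
    · simp only [qq]; nlinarith
    · simp only [qq]; nlinarith
    · simp only [qq, norm_zero]; exact h0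
    · simp only [qq]
      exact max_le (by linarith [hr.1]) (by linarith)

theorem KK_compact (hT : WH T) : IsCompact (KK T) := by
  have hq : IsCompact (qq (n := n) '' Icc (-2) 1) := isCompact_Icc.image qq_cont
  apply Metric.isCompact_of_isClosed_isBounded
  · apply isClosed_of_closure_subset
    intro z hz
    have hcl : ∀ z ∈ closure (KK T), 0 ≤ z.1 ∧ z.1 ≤ 1 ∧ 0 ≤ z.2.2.1 ∧ z.2.2.1 ≤ 3 * z.1 ∧
        ‖z.2.2.2‖ ≤ z.1 ∧ 0 ≤ z.2.1 ∧ z.2.1 ≤ 2 + z.1 := by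
      have hc : IsClosed {z : E n | 0 ≤ z.1 ∧ z.1 ≤ 1 ∧ 0 ≤ z.2.2.1 ∧ z.2.2.1 ≤ 3 * z.1 ∧
        ‖z.2.2.2‖ ≤ z.1 ∧ 0 ≤ z.2.1 ∧ z.2.1 ≤ 2 + z.1} := by
        simp only [ofPred_and]
        refine IsClosed.inter ?_ (IsClosed.inter ?_ (IsClosed.inter ?_ (IsClosed.inter ?_
          (IsClosed.inter ?_ (IsClosed.inter ?_ ?_))))) <;>
          exact isClosed_le (by fun_prop) (by fun_prop)
      exact closure_minimal (fun z hz => KK_b hT hz) hc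
    obtain ⟨b1, b2, b3, b4, b5, b6, b7⟩ := hcl z hz
    rcases b1.eq_or_lt with h | h
    · right
      refine ⟨-z.2.1, ⟨by linarith, by linarith⟩, ?_⟩
      have ha : z.2.2.2 = 0 := by rw [← norm_le_zero_iff, h]; exact b5
      have hw : z.2.2.1 = 0 := by linarith
      have hm : max (-z.2.1) 0 = 0 := max_eq_right (by linarith)
      have hm2 : max (- -z.2.1) 0 = z.2.1 := by rw [neg_neg]; exact max_eq_left b6
      simp only [qq, hm, hm2]
      refine Prod.ext h (Prod.ext rfl (Prod.ext ?_ ha.symm))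
      simp [hw]
    · rw [KK, closure_union] at hz
      rcases hz with hz | hz
      · exact Or.inl (PhiT_closed hT z h hz)
      · rw [hq.isClosed.closure_eq] at hz; exact Or.inr hz
  · rw [isBounded_iff_forall_norm_le]
    refine ⟨3, fun z hz => ?_⟩
    obtain ⟨b1, b2, b3, b4, b5, b6, b7⟩ := KK_b hT hz
    simp only [Prod.norm_def, Real.norm_eq_abs, sup_le_iff, abs_le]
    refine ⟨⟨?_, ?_⟩, ⟨?_, ?_⟩, ⟨?_, ?_⟩, ?_⟩ <;> linarith

theorem KK_pc (hT : WH T) : IsPathConnected (KK T) := by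
  refine IsPathConnected.union (hT.pc.image' (Phi_contT hT)) ?_ ⟨qq 1, ⟨0, hT.h0, Phi_0 hT⟩,
    1, ⟨by norm_num, le_refl _⟩, rfl⟩
  exact ((convex_Icc _ _).isPathConnected ⟨0, by norm_num⟩).image qq_cont

/-- wildness: the preimage of `Φ(T)` is closed -/
theorem pre_closed (hT : WH T) {W : Type*} [NormedAddCommGroup W] [NormedSpace ℝ W] (F : W → E n)
    (hF : Continuous F) (hK : ∀ p, F p ∈ KK T) : IsClosed (F ⁻¹' (Phi '' T)) := by
  apply isClosed_of_closure_subset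
  intro p hp
  have hp' : F p ∈ closure (Phi '' T) :=
    closure_mono (image_preimage_subset _ _) (image_closure_subset_closure_image hF ⟨p, hp, rfl⟩)
  by_cases hs : 0 < (F p).1
  · exact PhiT_closed hT _ hs hp'
  exfalso
  have hs0 : (F p).1 = 0 := le_antisymm (not_lt.1 hs) (KK_b hT (hK p)).1
  have h1 : Continuous fun y => (F y).1 := by fun_prop
  have h2 : Continuous fun y => (F y).2.1 := by fun_prop
  have hU : {y | (F y).1 < 1 / 2 ∧ |(F y).2.1 - (F p).2.1| < 1 / 2} ∈ 𝓝 p := by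
    have : IsOpen {y | (F y).1 < 1 / 2 ∧ |(F y).2.1 - (F p).2.1| < 1 / 2} :=
      (isOpen_lt h1 continuous_const).inter (isOpen_lt (continuous_abs.comp (h2.sub continuous_const)) continuous_const)
    exact this.mem_nhds (by simp [hs0])
  obtain ⟨ε, hε, hball⟩ := Metric.mem_nhds_iff.1 hU
  obtain ⟨y, hy, hyd⟩ := Metric.mem_closure_iff.1 hp ε hε
  have hseg : ∀ t ∈ Icc (0 : ℝ) 1, AffineMap.lineMap y p t ∈ Metric.ball p ε := by
    intro t ht
    refine (convex_ball p ε).lineMap_mem ?_ (Metric.mem_ball_self hε) ht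
    rwa [Metric.mem_ball, dist_comm]
  set γ : ℝ → E n := fun t => F (AffineMap.lineMap y p t) with hγ
  have hγc : Continuous γ := hF.comp (AffineMap.lineMap_continuous)
  have hγ0 : γ 0 = F y := by simp [hγ]
  have hγ1 : γ 1 = F p := by simp [hγ]
  have hγb : ∀ t ∈ Icc (0 : ℝ) 1, (γ t).1 < 1 / 2 ∧ |(γ t).2.1 - (F p).2.1| < 1 / 2 :=
    fun t ht => hball (hseg t ht)
  have hγK : ∀ t, γ t ∈ KK T := fun t => hK _
  obtain ⟨τ, hτ, hmin⟩ := (isCompact_Icc.inter_right (isClosed_eq (f := fun t => (γ t).1)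
    (by fun_prop) (continuous_const (y := (0 : ℝ))))).exists_isLeast
    (⟨1, ⟨zero_le_one, le_refl _⟩, by simp [hγ1, hs0]⟩ : (Icc (0 : ℝ) 1 ∩ _).Nonempty)
  have hτ0 : (γ τ).1 = 0 := hτ.2
  obtain ⟨y0, hy0, hy0'⟩ := hy
  have hpos0 : 0 < (γ 0).1 := by rw [hγ0, ← hy0']; exact (Phi_b hT y0 hy0).1
  -- dichotomy
  have hdich : ∀ t ∈ Icc (0 : ℝ) 1, 0 < (γ t).1 →
      ((γ t).2.2.1 < 2 * (γ t).1 * (1 - (γ t).1) → γ t ∈ Phi '' T) ∧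
      (γ t ∈ Phi '' T → (γ t).2.2.1 < 2 * (γ t).1 * (1 - (γ t).1)) ∧
      (γ t).2.2.1 - 2 * (γ t).1 * (1 - (γ t).1) ≠ 0 := by
    intro t ht hpos
    have hlt := (hγb t ht).1
    have hA : γ t ∈ Phi '' T → (γ t).2.2.1 < 2 * (γ t).1 * (1 - (γ t).1) := by
      rintro ⟨z, hz, hze⟩
      obtain ⟨b1, b2, b3, b4, -⟩ := Phi_b hT z hz
      rw [hze] at b4
      nlinarith
    rcases hγK t with h | ⟨r, hr, h⟩
    · refine ⟨fun _ => h, hA, ?_⟩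
      have := hA h
      intro h'; linarith
    · have e : (γ t).2.2.1 = 3 * (γ t).1 * (1 - (γ t).1) := by rw [← h]; rfl
      refine ⟨fun h' => ?_, hA, ?_⟩
      · exfalso; rw [e] at h'; nlinarith
      · rw [e]; intro h'; nlinarith
  have hposτ : ∀ t ∈ Ico (0 : ℝ) τ, 0 < (γ t).1 := by
    intro t ht
    have h0 := (KK_b hT (hγK t)).1
    rcases h0.eq_or_lt with h | h
    · exfalso
      exact not_le.2 ht.2 (hmin ⟨⟨ht.1, ht.2.le.trans hτ.1.2⟩, h.symm⟩)
    · exact h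
  have hit : ∀ v ∈ Ioo 0 (γ 0).1, ∃ t ∈ Icc (0 : ℝ) 1, (γ t).1 = v ∧ γ t ∈ Phi '' T := by
    intro v hv
    have hc1 : ContinuousOn (fun t => (γ t).1) (Icc 0 τ) := by fun_prop
    obtain ⟨t, ht, htv⟩ := intermediate_value_Icc' hτ.1.1 hc1
      (show v ∈ Icc (γ τ).1 (γ 0).1 from ⟨by rw [hτ0]; exact hv.1.le, hv.2.le⟩)
    have htv : (γ t).1 = v := htv
    have htτ : t < τ := by
      rcases ht.2.eq_or_lt with h | h
      · rw [h, hτ0] at htv; exact absurd htv.symm (ne_of_gt hv.1)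
      · exact h
    have ht1 : t ∈ Icc (0 : ℝ) 1 := ⟨ht.1, ht.2.trans hτ.1.2⟩
    refine ⟨t, ht1, htv, ?_⟩
    apply (hdich t ht1 (hposτ t ⟨ht.1, htτ⟩)).1
    by_contra hcon
    push Not at hcon
    have hc2 : ContinuousOn (fun t => (γ t).2.2.1 - 2 * (γ t).1 * (1 - (γ t).1)) (Icc 0 t) := by
      fun_prop
    have hn0 := (hdich 0 ⟨le_refl _, zero_le_one⟩ hpos0).2.1 ⟨y0, hy0, by rw [hγ0]; exact hy0'⟩
    obtain ⟨t2, ht2, he⟩ := intermediate_value_Icc ht.1 hc2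
      (show (0 : ℝ) ∈ Icc _ _ from ⟨by linarith, by linarith⟩)
    exact (hdich t2 ⟨ht2.1, ht2.2.trans ht1.2⟩
      (hposτ t2 ⟨ht2.1, ht2.2.trans_lt htτ⟩)).2.2 he
  obtain ⟨m, hm⟩ := exists_nat_gt (1 / (γ 0).1)
  have hm0 : (0 : ℝ) ≤ m := Nat.cast_nonneg m
  have hpi := Real.pi_gt_three
  have key : ∀ s : ℝ, (m : ℝ) ≤ s → ∃ t ∈ Icc (0 : ℝ) 1, ∃ z ∈ T, Phi z = γ t ∧ z.1 = s := by
    intro s hs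
    have hs1 : 0 < 1 + s := by linarith
    obtain ⟨t, ht, hv, z, hz, hze⟩ := hit (1 / (1 + s)) ⟨by positivity, by
      rw [div_lt_iff₀ hs1]
      rw [div_lt_iff₀ hpos0] at hm
      nlinarith⟩
    refine ⟨t, ht, z, hz, hze, ?_⟩
    rw [← hze] at hv
    have hv : 1 / (1 + z.1) = 1 / (1 + s) := hv
    have := hT.hs z hz
    rw [div_eq_div_iff (by positivity) (by positivity)] at hv
    linarith
  obtain ⟨ta, hta, za, hza, ea, sa⟩ := key (m * (2 * Real.pi)) (by nlinarith)
  obtain ⟨tb, htb, zb, hzb, eb, sb⟩ := key (m * (2 * Real.pi) + Real.pi) (by nlinarith)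
  have A1 := (Phi_b hT za hza).2.2.2.2.2.2
  have B1 := (Phi_b hT zb hzb).2.2.2.2.2.1
  rw [ea, sa, Real.cos_nat_mul_two_pi] at A1
  rw [eb, sb, Real.cos_nat_mul_two_pi_add_pi] at B1
  obtain ⟨a1, a2⟩ := hγb ta hta
  obtain ⟨b1, b2⟩ := hγb tb htb
  rw [abs_lt] at a2 b2
  linarith [a2.1, a2.2, b2.1, b2.2]

theorem glue2 {Z X : Type*} [TopologicalSpace Z] [TopologicalSpace X] {A B : Set Z}
    (hA : IsClosed A) (hB : IsClosed B) (hAB : ∀ z, z ∈ A ∨ z ∈ B) {f : Z → X}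
    (h1 : ContinuousOn f A) (h2 : ContinuousOn f B) : Continuous f := by
  rw [← continuousOn_univ]
  have : (univ : Set Z) = A ∪ B := by ext z; simpa using hAB z
  rw [this]
  exact h1.union_of_isClosed h2 hA hB

open Classical in
noncomputable def rho (T : Set (E n)) (z : E n) : E n := if z ∈ Phi '' T then Psi z else 0

theorem rho_Phi (hT : WH T) {z : E n} (hz : z ∈ T) : rho T (Phi z) = z := by
  unfold rho
  rw [if_pos ⟨z, hz, rfl⟩, Psi_Phi z (hT.hs z hz)]

theorem rho_mem (hT : WH T) (z : E n) : rho T z ∈ T := by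
  by_cases h : z ∈ Phi '' T
  · obtain ⟨y, hy, rfl⟩ := h
    rw [rho_Phi hT hy]; exact hy
  · unfold rho; rw [if_neg h]; exact hT.h0

theorem rho_qq (hT : WH T) {z : E n} (h2 : z ∈ qq '' (Icc (-2) 1)) : rho T z = 0 := by
  by_cases h : z ∈ Phi '' T
  · rw [inter_eq hT h h2, ← Phi_0 hT, rho_Phi hT hT.h0]
  · unfold rho; rw [if_neg h]

theorem rho_cont (hT : WH T) {Z : Type*} [TopologicalSpace Z] (F : Z → E n) (hF : Continuous F)
    (hK : ∀ p, F p ∈ KK T) (hA : IsClosed (F ⁻¹' (Phi '' T))) :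
    Continuous fun z => rho T (F z) := by
  have hq : IsCompact (qq (n := n) '' Icc (-2) 1) := isCompact_Icc.image qq_cont
  refine glue2 hA (hq.isClosed.preimage hF) (fun z => hK z) ?_ ?_
  · have : ContinuousOn (fun z => Psi (F z)) (F ⁻¹' (Phi '' T)) := by
      refine Psi_cont.comp hF.continuousOn ?_
      rintro z ⟨y, hy, h⟩
      rw [mem_ofPred_eq, ← h]
      exact (Phi_b hT y hy).1
    refine this.congr fun z hz => ?_
    unfold rho
    exact if_pos hz
  · refine (continuousOn_const (c := (0 : E n))).congr fun z hz => rho_qq hT hz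

theorem pre_closed' (hT : WH T) {ι : Type*} [Fintype ι] (F : I × (ι → I) → E n)
    (hF : Continuous F) (hK : ∀ p, F p ∈ KK T) : IsClosed (F ⁻¹' (Phi '' T)) := by
  let cl : ℝ × (ι → ℝ) → I × (ι → I) := fun q => (projIcc 0 1 zero_le_one q.1,
    fun j => projIcc 0 1 zero_le_one (q.2 j))
  have hcl : Continuous cl := by
    refine (continuous_projIcc.comp continuous_fst).prodMk (continuous_pi fun j => ?_)
    exact continuous_projIcc.comp (by fun_prop)
  let inc : I × (ι → I) → ℝ × (ι → ℝ) := fun q => (q.1, fun j => q.2 j)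
  have hinc : Continuous inc := by fun_prop
  have he : ∀ q, cl (inc q) = q := by
    intro q
    refine Prod.ext ?_ (funext fun j => ?_)
    · exact projIcc_val zero_le_one _
    · exact projIcc_val zero_le_one _
  have := (pre_closed hT (F ∘ cl) (hF.comp hcl) (fun p => hK _)).preimage hinc
  convert this using 1
  ext q
  simp only [mem_preimage, comp_apply, he]

theorem pre_closed'' (hT : WH T) {ι : Type*} [Fintype ι] (F : (ι → I) → E n)
    (hF : Continuous F) (hK : ∀ p, F p ∈ KK T) : IsClosed (F ⁻¹' (Phi '' T)) :=
  (pre_closed' hT (fun q : I × (ι → I) => F q.2) (hF.comp continuous_snd) (fun p => hK _)).preimage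
    (f := fun v => ((0 : I), v)) (by fun_prop)

/-- the map `T → K` -/
noncomputable def PhiC (hT : WH T) : C(T, KK T) :=
  ⟨fun z => ⟨Phi z.1, Or.inl ⟨z.1, z.2, rfl⟩⟩, by
    refine Continuous.subtype_mk ?_ _
    exact continuousOn_iff_continuous_domRestrict.1 (Phi_contT hT)⟩

noncomputable def bK (hT : WH T) : KK T := ⟨qq 1, Or.inr ⟨1, by norm_num, rfl⟩⟩

theorem wild_bij (hT : WH T) {ι : Type*} [Fintype ι] [DecidableEq ι] [Nonempty ι] :
    Bijective (pushH (ι := ι) (x := (⟨0, hT.h0⟩ : T)) (y := bK hT) (PhiC hT)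
      (Subtype.ext (Phi_0 hT))) := by
  constructor
  · rw [injective_iff_map_eq_one]
    intro a ha
    obtain ⟨f, rfl⟩ := cl_surj a
    rw [pushH_cl, cl_one] at ha
    obtain ⟨H, hc, h0, h1, hb⟩ := htp_to (cl_exact ha)
    rw [cl_one]
    have hFc : Continuous (fun q : I × (ι → I) => (H q.1 q.2 : E n)) :=
      continuous_subtype_val.comp hc
    have hR := rho_cont hT _ hFc (fun p => (H p.1 p.2).2) (pre_closed' hT _ hFc
      (fun p => (H p.1 p.2).2))
    refine cl_eq (htp_of (fun t v => ⟨rho T (H t v), rho_mem hT _⟩) (hR.subtype_mk _) ?_ ?_ ?_)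
    · intro v
      apply Subtype.ext
      simp only [h0]
      exact rho_Phi hT (f v).2
    · intro v
      apply Subtype.ext
      simp only [h1]
      exact rho_qq hT ⟨1, by norm_num, rfl⟩
    · intro t v hv
      apply Subtype.ext
      simp only [hb t v hv]
      exact rho_qq hT ⟨1, by norm_num, rfl⟩
  · intro a
    obtain ⟨f, rfl⟩ := cl_surj a
    have hFc : Continuous (fun v => (f v : E n)) := continuous_subtype_val.comp f.1.continuous
    have hA := pre_closed'' hT _ hFc (fun p => (f p).2)
    have hR := rho_cont hT _ hFc (fun p => (f p).2) hA
    have hq : IsCompact (qq (n := n) '' Icc (-2) 1) := isCompact_Icc.image qq_cont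
    let g : GenLoop ι T ⟨0, hT.h0⟩ := ⟨⟨fun v => ⟨rho T (f v), rho_mem hT _⟩, hR.subtype_mk _⟩, by
      intro v hv
      apply Subtype.ext
      change rho T (f v) = 0
      rw [bd f hv]
      exact rho_qq hT ⟨1, by norm_num, rfl⟩⟩
    refine ⟨cl g, ?_⟩
    rw [pushH_cl]
    symm
    classical
    let H : I → (ι → I) → E n := fun τ v => if (f v : E n) ∈ Phi '' T then (f v : E n) else
      qq ((1 - τ) * ((f v : E n).1 - (f v : E n).2.1) + τ)
    have kap : ∀ r ∈ Icc (-2 : ℝ) 1, (qq (n := n) r).1 - (qq (n := n) r).2.1 = r := by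
      intro r hr
      simp only [qq]
      rcases le_total r 0 with h | h
      · rw [max_eq_right h, max_eq_left (by linarith)]; ring
      · rw [max_eq_left h, max_eq_right (by linarith)]; ring
    have hHq : ∀ τ v, (f v : E n) ∈ qq '' Icc (-2) 1 → H τ v =
        qq ((1 - τ) * ((f v : E n).1 - (f v : E n).2.1) + τ) := by
      intro τ v hv
      simp only [H]
      split_ifs with h
      · rw [inter_eq hT h hv, kap 1 (by norm_num)]
        congr 1; ring
      · rfl
    have hHc : Continuous (fun q : I × (ι → I) => H q.1 q.2) := by
      refine glue2 (hA.preimage continuous_snd) ((hq.isClosed.preimage hFc).preimage continuous_snd)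
        (fun z => (f z.2).2) ?_ ?_
      · refine (hFc.comp continuous_snd).continuousOn.congr fun q hqA => ?_
        exact if_pos hqA
      · have : Continuous (fun q : I × (ι → I) =>
            qq (n := n) ((1 - q.1) * ((f q.2 : E n).1 - (f q.2 : E n).2.1) + q.1)) := by
          refine qq_cont.comp ?_
          have h2 : Continuous (fun q : I × (ι → I) => (f q.2 : E n)) := hFc.comp continuous_snd
          fun_prop
        exact this.continuousOn.congr fun q hqB => hHq _ _ hqB
    have hHm : ∀ τ v, H τ v ∈ KK T := by
      intro τ v
      rcases (f v).2 with h | h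
      · simp only [H, if_pos h]; exact Or.inl h
      · rw [hHq τ v h]
        obtain ⟨r, hr, h⟩ := h
        rw [← h, kap r hr]
        have := τ.2.1
        have := τ.2.2
        exact Or.inr ⟨_, ⟨by nlinarith [hr.1], by nlinarith [hr.2]⟩, rfl⟩
    refine cl_eq (htp_of (fun τ v => ⟨H τ v, hHm τ v⟩) (hHc.subtype_mk _) ?_ ?_ ?_)
    · intro v
      apply Subtype.ext
      rcases (f v).2 with h | h
      · simp only [H, if_pos h]
      · change H 0 v = _
        rw [hHq _ _ h]
        obtain ⟨r, hr, h⟩ := h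
        rw [← h, kap r hr]
        congr 1; simp
    · intro v
      apply Subtype.ext
      change H 1 v = Phi (rho T (f v))
      rcases (f v).2 with h | h
      · simp only [H, if_pos h]
        obtain ⟨y, hy, h⟩ := h
        rw [← h, rho_Phi hT hy]
      · rw [hHq _ _ h, rho_qq hT h, Phi_0 hT]
        congr 1; simp
    · intro τ v hv
      apply Subtype.ext
      change H τ v = qq 1
      have h : (f v : E n) = qq 1 := by rw [bd f hv]; rfl
      rw [hHq _ _ ⟨1, by norm_num, h.symm⟩, h, kap 1 (by norm_num)]
      congr 1; ring

theorem wild (hT : WH T) (G : Type) [Group G]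
    (e : Nonempty (HomotopyGroup (Fin (n + 1)) T ⟨0, hT.h0⟩ ≃* G)) :
    ∃ K : Set (Fin (n + 1 + 3) → ℝ), IsCompact K ∧ IsPathConnected K ∧
      ∀ x : ↥K, Nonempty ((π_ (n + 1) ↥K x) ≃* G) := by
  obtain ⟨e⟩ := e
  let L : E n ≃L[ℝ] (Fin (n + 1 + 3) → ℝ) := ContinuousLinearEquiv.ofFinrankEq (by simp; ring)
  have hpc : IsPathConnected (L '' KK T) := (KK_pc hT).image L.continuous
  refine ⟨L '' KK T, (KK_compact hT).image L.continuous, hpc, fun x => ?_⟩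
  let φ : C(KK T, L '' KK T) := ⟨fun z => ⟨L z, mem_image_of_mem _ z.2⟩, by fun_prop⟩
  have hψ : ∀ z : L '' KK T, L.symm z ∈ KK T := by
    rintro ⟨_, z, hz, rfl⟩; simpa using hz
  let ψ : C(L '' KK T, KK T) := ⟨fun z => ⟨L.symm z, hψ z⟩, by fun_prop⟩
  have h1 : ∀ z, ψ (φ z) = z := fun z => Subtype.ext (by simp [φ, ψ])
  have h2 : ∀ z, φ (ψ z) = z := fun z => Subtype.ext (by simp [φ, ψ])
  have e1 := MulEquiv.ofBijective _ (wild_bij hT (ι := Fin (n + 1)))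
  have e2 : Bijective (pushH (ι := Fin (n + 1)) φ (rfl : φ (bK hT) = φ (bK hT))) := by
    constructor
    · intro a b hab
      have := congrArg (pushH (ι := Fin (n + 1)) ψ (h1 (bK hT))) hab
      obtain ⟨f, rfl⟩ := cl_surj a
      obtain ⟨g, rfl⟩ := cl_surj b
      simp only [pushH_cl] at this
      have k : ∀ f : GenLoop (Fin (n + 1)) (KK T) (bK hT), pushL ψ (h1 (bK hT))
          (pushL φ (rfl : φ (bK hT) = φ (bK hT)) f) = f := by
        intro f; ext v : 1; exact h1 (f v)
      rwa [k, k] at this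
    · intro b
      obtain ⟨g, rfl⟩ := cl_surj b
      refine ⟨cl (pushL ψ (h1 (bK hT)) g), ?_⟩
      rw [pushH_cl]
      congr 1
      ext v : 1
      exact h2 (g v)
  have e3 := MulEquiv.ofBijective _ e2
  have : PathConnectedSpace (L '' KK T) := isPathConnected_iff_pathConnectedSpace.1 hpc
  obtain ⟨e4⟩ := baseChange (ι := Fin (n + 1)) (PathConnectedSpace.somePath x (φ (bK hT)))
  exact ⟨e4.trans (e3.symm.trans (e1.symm.trans e))⟩

end Wild
end CAG
namespace CAG
open Set Function unitInterval Topology.Homotopy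

abbrev V (n : ℕ) := Fin (n + 1) → ℝ

section Space
variable {n : ℕ}

noncomputable def bp (v : V n) : ℝ := ∏ j, max 0 (v j * (1 - v j))
noncomputable def Sp (i : ℕ) (s : ℝ) (v : V n) : E n :=
  (s, bp v, 0, bp v • (v + Pi.single 0 (i : ℝ)))
noncomputable def usc (k : ℕ) (v : V n) : V n := Function.update v 0 ((k + 1) * v 0)
noncomputable def sig (F : Finset ℕ) (u : V n) : ℝ := ∑ i ∈ F, bp (u - Pi.single 0 (i : ℝ))
noncomputable def Q (B : ℕ → Finset ℕ) (k : ℕ) (v : V n) (t : ℝ) : E n :=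
  (k + 1, t * (sig (B k) (usc k v) + t * (1 - t) * bp v), t * (1 - t) * bp v,
    (t * (sig (B k) (usc k v) + t * (1 - t) * bp v)) • usc k v)

def TT (B : ℕ → Finset ℕ) : Set (E n) := {z | 0 ≤ z.1 ∧ z.2 = 0} ∪
  {z | ∃ (i : ℕ) (s : ℝ) (v : V n), (i : ℝ) + 1 ≤ s ∧ z = Sp i s v} ∪
  {z | ∃ (k : ℕ) (v : V n) (t : ℝ), v ∈ Icc (0 : V n) 1 ∧ t ∈ Icc (0 : ℝ) 1 ∧ z = Q B k v t}

theorem bp_cont : Continuous (bp (n := n)) := by unfold bp; fun_prop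
theorem bp_nonneg (v : V n) : 0 ≤ bp v := Finset.prod_nonneg fun _ _ => le_max_left _ _
theorem bp_le (v : V n) : bp v ≤ 1 := by
  refine Finset.prod_le_one (fun _ _ => le_max_left _ _) fun j _ => max_le zero_le_one ?_
  nlinarith [sq_nonneg (v j - 1 / 2)]
theorem bp_pos {v : V n} : 0 < bp v ↔ ∀ j, 0 < v j ∧ v j < 1 := by
  unfold bp
  constructor
  · intro h j
    have h1 : max 0 (v j * (1 - v j)) ≠ 0 := by
      intro h0
      rw [Finset.prod_eq_zero (Finset.mem_univ j) h0] at h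
      exact lt_irrefl _ h
    have h2 : 0 < v j * (1 - v j) := by
      by_contra hc
      exact h1 (max_eq_left (not_lt.1 hc))
    constructor
    · by_contra hc; nlinarith
    · by_contra hc; nlinarith
  · intro h
    refine Finset.prod_pos fun j _ => ?_
    rw [lt_max_iff]; right
    exact mul_pos (h j).1 (by linarith [(h j).2])
theorem bp_zero {v : V n} (j) (h : v j ≤ 0 ∨ 1 ≤ v j) : bp v = 0 := by
  by_contra hc
  have := bp_pos.1 ((bp_nonneg v).lt_of_ne' hc) j
  rcases h with h | h <;> linarith [this.1, this.2]

theorem sig_cont (F : Finset ℕ) : Continuous (sig (n := n) F) := by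
  unfold sig
  have := bp_cont (n := n)
  fun_prop
theorem sig_nonneg (F : Finset ℕ) (u : V n) : 0 ≤ sig F u :=
  Finset.sum_nonneg fun _ _ => bp_nonneg _
theorem Sp_cont (i : ℕ) : Continuous (fun q : ℝ × V n => Sp i q.1 q.2) := by
  unfold Sp
  have := bp_cont (n := n)
  fun_prop
theorem usc_cont (k : ℕ) : Continuous (usc (n := n) k) := by
  unfold usc
  exact continuous_id.update 0 (by fun_prop)
theorem Q_cont (B : ℕ → Finset ℕ) (k : ℕ) : Continuous (fun q : V n × ℝ => Q B k q.1 q.2) := by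
  unfold Q
  have h1 := bp_cont (n := n)
  have h2 := usc_cont (n := n) k
  have h3 := sig_cont (n := n) (B k)
  fun_prop

theorem single_pos {i i' : ℕ} {u : V n} (h : 0 < bp (u - Pi.single 0 (i : ℝ)))
    (h' : 0 < bp (u - Pi.single 0 (i' : ℝ))) : i = i' := by
  have h1 := bp_pos.1 h 0
  have h2 := bp_pos.1 h' 0
  simp only [Pi.sub_apply, Pi.single_eq_same] at h1 h2
  have a : (i : ℝ) < i' + 1 := by linarith [h1.1, h2.2]
  have b : (i' : ℝ) < i + 1 := by linarith [h1.2, h2.1]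
  norm_cast at a b
  omega

theorem sig_eq {F : Finset ℕ} {i : ℕ} {u : V n} (h : 0 < bp (u - Pi.single 0 (i : ℝ))) :
    sig F u = if i ∈ F then bp (u - Pi.single 0 (i : ℝ)) else 0 := by
  unfold sig
  have hz : ∀ i' : ℕ, i' ≠ i → bp (u - Pi.single 0 (i' : ℝ)) = 0 := fun i' hi => by
    by_contra hc
    exact hi (single_pos ((bp_nonneg _).lt_of_ne' hc) h)
  split_ifs with hi
  · exact Finset.sum_eq_single i (fun i' _ h => hz i' h) (fun h => absurd hi h)
  · exact Finset.sum_eq_zero fun i' h' => hz i' (fun h => hi (h ▸ h'))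

theorem sig_pos {F : Finset ℕ} {u : V n} (h : 0 < sig F u) :
    ∃ i ∈ F, 0 < bp (u - Pi.single 0 (i : ℝ)) ∧ sig F u = bp (u - Pi.single 0 (i : ℝ)) := by
  unfold sig at h
  obtain ⟨i, hi, hp⟩ := Finset.exists_lt_of_sum_lt (f := fun _ => (0 : ℝ)) (by simpa using h)
  refine ⟨i, hi, hp, ?_⟩
  rw [sig_eq hp, if_pos hi]

theorem sig_le (F : Finset ℕ) (u : V n) : sig F u ≤ 1 := by
  rcases (sig_nonneg F u).eq_or_lt with h | h
  · rw [← h]; exact zero_le_one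
  · obtain ⟨i, _, _, he⟩ := sig_pos h
    rw [he]; exact bp_le _

theorem usc_zero (k : ℕ) (v : V n) : usc k v 0 = (k + 1) * v 0 := by simp [usc]
theorem usc_ne (k : ℕ) (v : V n) {j} (hj : j ≠ 0) : usc k v j = v j := by simp [usc, hj]

theorem sig_usc_zero {F : Finset ℕ} {k : ℕ} (hF : ∀ i ∈ F, i ≤ k) {v : V n} (h : bp v = 0) :
    sig F (usc k v) = 0 := by
  by_contra hc
  obtain ⟨i, hi, hp, -⟩ := sig_pos ((sig_nonneg F _).lt_of_ne' hc)
  rw [bp_pos] at hp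
  have : 0 < bp v := by
    rw [bp_pos]
    intro j
    have := hp j
    by_cases hj : j = 0
    · subst hj
      have hik : (i : ℝ) ≤ k := by exact_mod_cast hF i hi
      have hi0 : (0 : ℝ) ≤ i := Nat.cast_nonneg i
      simp only [Pi.sub_apply, Pi.single_eq_same, usc_zero] at this
      constructor
      · by_contra hh; nlinarith
      · by_contra hh; nlinarith
    · simpa [usc_ne k v hj, hj] using this
  exact ne_of_gt this h

variable {B : ℕ → Finset ℕ} 

theorem base_mem {s : ℝ} (h : 0 ≤ s) : ((s, 0) : E n) ∈ TT B := Or.inl (Or.inl ⟨h, rfl⟩)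
theorem Sp_mem' {i : ℕ} {s : ℝ} (v : V n) (h : (i : ℝ) + 1 ≤ s) : Sp i s v ∈ TT B :=
  Or.inl (Or.inr ⟨i, s, v, h, rfl⟩)
theorem Sp_base {i : ℕ} {s : ℝ} {v : V n} (h : bp v = 0) : Sp i s v = (s, 0) := by
  simp [Sp, h]
theorem Sp_mem {i : ℕ} {s : ℝ} (v : V n) (h0 : 0 ≤ s) (h : 0 < bp v → (i : ℝ) + 1 ≤ s) :
    Sp i s v ∈ TT B := by
  rcases (bp_nonneg v).eq_or_lt with h1 | h1
  · rw [Sp_base h1.symm]; exact base_mem h0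
  · exact Sp_mem' v (h h1)
theorem Q_base (hB : ∀ k, ∀ i ∈ B k, i ≤ k) {k : ℕ} {v : V n} {t : ℝ} (h : bp v = 0 ∨ t = 0) :
    Q B k v t = ((k : ℝ) + 1, 0) := by
  rcases h with h | h
  · simp [Q, h, sig_usc_zero (hB k) h]
  · simp [Q, h]
theorem Q_mem {k : ℕ} {v : V n} {t : ℝ} (hv : v ∈ Icc (0 : V n) 1) (ht : t ∈ Icc (0 : ℝ) 1) :
    Q B k v t ∈ TT B := Or.inr ⟨k, v, t, hv, ht, rfl⟩
theorem Q_mem' (hB : ∀ k, ∀ i ∈ B k, i ≤ k) {k : ℕ} (v : V n) {t : ℝ} (ht : t ∈ Icc (0 : ℝ) 1) :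
    Q B k v t ∈ TT B := by
  rcases (bp_nonneg v).eq_or_lt with h1 | h1
  · rw [Q_base hB (Or.inl h1.symm)]; exact base_mem (by positivity)
  · rw [bp_pos] at h1
    exact Q_mem ⟨fun j => (h1 j).1.le, fun j => (h1 j).2.le⟩ ht

/-- classification of the points of `T` -/
theorem T_cases (hB : ∀ k, ∀ i ∈ B k, i ≤ k) {z : E n} (hz : z ∈ TT B) :
    (0 ≤ z.1 ∧ z = (z.1, 0)) ∨
    (∃ (i : ℕ) (s : ℝ) (v : V n), (i : ℝ) + 1 ≤ s ∧ 0 < bp v ∧ z = Sp i s v) ∨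
    (∃ (k : ℕ) (v : V n) (t : ℝ), 0 < bp v ∧ 0 < t ∧ t < 1 ∧ z = Q B k v t) := by
  rcases hz with (⟨h1, h2⟩ | ⟨i, s, v, h1, h2⟩) | ⟨k, v, t, hv, ht, h⟩
  · left; exact ⟨h1, Prod.ext rfl h2⟩
  · rcases (bp_nonneg v).eq_or_lt with h | h
    · left
      have hi : (0 : ℝ) ≤ i := Nat.cast_nonneg i
      rw [h2, Sp_base h.symm]; exact ⟨by linarith, rfl⟩
    · right; left; exact ⟨i, s, v, h1, h, h2⟩
  · by_cases h0 : bp v = 0 ∨ t = 0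
    · left
      rw [h, Q_base hB h0]; exact ⟨by positivity, rfl⟩
    push Not at h0
    have hb := (bp_nonneg v).lt_of_ne' h0.1
    have ht0 := ht.1.lt_of_ne' h0.2
    rcases ht.2.eq_or_lt with h1 | h1
    · rcases (sig_nonneg (B k) (usc k v)).eq_or_lt with h2 | h2
      · left
        rw [h, h1]
        refine ⟨by simp [Q]; positivity, ?_⟩
        simp [Q, ← h2]
      · right; left
        obtain ⟨i, hi, hp, he⟩ := sig_pos h2
        refine ⟨i, k + 1, usc k v - Pi.single 0 (i : ℝ), ?_, hp, ?_⟩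
        · have := hB k i hi
          have : (i : ℝ) ≤ k := by exact_mod_cast this
          linarith
        · rw [h, h1]; simp [Q, Sp, he]
    · right; right; exact ⟨k, v, t, hb, ht0, h1, h⟩

theorem norm_V {v : V n} {c : ℝ} (h0 : 0 ≤ c) (h : ∀ j, 0 ≤ v j ∧ v j ≤ c) : ‖v‖ ≤ c :=
  (pi_norm_le_iff_of_nonneg h0).2 fun j => by
    rw [Real.norm_of_nonneg (h j).1]; exact (h j).2

theorem usc_bd {k : ℕ} {v : V n} (h : ∀ j, 0 ≤ v j ∧ v j ≤ 1) : 
    ∀ j, 0 ≤ usc k v j ∧ usc k v j ≤ k + 1 := by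
  intro j
  have hk : (0 : ℝ) ≤ k := Nat.cast_nonneg k
  by_cases hj : j = 0
  · subst hj
    rw [usc_zero]
    exact ⟨mul_nonneg (by linarith) (h 0).1, by nlinarith [(h 0).2]⟩
  · rw [usc_ne k v hj]; exact ⟨(h j).1, by linarith [(h j).2]⟩

theorem T_bd (hB : ∀ k, ∀ i ∈ B k, i ≤ k) {z : E n} (hz : z ∈ TT B) :
    0 ≤ z.1 ∧ 0 ≤ z.2.1 ∧ z.2.1 ≤ 2 ∧ 0 ≤ z.2.2.1 ∧ z.2.2.1 ≤ 1 ∧ z.2.2.1 ≤ z.1 ∧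
      ‖z.2.2.2‖ ≤ 2 * z.1 := by
  rcases T_cases hB hz with ⟨h1, h2⟩ | ⟨i, s, v, h1, h2, h3⟩ | ⟨k, v, t, h1, h2, h3, h4⟩
  · rw [h2]; simp [h1]
  · have hi : (0 : ℝ) ≤ i := Nat.cast_nonneg i
    have hb := bp_le v
    rw [h3]
    simp only [Sp]
    refine ⟨by linarith, h2.le, by linarith, le_refl _, zero_le_one, by linarith, ?_⟩
    rw [norm_smul, Real.norm_of_nonneg h2.le]
    have : ‖v + Pi.single 0 (i : ℝ)‖ ≤ i + 1 := by
      refine norm_V (by linarith) fun j => ?_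
      have := bp_pos.1 h2 j
      by_cases hj : j = 0
      · subst hj
        simp
        constructor <;> linarith [this.1, this.2]
      · simp [hj]
        constructor <;> linarith [this.1, this.2]
    nlinarith [norm_nonneg (v + Pi.single 0 (i : ℝ))]
  · have hk : (0 : ℝ) ≤ k := Nat.cast_nonneg k
    have hb := bp_le v
    have hs0 := sig_nonneg (B k) (usc k v)
    have hs1 := sig_le (B k) (usc k v)
    have hw0 : 0 < t * (1 - t) * bp v := mul_pos (mul_pos h2 (by linarith)) h1
    have ht : t * (1 - t) ≤ 1 := by nlinarith
    have hw1 : t * (1 - t) * bp v ≤ 1 := by nlinarith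
    have hl0 : 0 ≤ t * (sig (B k) (usc k v) + t * (1 - t) * bp v) :=
      mul_nonneg h2.le (by linarith)
    have hl1 : t * (sig (B k) (usc k v) + t * (1 - t) * bp v) ≤ 2 := by nlinarith
    rw [h4]
    simp only [Q]
    refine ⟨by linarith, hl0, hl1, hw0.le, hw1, by linarith, ?_⟩
    rw [norm_smul, Real.norm_of_nonneg hl0]
    have : ‖usc k v‖ ≤ k + 1 := norm_V (by linarith) (usc_bd fun j =>
      ⟨((bp_pos.1 h1) j).1.le, ((bp_pos.1 h1) j).2.le⟩)
    exact mul_le_mul hl1 this (norm_nonneg _) (by norm_num)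

theorem T_compact (hB : ∀ k, ∀ i ∈ B k, i ≤ k) (M : ℝ) :
    IsCompact ((TT B : Set (E n)) ∩ {z | z.1 ≤ M}) := by
  obtain ⟨m, hm⟩ := exists_nat_gt M
  have hc1 : IsCompact ((fun s : ℝ => ((s, 0) : E n)) '' Icc 0 M) :=
    isCompact_Icc.image (by fun_prop)
  have hc2 : IsCompact (⋃ i ∈ Finset.range m, (fun q : ℝ × V n => Sp i q.1 q.2) ''
      (Icc ((i : ℝ) + 1) M ×ˢ Icc (0 : V n) 1)) :=
    (Finset.range m).isCompact_biUnion fun i _ => (isCompact_Icc.prod isCompact_Icc).image (Sp_cont i)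
  have hc3 : IsCompact (⋃ k ∈ (Finset.range m).filter (fun k : ℕ => (k : ℝ) + 1 ≤ M),
      (fun q : V n × ℝ => Q B k q.1 q.2) '' (Icc (0 : V n) 1 ×ˢ Icc (0 : ℝ) 1)) :=
    Finset.isCompact_biUnion _ fun k _ => (isCompact_Icc.prod isCompact_Icc).image (Q_cont B k)
  convert (hc1.union hc2).union hc3 using 1
  ext z
  constructor
  · rintro ⟨hz, hM⟩
    have hM : z.1 ≤ M := hM
    rcases T_cases hB hz with ⟨h1, h2⟩ | ⟨i, s, v, h1, h2, h3⟩ | ⟨k, v, t, h1, h2, h3, h4⟩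
    · left; left; exact ⟨z.1, ⟨h1, hM⟩, h2.symm⟩
    · left; right
      have hsM : s ≤ M := by rw [h3] at hM; exact hM
      simp only [mem_iUnion]
      refine ⟨i, ?_, (s, v), ⟨⟨h1, hsM⟩, fun j => (bp_pos.1 h2 j).1.le,
        fun j => (bp_pos.1 h2 j).2.le⟩, h3.symm⟩
      rw [Finset.mem_range]
      have : (i : ℝ) < m := by linarith
      exact_mod_cast this
    · right
      have hsM : (k : ℝ) + 1 ≤ M := by rw [h4] at hM; exact hM
      simp only [mem_iUnion]
      refine ⟨k, ?_, (v, t), ⟨⟨fun j => (bp_pos.1 h1 j).1.le,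
        fun j => (bp_pos.1 h1 j).2.le⟩, h2.le, h3.le⟩, h4.symm⟩
      rw [Finset.mem_filter, Finset.mem_range]
      have : (k : ℝ) < m := by linarith
      exact ⟨by exact_mod_cast this, hsM⟩
  · rintro ((⟨s, hs, rfl⟩ | h) | h)
    · exact ⟨base_mem hs.1, hs.2⟩
    · simp only [mem_iUnion] at h
      obtain ⟨i, -, q, ⟨h1, h2⟩, rfl⟩ := h
      exact ⟨Sp_mem' _ h1.1, h1.2⟩
    · simp only [mem_iUnion] at h
      obtain ⟨k, hk, q, ⟨h1, h2⟩, rfl⟩ := h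
      exact ⟨Q_mem h1 h2, (Finset.mem_filter.1 hk).2⟩

theorem T_pc (hB : ∀ k, ∀ i ∈ B k, i ≤ k) : IsPathConnected (TT B : Set (E n)) := by
  have key : ∀ s : ℝ, 0 ≤ s → JoinedIn (TT B : Set (E n)) 0 (s, 0) := by
    intro s hs
    refine JoinedIn.ofLine (f := fun t : ℝ => ((t * s, 0) : E n)) (by fun_prop) ?_ ?_ ?_
    · simp
    · simp
    · rintro _ ⟨t, ht, rfl⟩; exact base_mem (mul_nonneg ht.1 hs)
  refine ⟨0, base_mem (le_refl 0), fun {z} hz => ?_⟩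
  rcases T_cases hB hz with ⟨h1, h2⟩ | ⟨i, s, v, h1, h2, h3⟩ | ⟨k, v, t, h1, h2, h3, h4⟩
  · rw [h2]; exact key _ h1
  · have hi : (0 : ℝ) ≤ i := Nat.cast_nonneg i
    refine (key s (by linarith)).trans ?_
    rw [h3]
    refine JoinedIn.ofLine (f := fun t : ℝ => Sp i s (t • v))
      ((Sp_cont i).comp (by fun_prop : Continuous fun t : ℝ => (s, t • v))).continuousOn ?_ ?_ ?_
    · exact Sp_base (bp_zero 0 (by simp))
    · simp
    · rintro _ ⟨t, ht, rfl⟩; exact Sp_mem' _ h1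
  · refine (key (k + 1) (by positivity)).trans ?_
    rw [h4]
    refine JoinedIn.ofLine (f := fun τ : ℝ => Q B k v (τ * t))
      ((Q_cont B k).comp (by fun_prop : Continuous fun τ : ℝ => (v, τ * t))).continuousOn ?_ ?_ ?_
    · exact Q_base hB (by simp)
    · simp
    · rintro _ ⟨τ, hτ, rfl⟩
      exact Q_mem' hB _ ⟨mul_nonneg hτ.1 h2.le, mul_le_one₀ hτ.2 h2.le h3.le⟩

theorem T_WH (hB : ∀ k, ∀ i ∈ B k, i ≤ k) : WH (TT B : Set (E n)) where
  h0 := base_mem (le_refl 0)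
  comp := T_compact hB
  hs z hz := (T_bd hB hz).1
  l0 z hz := (T_bd hB hz).2.1
  l1 z hz := by
    obtain ⟨h1, h2, h3, h4, h5, h6, h7⟩ := T_bd hB hz
    rcases T_cases hB hz with ⟨h1, h2⟩ | ⟨i, s, v, h1, h2, h3⟩ | ⟨k, v, t, h1, h2, h3, h4⟩
    · rw [h2]; positivity
    · have hs : (0 : ℝ) ≤ i := Nat.cast_nonneg i
      have : z.1 = s := by rw [h3]; rfl
      nlinarith
    · have hs : (0 : ℝ) ≤ k := Nat.cast_nonneg k
      have : z.1 = k + 1 := by rw [h4]; rfl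
      nlinarith
  w0 z hz := (T_bd hB hz).2.2.2.1
  w1 z hz := (T_bd hB hz).2.2.2.2.2.1
  a1 z hz := by
    obtain ⟨h1, h2, h3, h4, h5, h6, h7⟩ := T_bd hB hz
    nlinarith
  pc := T_pc hB

end Space
end CAG
namespace CAG
open Set Function unitInterval Topology.Homotopy

section Loops
variable {n : ℕ} {B : ℕ → Finset ℕ}

abbrev Cb (n : ℕ) := Fin (n + 1) → I
abbrev Pr (n : ℕ) := ℝ × ℝ × V n
def b0 (n : ℕ) (B : ℕ → Finset ℕ) : (TT B : Set (E n)) := ⟨0, base_mem (le_refl 0)⟩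
abbrev Lp (n : ℕ) (B : ℕ → Finset ℕ) := GenLoop (Fin (n + 1)) (TT B : Set (E n)) (b0 n B)
abbrev PG (n : ℕ) (B : ℕ → Finset ℕ) := HomotopyGroup (Fin (n + 1)) (TT B : Set (E n)) (b0 n B)

def rl (x : Cb n) : V n := fun j => (x j : ℝ)
theorem rl_cont : Continuous (rl (n := n)) := by unfold rl; fun_prop
theorem rl_bd {x : Cb n} (h : x ∈ Cube.boundary (Fin (n + 1))) : bp (rl x) = 0 := by
  obtain ⟨j, hj⟩ := h
  refine bp_zero j ?_
  rcases hj with h | h <;> simp [rl, h]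

def mkL (g : Cb n → E n) (hc : Continuous g) (hm : ∀ x, g x ∈ TT B)
    (hb : ∀ x ∈ Cube.boundary (Fin (n + 1)), g x = 0) : Lp n B :=
  ⟨⟨fun x => ⟨g x, hm x⟩, by fun_prop⟩, fun x hx => Subtype.ext (hb x hx)⟩

theorem L_bd (f : Lp n B) {x : Cb n} (h : x ∈ Cube.boundary (Fin (n + 1))) :
    (f x : E n) = 0 := congrArg Subtype.val (bd f h)

theorem L_cont (f : Lp n B) : Continuous (fun x => (f x : E n)) :=
  continuous_subtype_val.comp f.1.continuous

theorem mk_htp {f g : Lp n B} (H : I → Cb n → E n) (hc : Continuous (uncurry H))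
    (hm : ∀ t x, H t x ∈ TT B) (h0 : ∀ x, H 0 x = f x) (h1 : ∀ x, H 1 x = g x)
    (hb : ∀ t, ∀ x ∈ Cube.boundary (Fin (n + 1)), H t x = 0) : cl f = cl g := by
  refine cl_eq (htp_of (fun t x => ⟨H t x, hm t x⟩) ?_ (fun x => Subtype.ext (h0 x))
    (fun x => Subtype.ext (h1 x)) fun t x hx => Subtype.ext (hb t x hx))
  exact Continuous.subtype_mk hc _

def Pf (k : ℕ) (p : Pr n) : Prop := ∃ i ≤ k, ∃ v : V n, p = (Sp i 0 v).2
theorem Sp_snd (i : ℕ) (s : ℝ) (v : V n) : Sp i s v = (s, (Sp i 0 v).2) := rfl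
theorem Pf_mem {k : ℕ} {p : Pr n} (h : Pf k p) {s : ℝ} (hs : (k : ℝ) + 1 ≤ s) :
    ((s, p) : E n) ∈ TT B := by
  obtain ⟨i, hi, v, rfl⟩ := h
  have : (i : ℝ) ≤ k := by exact_mod_cast hi
  exact Sp_mem' v (by linarith)

theorem conv_mem (hB : ∀ k, ∀ i ∈ B k, i ≤ k) {z z' : E n} (hz : z ∈ TT B) (hz' : z' ∈ TT B)
    (h : z.2 = z'.2) (hw : z.2.2.1 = 0) {t : ℝ} (ht0 : 0 ≤ t) (ht1 : t ≤ 1) :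
    (((1 - t) * z.1 + t * z'.1, z.2) : E n) ∈ TT B := by
  have e1 := (T_bd hB hz).1
  have e2 := (T_bd hB hz').1
  rcases T_cases hB hz with ⟨h1, h2⟩ | ⟨i, s, v, h1, h2, h3⟩ | ⟨k, v, t', h1, h2, h3, h4⟩
  · have : z.2 = 0 := by rw [h2]
    rw [this]
    exact base_mem (by nlinarith)
  · rcases T_cases hB hz' with ⟨g1, g2⟩ | ⟨i', s', v', g1, g2, g3⟩ | ⟨k, v', t', g1, g2, g3, g4⟩
    · exfalso
      rw [h3, g2] at h
      have := congrArg (fun q => q.1) h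
      simp [Sp] at this
      linarith
    · have hl : bp v = bp v' := by
        rw [h3, g3] at h
        have := congrArg (fun q => q.1) h
        simpa [Sp] using this
      have ha : v + Pi.single 0 (i : ℝ) = v' + Pi.single 0 (i' : ℝ) := by
        rw [h3, g3] at h
        have := congrArg (fun q => q.2.2) h
        simp only [Sp] at this
        rw [hl] at this
        exact smul_right_injective _ g2.ne' this
      have hi : i = i' := by
        apply single_pos (u := v + Pi.single 0 (i : ℝ))
        · simpa using h2
        · rw [ha]; simpa using g2
      subst hi
      have : z.2 = (Sp i 0 v).2 := by rw [h3]; rfl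
      rw [this]
      have a1 : z.1 = s := by rw [h3]; rfl
      have a2 : z'.1 = s' := by rw [g3]; rfl
      rw [a1, a2]
      exact Sp_mem' v (by nlinarith)
    · exfalso
      rw [h, g4] at hw
      simp only [Q] at hw
      have : 0 < t' * (1 - t') * bp v' := mul_pos (mul_pos g2 (by linarith)) g1
      linarith
  · exfalso
    rw [h4] at hw
    simp only [Q] at hw
    have : 0 < t' * (1 - t') * bp v := mul_pos (mul_pos h2 (by linarith)) h1
    linarith

theorem adj (hB : ∀ k, ∀ i ∈ B k, i ≤ k) {f g : Lp n B} (h : ∀ x, (f x : E n).2 = (g x : E n).2)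
    (hw : ∀ x, (f x : E n).2.2.1 = 0) : cl f = cl g := by
  have hf := L_cont f
  have hg := L_cont g
  refine mk_htp (fun t x => ((1 - (t : ℝ)) * (f x : E n).1 + t * (g x : E n).1, (f x : E n).2))
    ?_ (fun t x => conv_mem hB (f x).2 (g x).2 (h x) (hw x) t.2.1 t.2.2) ?_ ?_ ?_
  · simp only [uncurry_def]; fun_prop
  · intro x; simp
  · intro x; simp [h x]
  · intro t x hx
    rw [L_bd f hx, L_bd g hx]; simp

/-- loop with a given profile -/
noncomputable def PLf (ω : Cb n → ℝ) (δ : ℝ) (k : ℕ) (P : Cb n → Pr n) (x : Cb n) : E n :=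
  ((k + 1) / δ * ω x, P x)

theorem PLf_mem {ω : Cb n → ℝ} (hω : ∀ x, 0 ≤ ω x) {δ : ℝ} (hδ : 0 < δ) {k : ℕ} {P : Cb n → Pr n}
    {x : Cb n} (h : P x = 0 ∨ (δ ≤ ω x ∧ Pf k (P x))) : PLf ω δ k P x ∈ TT B := by
  have hk : (0 : ℝ) ≤ k := Nat.cast_nonneg k
  unfold PLf
  rcases h with h | ⟨h1, h2⟩
  · rw [h]; exact base_mem (mul_nonneg (by positivity) (hω x))
  · refine Pf_mem h2 ?_
    rw [div_mul_eq_mul_div, le_div_iff₀ hδ]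
    exact mul_le_mul_of_nonneg_left h1 (by linarith)

theorem PLf_bd {ω : Cb n → ℝ} {δ : ℝ} (hδ : 0 < δ) {k : ℕ} {P : Cb n → Pr n} {x : Cb n}
    (h : P x = 0 ∨ (δ ≤ ω x ∧ Pf k (P x))) (hx : ω x = 0) : PLf ω δ k P x = 0 := by
  unfold PLf
  rcases h with h | ⟨h1, h2⟩
  · rw [h, hx]; simp
  · rw [hx] at h1; linarith

noncomputable def PLw (ω : Cb n → ℝ) (hωc : Continuous ω) (hω : ∀ x, 0 ≤ ω x)
    (hωb : ∀ x ∈ Cube.boundary (Fin (n + 1)), ω x = 0)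
    (δ : ℝ) (hδ : 0 < δ) (k : ℕ) (P : Cb n → Pr n) (hc : Continuous P)
    (h : ∀ x, P x = 0 ∨ (δ ≤ ω x ∧ Pf k (P x))) : Lp n B :=
  mkL (PLf ω δ k P) (by unfold PLf; fun_prop)
    (fun x => PLf_mem hω hδ (h x)) (fun x hx => PLf_bd hδ (h x) (hωb x hx))

noncomputable def PL (δ : ℝ) (hδ : 0 < δ) (k : ℕ) (P : Cb n → Pr n) (hc : Continuous P)
    (h : ∀ x, P x = 0 ∨ (δ ≤ bp (rl x) ∧ Pf k (P x))) : Lp n B :=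
  PLw (fun x => bp (rl x)) (bp_cont.comp rl_cont) (fun x => bp_nonneg _) (fun x hx => rl_bd hx)
    δ hδ k P hc h

theorem Pf_w {k : ℕ} {p : Pr n} (h : Pf k p) : p.2.1 = 0 := by
  obtain ⟨i, _, v, rfl⟩ := h; rfl

theorem PL_htp (hB : ∀ k, ∀ i ∈ B k, i ≤ k) {δ : ℝ} (hδ : 0 < δ) {k : ℕ} (P : I → Cb n → Pr n)
    (hc : Continuous (uncurry P)) (h : ∀ t x, P t x = 0 ∨ (δ ≤ bp (rl x) ∧ Pf k (P t x)))
    {f g : Lp n B} (hf : ∀ x, (f x : E n).2 = P 0 x) (hg : ∀ x, (g x : E n).2 = P 1 x) :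
    cl f = cl g := by
  have hPc : ∀ t, Continuous (P t) := fun t => hc.comp (by fun_prop : Continuous fun x => (t, x))
  have hw : ∀ t x, (P t x).2.1 = 0 := fun t x => by
    rcases h t x with h | ⟨_, h⟩
    · rw [h]; rfl
    · exact Pf_w h
  have a1 : cl f = cl (PL (B := B) δ hδ k (P 0) (hPc 0) (h 0)) :=
    adj hB (fun x => hf x) fun x => by rw [hf, hw]
  have a2 : cl g = cl (PL (B := B) δ hδ k (P 1) (hPc 1) (h 1)) :=
    adj hB (fun x => hg x) fun x => by rw [hg, hw]
  rw [a1, a2]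
  refine mk_htp (fun t => PLf (fun x => bp (rl x)) δ k (P t)) ?_
    (fun t x => PLf_mem (fun x => bp_nonneg _) hδ (h t x)) (fun x => rfl)
    (fun x => rfl) (fun t x hx => PLf_bd hδ (h t x) (rl_bd hx))
  unfold PLf
  have := bp_cont (n := n); have := rl_cont (n := n)
  refine Continuous.prodMk ?_ hc
  fun_prop

theorem split_pf (hB : ∀ k, ∀ i ∈ B k, i ≤ k) {δ : ℝ} (hδ : 0 < δ) {k : ℕ} {P : Cb n → Pr n}
    (hc : Continuous P) (j : Fin (n + 1)) (c : ℝ) (hc0 : 0 ≤ c) (hc1 : c ≤ 1)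
    (h : ∀ x, P x = 0 ∨ (δ ≤ bp (rl x) ∧ δ ≤ |(x j : ℝ) - c| ∧ Pf k (P x)))
    {f fm fp : Lp n B} (hf : ∀ x, (f x : E n).2 = P x)
    (hm : ∀ x, (fm x : E n).2 = if (x j : ℝ) ≤ c then P x else 0)
    (hp : ∀ x, (fp x : E n).2 = if c ≤ (x j : ℝ) then P x else 0) : cl f = cl fp * cl fm := by
  have hw : ∀ x, (P x).2.1 = 0 := fun x => by
    rcases h x with h | ⟨_, _, h⟩
    · rw [h]; rfl
    · exact Pf_w h
  have hz : ∀ x, (x j : ℝ) = c → P x = 0 := fun x hx => by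
    rcases h x with h | ⟨_, h, _⟩
    · exact h
    · rw [hx] at h; simp at h; linarith
  have b1 := bp_cont.comp (rl_cont (n := n))
  simp only [Function.comp_def] at b1
  have wc : ∀ r : ℝ → ℝ, Continuous r → Continuous fun x : Cb n => bp (rl x) * r (x j) := by
    intro r hr; fun_prop
  have wb : ∀ r : ℝ → ℝ, ∀ x ∈ Cube.boundary (Fin (n + 1)), bp (rl x) * r (x j) = 0 := by
    intro r x hx; rw [rl_bd hx, zero_mul]
  have hδ2 : 0 < δ * δ := mul_pos hδ hδ
  have c1 : Continuous fun r => |r - c| := by fun_prop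
  have c2 : Continuous fun r => max 0 (c - r) := by fun_prop
  have c3 : Continuous fun r => max 0 (r - c) := by fun_prop
  let F := PLw (B := B) _ (wc _ c1) (fun x => mul_nonneg (bp_nonneg _) (abs_nonneg _)) (wb (fun r => |r - c|))
    (δ * δ) hδ2 k P hc (fun x => (h x).imp id fun ⟨h1, h2, h3⟩ =>
      ⟨mul_le_mul h1 h2 hδ.le (bp_nonneg _), h3⟩)
  let Fm := PLw (B := B) _ (wc _ c2) (fun x => mul_nonneg (bp_nonneg _) (le_max_left _ _)) (wb (fun r => max 0 (c - r)))
    (δ * δ) hδ2 k (fun x => if (x j : ℝ) ≤ c then P x else 0)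
    (Continuous.if_le hc continuous_const (by fun_prop) (by fun_prop) hz) (fun x => by
      split_ifs with hx
      · refine (h x).imp id fun ⟨h1, h2, h3⟩ => ⟨mul_le_mul h1 ?_ hδ.le (bp_nonneg _), h3⟩
        rw [abs_of_nonpos (by linarith)] at h2
        exact le_max_of_le_right (by linarith)
      · left; rfl)
  let Fp := PLw (B := B) _ (wc _ c3) (fun x => mul_nonneg (bp_nonneg _) (le_max_left _ _)) (wb (fun r => max 0 (r - c)))
    (δ * δ) hδ2 k (fun x => if c ≤ (x j : ℝ) then P x else 0)
    (Continuous.if_le hc continuous_const (by fun_prop) (by fun_prop) (fun x hx => hz x hx.symm))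
    (fun x => by
      split_ifs with hx
      · refine (h x).imp id fun ⟨h1, h2, h3⟩ => ⟨mul_le_mul h1 ?_ hδ.le (bp_nonneg _), h3⟩
        rw [abs_of_nonneg (by linarith)] at h2
        exact le_max_of_le_right (by linarith)
      · left; rfl)
  have e1 : cl f = cl F := adj hB (fun x => hf x) fun x => by rw [hf, hw]
  have e2 : cl fm = cl Fm := adj hB (fun x => hm x) fun x => by
    rw [hm]; split_ifs
    · exact hw x
    · rfl
  have e3 : cl fp = cl Fp := adj hB (fun x => hp x) fun x => by
    rw [hp]; split_ifs
    · exact hw x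
    · rfl
  rw [e1, e2, e3]
  have vF : ∀ x, ((F x : (TT B : Set (E n))) : E n) =
    PLf (fun x => bp (rl x) * |(x j : ℝ) - c|) (δ * δ) k P x := fun x => rfl
  have vM : ∀ x, ((Fm x : (TT B : Set (E n))) : E n) = PLf (fun x => bp (rl x) *
    max 0 (c - (x j : ℝ))) (δ * δ) k (fun x => if (x j : ℝ) ≤ c then P x else 0) x := fun x => rfl
  have vP : ∀ x, ((Fp x : (TT B : Set (E n))) : E n) = PLf (fun x => bp (rl x) *
    max 0 ((x j : ℝ) - c)) (δ * δ) k (fun x => if c ≤ (x j : ℝ) then P x else 0) x := fun x => rfl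
  refine split_lem j c hc0 hc1 F Fm Fp ?_ ?_ ?_ ?_ ?_
  · intro x hx
    refine Subtype.ext ?_
    rw [vF]; change _ = (0 : E n)
    simp [PLf, hz x hx, hx]
  · intro x hx
    refine Subtype.ext ?_
    rw [vM, vF]
    simp only [PLf, if_pos hx]
    rw [abs_of_nonpos (by linarith), max_eq_right (by linarith)]
    ring_nf
  · intro x hx
    refine Subtype.ext ?_
    rw [vM]; change _ = (0 : E n)
    have : (if (x j : ℝ) ≤ c then P x else 0) = 0 := by
      split_ifs with h'
      · exact hz x (le_antisymm h' hx)
      · rfl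
    simp only [PLf, this]
    rw [max_eq_left (by linarith)]; simp
  · intro x hx
    refine Subtype.ext ?_
    rw [vP, vF]
    simp only [PLf, if_pos hx]
    rw [abs_of_nonneg (by linarith), max_eq_right (by linarith)]
  · intro x hx
    refine Subtype.ext ?_
    rw [vP]; change _ = (0 : E n)
    have : (if c ≤ (x j : ℝ) then P x else 0) = 0 := by
      split_ifs with h'
      · exact hz x (le_antisymm hx h')
      · rfl
    simp only [PLf, this]
    rw [max_eq_left (by linarith)]; simp

/-- the middle chart -/
noncomputable def mid (x : Cb n) : V n := fun j => 2 * (x j : ℝ) - 1 / 2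
theorem mid_cont : Continuous (mid (n := n)) := by unfold mid; fun_prop
noncomputable def dn (n : ℕ) : ℝ := (3 / 16) ^ (n + 1)
theorem dn_pos : 0 < dn n := by unfold dn; positivity
theorem dn_le {x : Cb n} (h : ∀ j, 0 < mid x j ∧ mid x j < 1) : dn n ≤ bp (rl x) := by
  unfold dn bp
  have : (3 / 16 : ℝ) ^ (n + 1) = ∏ j : Fin (n + 1), (3 / 16 : ℝ) := by
    rw [Finset.prod_const]; simp
  rw [this]
  refine Finset.prod_le_prod (fun _ _ => by norm_num) fun j _ => le_max_of_le_right ?_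
  obtain ⟨h1, h2⟩ := h j
  simp only [mid, rl] at *
  nlinarith

theorem Sp_snd0 {i : ℕ} {s : ℝ} {v : V n} (h : ¬ 0 < bp v) : (Sp i s v).2 = 0 := by
  rw [Sp_base (le_antisymm (not_lt.1 h) (bp_nonneg v))]
theorem Sp_ok {i k : ℕ} {δ : ℝ} {x : Cb n} {v : V n} (hik : i ≤ k) 
    (h : 0 < bp v → δ ≤ bp (rl x)) :
    (Sp i 0 v).2 = 0 ∨ (δ ≤ bp (rl x) ∧ Pf k (Sp i 0 v).2) := by
  by_cases hv : 0 < bp v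
  · right; exact ⟨h hv, i, hik, v, rfl⟩
  · left; exact Sp_snd0 hv

theorem Sp_cont' {Y : Type*} [TopologicalSpace Y] (i : ℕ) {g : Y → V n} (hg : Continuous g) :
    Continuous (fun y => (Sp i 0 (g y)).2) :=
  continuous_snd.comp ((Sp_cont i).comp (by fun_prop : Continuous fun y => ((0 : ℝ), g y)))

noncomputable def eL (B : ℕ → Finset ℕ) (i : ℕ) : Lp n B :=
  PL (dn n) dn_pos i (fun x => (Sp i 0 (mid x)).2) (Sp_cont' i mid_cont)
    fun x => Sp_ok le_rfl fun h => dn_le (bp_pos.1 h)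

/-- sheet profiles -/
noncomputable def dil (μ : ℝ) (v : V n) : V n := fun j => 1 / 2 + μ * (v j - 1 / 2)
theorem dil_cont : Continuous (fun q : ℝ × V n => dil q.1 q.2) := by unfold dil; fun_prop
theorem dil_one (v : V n) : dil 1 v = v := by ext j; simp [dil]
theorem dil_bp {μ : ℝ} (hμ : 1 ≤ μ) {v : V n} (h : 0 < bp (dil μ v)) : 0 < bp v := by
  rw [bp_pos] at *
  intro j
  have := h j
  simp only [dil] at this
  constructor <;> nlinarith [this.1, this.2]

noncomputable def SP (μ : ℝ) (F : Finset ℕ) (k : ℕ) (x : Cb n) : Pr n :=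
  ∑ i ∈ F, (Sp i 0 (dil μ (usc k (mid x) - Pi.single 0 (i : ℝ)))).2
theorem SP_cont (F : Finset ℕ) (k : ℕ) :
    Continuous (fun q : ℝ × Cb n => SP q.1 F k q.2) := by
  unfold SP
  have h1 := usc_cont (n := n) k
  have h2 := mid_cont (n := n)
  refine continuous_finsetSum _ fun i _ => Sp_cont' i ?_
  exact dil_cont.comp (by fun_prop : Continuous fun q : ℝ × Cb n =>
    (q.1, usc k (mid q.2) - Pi.single 0 (i : ℝ)))

theorem SP_cont1 (μ : ℝ) (F : Finset ℕ) (k : ℕ) : Continuous (SP (n := n) μ F k) := by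
  have h := (SP_cont (n := n) F k).comp (by fun_prop : Continuous fun x : Cb n => (μ, x))
  exact h

theorem SP_at {μ : ℝ} (hμ : 1 ≤ μ) (F : Finset ℕ) (k : ℕ) (x : Cb n) : SP μ F k x = 0 ∨
    ∃ i ∈ F, 0 < bp (dil μ (usc k (mid x) - Pi.single 0 (i : ℝ))) ∧
      SP μ F k x = (Sp i 0 (dil μ (usc k (mid x) - Pi.single 0 (i : ℝ)))).2 := by
  by_cases h : ∃ i ∈ F, 0 < bp (dil μ (usc k (mid x) - Pi.single 0 (i : ℝ)))
  · obtain ⟨i, hi, h⟩ := h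
    refine Or.inr ⟨i, hi, h, Finset.sum_eq_single i (fun i' _ hne => Sp_snd0 fun h' => hne ?_)
      fun h => absurd hi h⟩
    exact single_pos (dil_bp hμ h') (dil_bp hμ h)
  · push Not at h
    exact Or.inl (Finset.sum_eq_zero fun i hi => Sp_snd0 (not_lt.2 (h i hi)))

theorem SP_ok {μ : ℝ} (hμ : 1 ≤ μ) {F : Finset ℕ} {k : ℕ} (hF : ∀ i ∈ F, i ≤ k) (x : Cb n) :
    SP μ F k x = 0 ∨ (dn n ≤ bp (rl x) ∧ Pf k (SP μ F k x)) := by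
  rcases SP_at hμ F k x with h | ⟨i, hi, hp, he⟩
  · exact Or.inl h
  · right
    have hm : 0 < bp (mid x) := by
      refine (bp_nonneg _).lt_of_ne' fun h0 => ?_
      have h1 := sig_usc_zero hF h0
      rw [sig_eq (dil_bp hμ hp), if_pos hi] at h1
      exact absurd h1 (dil_bp hμ hp).ne'
    exact ⟨dn_le (bp_pos.1 hm), i, hF i hi, _, he⟩

theorem SP_one (F : Finset ℕ) (k : ℕ) (x : Cb n) : SP 1 F k x =
    (sig F (usc k (mid x)), 0, sig F (usc k (mid x)) • usc k (mid x)) := by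
  rcases (sig_nonneg F (usc k (mid x))).eq_or_lt with h | h
  · rw [← h]
    unfold sig at h
    rw [eq_comm, Finset.sum_eq_zero_iff_of_nonneg (fun _ _ => bp_nonneg _)] at h
    unfold SP
    rw [Finset.sum_eq_zero]
    · simp; rfl
    · intro i hi; rw [dil_one]; exact Sp_snd0 (by rw [h i hi]; exact lt_irrefl _)
  · obtain ⟨i, hi, hp, he⟩ := sig_pos h
    rcases SP_at le_rfl F k x with h' | ⟨i', hi', hp', he'⟩
    · exfalso
      have : (SP 1 F k x).1 = sig F (usc k (mid x)) := by
        unfold SP sig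
        rw [Prod.fst_sum]
        refine Finset.sum_congr rfl fun i _ => ?_
        rw [dil_one]; rfl
      rw [h'] at this
      rw [← this] at h
      exact lt_irrefl _ h
    · rw [dil_one] at hp' he'
      rw [he', ← single_pos hp hp']
      simp [Sp, he]

noncomputable def sL (B : ℕ → Finset ℕ) (F : Finset ℕ) (k : ℕ) (hF : ∀ i ∈ F, i ≤ k) : Lp n B :=
  PL (dn n) dn_pos k (SP 1 F k) (SP_cont1 1 F k)
    (SP_ok le_rfl hF)

theorem sL_empty (hB : ∀ k, ∀ i ∈ B k, i ≤ k) (k : ℕ) :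
    cl (sL (n := n) B ∅ k (by simp)) = 1 := by
  rw [cl_one]
  refine adj hB (fun x => ?_) fun x => ?_
  · change SP 1 ∅ k x = 0; simp [SP]
  · change (SP 1 ∅ k x).2.1 = 0; simp [SP]

theorem sL_single (hB : ∀ k, ∀ i ∈ B k, i ≤ k) {k m : ℕ} (hm : m ≤ k) :
    cl (sL (n := n) B {m} k (by simpa using hm)) = cl (eL (n := n) B m) := by
  have hk : (m : ℝ) ≤ k := by exact_mod_cast hm
  have hm0 : (0 : ℝ) ≤ m := Nat.cast_nonneg m
  refine PL_htp hB (δ := dn n) dn_pos (k := k) (fun t x => (Sp m 0 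
      ((1 - (t : ℝ)) • (usc k (mid x) - Pi.single 0 (m : ℝ)) + (t : ℝ) • mid x)).2)
    ?_ ?_ ?_ ?_
  · simp only [uncurry_def]
    have := usc_cont (n := n) k
    have := mid_cont (n := n)
    exact Sp_cont' m (by fun_prop)
  · intro t x
    refine Sp_ok hm fun h => dn_le fun j => ?_
    have h1 := bp_pos.1 h j
    have t0 := t.2.1
    have t1 := t.2.2
    by_cases hj : j = 0
    · subst hj
      simp only [Pi.add_apply, Pi.smul_apply, Pi.sub_apply, Pi.single_eq_same, smul_eq_mul,
        usc_zero] at h1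
      constructor
      · by_contra hc
        push Not at hc
        have : ((k : ℝ) + 1) * mid x 0 - m ≤ 0 := by nlinarith
        nlinarith [h1.1]
      · by_contra hc
        push Not at hc
        have : 1 ≤ ((k : ℝ) + 1) * mid x 0 - m := by nlinarith
        nlinarith [h1.2]
    · simp only [Pi.add_apply, Pi.smul_apply, Pi.sub_apply, smul_eq_mul,
        usc_ne k _ hj, Pi.single_eq_of_ne hj] at h1
      constructor <;> nlinarith [h1.1, h1.2]
  · intro x
    change SP 1 {m} k x = _
    simp [SP, dil_one]
  · intro x
    change (Sp m 0 (mid x)).2 = _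
    simp

noncomputable def sL2 (B : ℕ → Finset ℕ) (F : Finset ℕ) (k : ℕ) (hF : ∀ i ∈ F, i ≤ k) : Lp n B :=
  PL (dn n) dn_pos k (SP 2 F k) (SP_cont1 2 F k)
    (SP_ok (by norm_num) hF)

theorem sL_two (hB : ∀ k, ∀ i ∈ B k, i ≤ k) {F : Finset ℕ} {k : ℕ} (hF : ∀ i ∈ F, i ≤ k) :
    cl (sL (n := n) B F k hF) = cl (sL2 B F k hF) := by
  refine PL_htp hB (δ := dn n) dn_pos (k := k) (fun t x => SP (1 + t) F k x) ?_ 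
    (fun t x => SP_ok (by linarith [t.2.1]) hF x) ?_ ?_
  · have h := (SP_cont (n := n) F k).comp (by fun_prop : Continuous fun q : I × Cb n => ((1 : ℝ) + q.1, q.2))
    exact h
  · intro x
    change SP 1 F k x = _
    simp
  · intro x
    change SP 2 F k x = _
    norm_num

theorem sL_insert (hB : ∀ k, ∀ i ∈ B k, i ≤ k) {F : Finset ℕ} {k m : ℕ} (hm : m ≤ k)
    (hF : ∀ i ∈ F, i < m) (h1 : ∀ i ∈ insert m F, i ≤ k) (h2 : ∀ i ∈ F, i ≤ k) :
    cl (sL (n := n) B (insert m F) k h1) = cl (eL (n := n) B m) * cl (sL (n := n) B F k h2) := by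
  rw [← sL_single hB hm, sL_two hB, sL_two hB, sL_two hB]
  have hk : (m : ℝ) ≤ k := by exact_mod_cast hm
  have hm0 : (0 : ℝ) ≤ m := Nat.cast_nonneg m
  have hmF : m ∉ F := fun h => lt_irrefl _ (hF m h)
  have hk1 : (0 : ℝ) < k + 1 := by positivity
  -- the cutting value
  set c : ℝ := (m / (k + 1) + 1 / 2) / 2 with hc
  have hmk : (m : ℝ) / (k + 1) ≤ 1 := by rw [div_le_one hk1]; linarith
  have hmk0 : (0 : ℝ) ≤ (m : ℝ) / (k + 1) := by positivity
  have hsc : ((m : ℝ) / (k + 1)) * (k + 1) = m := div_mul_cancel₀ _ hk1.ne'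
  have hu : ∀ x : Cb n, usc k (mid x) 0 - m = 2 * (k + 1) * (x 0 - c) := by
    intro x
    rw [usc_zero, hc]
    simp only [mid]
    linear_combination hsc
  have hadd : ∀ x : Cb n, SP 2 (insert m F) k x = SP 2 {m} k x + SP 2 F k x := by
    intro u
    unfold SP
    rw [Finset.sum_insert hmF, Finset.sum_singleton]
  have zF : ∀ x : Cb n, c ≤ x 0 → SP 2 F k x = 0 := by
    intro x hx
    refine Finset.sum_eq_zero fun i hi => Sp_snd0 fun h => ?_
    have h := (bp_pos.1 h 0).2
    have : (i : ℝ) + 1 ≤ m := by exact_mod_cast hF i hi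
    have := hu x
    simp [dil] at h
    nlinarith
  have zm : ∀ x : Cb n, (x 0 : ℝ) ≤ c → SP 2 {m} k x = 0 := by
    intro x hx
    refine Finset.sum_eq_zero fun i hi => Sp_snd0 fun h => ?_
    have h := (bp_pos.1 h 0).1
    rw [Finset.mem_singleton.1 hi] at h
    have := hu x
    simp [dil] at h
    nlinarith
  have hδ : 0 < min (dn n) (1 / (8 * (k + 1))) := lt_min dn_pos (by positivity)
  refine split_pf hB hδ (k := k) (P := SP 2 (insert m F) k) 
    (SP_cont1 2 _ k)
    0 c (by rw [hc]; linarith) (by rw [hc]; linarith) ?_ (fun x => rfl) ?_ ?_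
  · intro x
    rcases SP_at (by norm_num : (1 : ℝ) ≤ 2) (insert m F) k x with h | ⟨i, hi, hp, he⟩
    · exact Or.inl h
    rcases SP_ok (by norm_num : (1 : ℝ) ≤ 2) h1 x with h | ⟨h, h'⟩
    · exact Or.inl h
    refine Or.inr ⟨(min_le_left _ _).trans h, (min_le_right _ _).trans ?_, h'⟩
    rw [div_le_iff₀ (by positivity)]
    have h2 := bp_pos.1 hp 0
    have h3 := hu x
    simp [dil] at h2
    rcases Finset.mem_insert.1 hi with rfl | hi
    · have : 0 ≤ (x 0 : ℝ) - c := by nlinarith [h2.1]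
      rw [abs_of_nonneg this]; nlinarith [h2.1]
    · have : (i : ℝ) + 1 ≤ m := by exact_mod_cast hF i hi
      have : (x 0 : ℝ) - c ≤ 0 := by nlinarith [h2.2]
      rw [abs_of_nonpos this]; nlinarith [h2.2]
  · intro x
    change SP 2 F k x = _
    split_ifs with hx
    · rw [hadd, zm x hx, zero_add]
    · exact zF x (not_le.1 hx).le
  · intro x
    change SP 2 {m} k x = _
    split_ifs with hx
    · rw [hadd, zF x hx, add_zero]
    · exact zm x (not_le.1 hx).le

theorem sL_null (hB : ∀ k, ∀ i ∈ B k, i ≤ k) (k : ℕ) : cl (sL (n := n) B (B k) k (hB k)) = 1 := by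
  have hk1 : (0 : ℝ) < k + 1 := by positivity
  have h1 := bp_cont (n := n); have h2 := rl_cont (n := n)
  have hδ := dn_pos (n := n)
  let ss : Cb n → ℝ := fun x => min (k + 1) ((k + 1) / dn n * bp (rl x))
  have ssc : Continuous ss := by fun_prop
  have ss0 : ∀ x, 0 ≤ ss x := fun x =>
    le_min hk1.le (mul_nonneg (by positivity) (bp_nonneg _))
  have ssb : ∀ x ∈ Cube.boundary (Fin (n + 1)), ss x = 0 := fun x hx => by
    simp only [ss, rl_bd hx, mul_zero]
    exact min_eq_right hk1.le
  let H : I → Cb n → E n := fun t x => (ss x, (Q B k (mid x) (1 - t)).2)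
  have Hc : Continuous (uncurry H) := by
    refine Continuous.prodMk (by fun_prop) (continuous_snd.comp ?_)
    have h3 := mid_cont (n := n)
    exact (Q_cont B k).comp (by fun_prop : Continuous fun q : I × Cb n => (mid q.2, 1 - (q.1 : ℝ)))
  have Hm : ∀ t x, H t x ∈ TT B := by
    intro t x
    rcases (bp_nonneg (mid x)).eq_or_lt with h | h
    · simp only [H, Q_base hB (Or.inl h.symm)]
      exact base_mem (ss0 x)
    · have : ss x = k + 1 := by
        refine min_eq_left ?_
        have := dn_le (bp_pos.1 h)
        rw [div_mul_eq_mul_div, le_div_iff₀ hδ]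
        exact mul_le_mul_of_nonneg_left this hk1.le
      simp only [H, this]
      exact Q_mem' hB (mid x) ⟨by linarith [t.2.2], by linarith [t.2.1]⟩
  have Hb : ∀ t, ∀ x ∈ Cube.boundary (Fin (n + 1)), H t x = 0 := by
    intro t x hx
    have : bp (mid x) = 0 := by
      obtain ⟨j, hj⟩ := hx
      refine bp_zero j ?_
      rcases hj with h | h
      · left; simp [mid, h]
      · right; simp [mid, h]; norm_num
    simp only [H, Q_base hB (Or.inl this), ssb x hx]
    rfl
  have Hct : ∀ t, Continuous (H t) := fun t => Hc.comp (by fun_prop : Continuous fun x => (t, x))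
  have e1 : cl (mkL (B := B) (H 0) (Hct 0) (Hm 0) (Hb 0)) = cl (mkL (B := B) (H 1) (Hct 1) (Hm 1) (Hb 1)) :=
    mk_htp H Hc Hm (fun x => rfl) (fun x => rfl) Hb
  have e2 : cl (sL (n := n) B (B k) k (hB k)) = cl (mkL (B := B) (H 0) (Hct 0) (Hm 0) (Hb 0)) := by
    have a : ∀ x : Cb n, SP 1 (B k) k x = (Q B k (mid x) (1 - ((0 : I) : ℝ))).2 := by
      intro x
      rw [SP_one]; simp [Q]
    refine adj hB (fun x => a x) fun x => ?_
    change (SP 1 (B k) k x).2.1 = 0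
    rw [SP_one]
  have e3 : cl (mkL (B := B) (H 1) (Hct 1) (Hm 1) (Hb 1)) = 1 := by
    rw [cl_one]
    refine adj hB (fun x => ?_) fun x => ?_
    · change (Q B k (mid x) (1 - ((1 : I) : ℝ))).2 = 0
      simp [Q]
    · change (Q B k (mid x) (1 - ((1 : I) : ℝ))).2.2.1 = 0
      simp [Q]
  rw [e2, e1, e3]

theorem rel2 (hB : ∀ k, ∀ i ∈ B k, i ≤ k) {k i j : ℕ} (h : B k = {i, j}) (hij : j < i) :
    cl (eL (n := n) B i) * cl (eL (n := n) B j) = 1 := by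
  have h1 := hB k
  have h0 := sL_null (n := n) hB k
  have hi : i ≤ k := h1 i (by simp [h])
  have hj : j ≤ k := h1 j (by simp [h])
  have e : ∀ F (hF : B k = F) (h' : ∀ i ∈ F, i ≤ k), cl (sL (n := n) B F k h') = 1 := by
    rintro F rfl h'; exact h0
  have := e {i, j} h (by rw [← h]; exact h1)
  rw [sL_insert hB hi (by simpa using hij) _ (by simpa using hj), sL_single hB hj] at this
  exact this

theorem rel3 (hB : ∀ k, ∀ i ∈ B k, i ≤ k) {k i j l : ℕ} (h : B k = {i, j, l}) (hij : j < i)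
    (hjl : l < j) :
    cl (eL (n := n) B i) * (cl (eL (n := n) B j) * cl (eL (n := n) B l)) = 1 := by
  have h1 := hB k
  have h0 := sL_null (n := n) hB k
  have hi : i ≤ k := h1 i (by simp [h])
  have hj : j ≤ k := h1 j (by simp [h])
  have hl : l ≤ k := h1 l (by simp [h])
  have e : ∀ F (hF : B k = F) (h' : ∀ i ∈ F, i ≤ k), cl (sL (n := n) B F k h') = 1 := by
    rintro F rfl h'; exact h0
  have := e {i, j, l} h (by rw [← h]; exact h1)
  rw [sL_insert hB hi (by simp; omega) _ (by simp; omega),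
    sL_insert hB hj (by simpa using hjl) _ (by simpa using hl), sL_single hB hl] at this
  exact this

/-- the homomorphism from `G` -/
theorem eHom (hB : ∀ k, ∀ i ∈ B k, i ≤ k) {G : Type*} [CommGroup G] (x : ℕ → G)
    (hx : ∀ g m, ∃ i, m < i ∧ x i = g)
    (hF : ∀ F : Finset ℕ, ∏ i ∈ F, x i = 1 → ∃ k, B k = F) :
    ∃ e : G →* PG n B, ∀ i, e (x i) = cl (eL (n := n) B i) := by
  have r2 : ∀ i j, j < i → x i * x j = 1 → cl (eL (n := n) B i) * cl (eL (n := n) B j) = 1 := by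
    intro i j hij h
    obtain ⟨k, hk⟩ := hF {i, j} (by rw [Finset.prod_pair hij.ne']; exact h)
    exact rel2 hB hk hij
  have r3 : ∀ i j l, j < i → l < j → x i * (x j * x l) = 1 →
      cl (eL (n := n) B i) * (cl (eL (n := n) B j) * cl (eL (n := n) B l)) = 1 := by
    intro i j l hij hjl h
    obtain ⟨k, hk⟩ := hF {i, j, l} (by
      rw [Finset.prod_insert (by simp; omega), Finset.prod_pair hjl.ne']; exact h)
    exact rel3 hB hk hij hjl
  have dep : ∀ i j, x i = x j → cl (eL (n := n) B i) = cl (eL (n := n) B j) := by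
    intro i j h
    obtain ⟨l, hl, hlx⟩ := hx (x i)⁻¹ (max i j)
    have a := r2 l i (by omega) (by rw [hlx]; simp)
    have b := r2 l j (by omega) (by rw [hlx, h]; simp)
    exact mul_left_cancel (a.trans b.symm)
  choose ix hix using fun g => hx g 0
  refine ⟨MonoidHom.mk' (fun g => cl (eL (n := n) B (ix g))) ?_, fun i => dep _ _ (hix _).2⟩
  intro g h
  obtain ⟨l, hl, hlx⟩ := hx (g * h)⁻¹ 0
  obtain ⟨j, hj, hjx⟩ := hx h l
  obtain ⟨i, hi, hix'⟩ := hx g j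
  obtain ⟨i', hi', hix''⟩ := hx (g * h) l
  have a := r3 i j l hi hj (by rw [hix', hjx, hlx]; group)
  have b := r2 i' l hi' (by rw [hix'', hlx]; group)
  rw [← mul_assoc] at a
  have := mul_right_cancel (a.trans b.symm)
  rw [dep (ix (g * h)) i' (by rw [(hix _).2, hix'']), dep (ix g) i (by rw [(hix _).2, hix']),
    dep (ix h) j (by rw [(hix _).2, hjx]), this]
end Loops
end CAG
namespace CAG
open Set Function unitInterval Topology.Homotopy

section Kuhn
variable {X R : Type*} [CommRing R]

/-- the `l`-th face of a sequence -/
def fc (l : ℕ) (y : ℕ → X) : ℕ → X := fun r => if r < l then y r else y (r + 1)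

theorem cup_cocycle (N : ℕ) (f : ℕ → X → R) (y : ℕ → X) :
    ∑ l ∈ Finset.range (N + 2), (-1 : R) ^ l *
      ∏ r ∈ Finset.range N, (f r (fc l y (r + 1)) - f r (fc l y r)) = 0 := by
  set p : ℕ → R := fun r => f r (y (r + 1)) - f r (y r) with hp
  set q : ℕ → R := fun r => f r (y (r + 2)) - f r (y (r + 1)) with hq
  set X : ℕ → R := fun L => ∏ r ∈ Finset.range N, (if r < L then p r else q r) with hX
  have key : ∀ L, L ≤ N → ∑ l ∈ Finset.range (L + 1), (-1 : R) ^ l *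
      ∏ r ∈ Finset.range N, (f r (fc l y (r + 1)) - f r (fc l y r)) = (-1) ^ L * X L := by
    intro L
    induction L with
    | zero =>
      intro _
      simp [hX, fc, hq]
    | succ L ih =>
      intro hL
      rw [Finset.sum_range_succ, ih (by omega)]
      have : X L + X (L + 1) =
          ∏ r ∈ Finset.range N, (f r (fc (L + 1) y (r + 1)) - f r (fc (L + 1) y r)) := by
        refine Finset.prod_add_prod_eq (i := L) (by simp; omega) ?_ ?_ ?_
        · simp [fc, hp, hq]
        · intro j _ hj
          rcases lt_or_gt_of_ne hj with h | h
          · rw [if_pos h]; simp [fc, hp, h, h.trans (Nat.lt_succ_self L)]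
          · rw [if_neg (by omega)]
            simp [fc, hq, show ¬ (j < L) by omega, show ¬ (j < L + 1) by omega]
        · intro j _ hj
          rcases lt_or_gt_of_ne hj with h | h
          · rw [if_pos (by omega)]; simp [fc, hp, h, h.trans (Nat.lt_succ_self L)]
          · rw [if_neg (by omega)]
            simp [fc, hq, show ¬ (j < L) by omega, show ¬ (j < L + 1) by omega]
      rw [← this]
      ring
  rw [Finset.sum_range_succ, key N le_rfl]
  have : ∏ r ∈ Finset.range N, (f r (fc (N + 1) y (r + 1)) - f r (fc (N + 1) y r)) = X N := by
    refine Finset.prod_congr rfl fun r hr => ?_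
    rw [Finset.mem_range] at hr
    rw [if_pos hr]; simp [fc, hp, hr, hr.trans (Nat.lt_succ_self N)]
  rw [this]; ring

def pv {N : ℕ} (b : Fin (N + 1) → ℕ) (τ : Equiv.Perm (Fin (N + 1))) (l : ℕ) : Fin (N + 1) → ℕ :=
  fun j => b j + if (τ.symm j : ℕ) < l then 1 else 0

theorem pv_swap {N : ℕ} (b : Fin (N + 1) → ℕ) (τ : Equiv.Perm (Fin (N + 1))) (l : ℕ)
    (hl : l + 1 < N + 1) (r : ℕ) (hr : r ≠ l + 1) :
    pv b (τ * Equiv.swap (⟨l, by omega⟩ : Fin (N + 1)) ⟨l + 1, hl⟩) r = pv b τ r := by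
  funext j
  unfold pv
  congr 1
  have : (τ * Equiv.swap (⟨l, by omega⟩ : Fin (N + 1)) ⟨l + 1, hl⟩).symm j =
      Equiv.swap (⟨l, by omega⟩ : Fin (N + 1)) ⟨l + 1, hl⟩ (τ.symm j) := by
    change (Equiv.swap (⟨l, by omega⟩ : Fin (N + 1)) ⟨l + 1, hl⟩).symm (τ.symm j) = _
    rw [Equiv.symm_swap]
  rw [this]
  set a := τ.symm j
  rw [Equiv.swap_apply_def]
  split_ifs with h1 h2 h3 h4 h5 h6 <;> simp_all [Fin.ext_iff] <;> omega

theorem pv_rot {N : ℕ} (b : Fin (N + 1) → ℕ) (τ : Equiv.Perm (Fin (N + 1))) (l : ℕ) (hl : l ≤ N) :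
    pv (b + Pi.single ((τ * finRotate (N + 1)) (Fin.last N)) 1) (τ * finRotate (N + 1)) l =
      pv b τ (l + 1) := by
  funext j
  unfold pv
  have h0 : (τ * finRotate (N + 1)) (Fin.last N) = τ 0 := by simp
  have h1 : (τ * finRotate (N + 1)).symm j = (finRotate (N + 1)).symm (τ.symm j) := rfl
  rw [h0, h1]
  obtain ⟨a, rfl⟩ := τ.surjective j
  rw [Equiv.symm_apply_apply]
  by_cases ha : a = 0
  · subst ha
    have : (finRotate (N + 1)).symm 0 = Fin.last N := by rw [Equiv.symm_apply_eq]; simp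
    rw [this]
    simp [hl]
  · obtain ⟨a', rfl⟩ := Fin.exists_succ_eq.2 ha
    have : (finRotate (N + 1)).symm a'.succ = a'.castSucc := by
      rw [Equiv.symm_apply_eq]
      apply Fin.ext
      rw [coe_finRotate_of_ne_last (by exact Fin.castSucc_ne_last a')]
      simp
    rw [this]
    have h2 : τ a'.succ ≠ τ 0 := fun h => ha (τ.injective h)
    simp [Pi.single_apply, h2]

theorem tele {N : ℕ} (m : ℕ) (j : Fin (N + 1)) (Φ : (Fin (N + 1) → ℕ) → R)
    (h1 : ∀ b, (∀ i, b i ≤ m) → b j = m → Φ b = 0) :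
    ∑ b ∈ Fintype.piFinset (fun _ : Fin (N + 1) => Finset.range m),
      (Φ (b + Pi.single j 1) - Φ b) =
    - ∑ b ∈ (Fintype.piFinset (fun _ : Fin (N + 1) => Finset.range m)).filter (fun b => b j = 0),
      Φ b := by
  rw [Finset.sum_sub_distrib, ← Finset.sum_filter_add_sum_filter_not _ (fun b => b j = 0) Φ]
  have : ∑ b ∈ Fintype.piFinset (fun _ : Fin (N + 1) => Finset.range m), Φ (b + Pi.single j 1) =
      ∑ b ∈ (Fintype.piFinset (fun _ : Fin (N + 1) => Finset.range m)).filter (fun b => ¬ b j = 0),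
      Φ b := by
    refine Finset.sum_bij_ne_zero (fun b _ _ => b + Pi.single j 1) ?_ ?_ ?_ ?_
    · intro b hb hne
      rw [Fintype.mem_piFinset] at hb
      simp only [Finset.mem_range] at hb
      rw [Finset.mem_filter, Fintype.mem_piFinset]
      refine ⟨fun i => ?_, by simp⟩
      rw [Finset.mem_range]
      by_cases hi : i = j
      · subst hi
        have h3 : b i + 1 ≠ m := by
          intro h
          refine hne (h1 _ (fun i' => ?_) (by simpa using h))
          have := hb i'
          by_cases hi' : i' = i
          · subst hi'; simp; omega
          · simp [hi']; omega
        have := hb i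
        simp; omega
      · simp [hi, hb i]
    · intro b _ _ b' _ _ h
      exact add_right_cancel h
    · intro b hb hne
      rw [Finset.mem_filter, Fintype.mem_piFinset] at hb
      simp only [Finset.mem_range] at hb
      have e : (b - Pi.single j 1 : Fin (N + 1) → ℕ) + Pi.single j 1 = b := by
        funext i
        by_cases hi : i = j
        · subst hi; simp; omega
        · simp [hi]
      refine ⟨b - Pi.single j 1, ?_, by rw [e]; exact hne, e⟩
      rw [Fintype.mem_piFinset]
      intro i
      rw [Finset.mem_range]
      have := hb.1 i
      simp only [Pi.sub_apply]; omega
    · intros; rfl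
  rw [this]; ring

theorem kuhn {N : ℕ} (c : (ℕ → X) → R) (hcong : ∀ y y', (∀ r ≤ N, y r = y' r) → c y = c y')
    (F : (Fin (N + 1) → ℕ) → X) (m : ℕ)
    (hδ : ∀ b, (∀ i, b i < m) → ∀ τ : Equiv.Perm (Fin (N + 1)),
      ∑ l ∈ Finset.range (N + 2), (-1 : R) ^ l * c (fc l fun r => F (pv b τ r)) = 0)
    (h1 : ∀ (τ : Equiv.Perm (Fin (N + 1))) b, (∀ i, b i ≤ m) → b (τ (Fin.last N)) = m →
      c (fun r => F (pv b τ r)) = 0)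
    (bs : Fin (N + 1) → ℕ) (hbs : ∀ i, bs i < m) (hbs0 : bs (Fin.last N) = 0)
    (h0 : ∀ (τ : Equiv.Perm (Fin (N + 1))) b, (∀ i, b i < m) → b (τ (Fin.last N)) = 0 →
      (τ ≠ 1 ∨ b ≠ bs) → c (fun r => F (pv b τ r)) = 0) :
    c (fun r => F (pv bs 1 r)) = 0 := by
  set S := Fintype.piFinset (fun _ : Fin (N + 1) => Finset.range m) with hS
  have mS : ∀ b, b ∈ S ↔ ∀ i, b i < m := fun b => by simp [hS, Fintype.mem_piFinset]
  set Fr : (Fin (N + 1) → ℕ) → Equiv.Perm (Fin (N + 1)) → R := fun b τ => c (fun r => F (pv b τ r))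
    with hFr
  let sg : Equiv.Perm (Fin (N + 1)) → R := fun τ => ((Equiv.Perm.sign τ : ℤ) : R)
  have sgm : ∀ τ ρ, sg (τ * ρ) = sg τ * sg ρ := fun τ ρ => by simp [sg]
  -- cube relation
  have cube : ∀ b ∈ S, ∑ τ, sg τ * (Fr (b + Pi.single (τ (Fin.last N)) 1) τ - Fr b τ) = 0 := by
    intro b hb
    have t0 : ∑ τ, sg τ * ∑ l ∈ Finset.range (N + 2),
        (-1 : R) ^ l * c (fc l fun r => F (pv b τ r)) = 0 :=
      Finset.sum_eq_zero fun τ _ => by rw [hδ b ((mS b).1 hb) τ, mul_zero]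
    simp only [Finset.mul_sum] at t0
    rw [Finset.sum_comm, Finset.sum_range_succ, Finset.sum_range_succ'] at t0
    have tm : ∑ l ∈ Finset.range N, ∑ τ, sg τ *
        ((-1 : R) ^ (l + 1) * c (fc (l + 1) fun r => F (pv b τ r))) = 0 := by
      refine Finset.sum_eq_zero fun l hl => ?_
      rw [Finset.mem_range] at hl
      set ρ : Equiv.Perm (Fin (N + 1)) := Equiv.swap ⟨l, by omega⟩ ⟨l + 1, by omega⟩ with hρ
      have hρ1 : (⟨l, by omega⟩ : Fin (N + 1)) ≠ ⟨l + 1, by omega⟩ := by simp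
      refine Finset.sum_involution (fun τ _ => τ * ρ) ?_ ?_ (fun _ _ => Finset.mem_univ _) ?_
      · intro τ _
        have : fc (l + 1) (fun r => F (pv b (τ * ρ) r)) = fc (l + 1) (fun r => F (pv b τ r)) := by
          funext r
          unfold fc
          split_ifs with h
          · exact congrArg F (pv_swap b τ l (by omega) r (by omega))
          · exact congrArg F (pv_swap b τ l (by omega) (r + 1) (by omega))
        rw [this, sgm]
        have : sg ρ = -1 := by simp [sg, hρ, Equiv.Perm.sign_swap hρ1]
        rw [this]; ring
      · intro τ _ _ h
        have : ρ = 1 := by simpa using h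
        exact hρ1 (Equiv.swap_eq_one_iff.1 this)
      · intro τ _
        simp [mul_assoc, hρ]
    rw [tm, zero_add] at t0
    have tl : ∑ τ, sg τ * ((-1 : R) ^ (N + 1) * c (fc (N + 1) fun r => F (pv b τ r))) =
        ∑ τ, sg τ * ((-1 : R) ^ (N + 1) * Fr b τ) := by
      refine Finset.sum_congr rfl fun τ _ => ?_
      rw [hcong (fc (N + 1) fun r => F (pv b τ r)) (fun r => F (pv b τ r)) fun r hr => by
        simp [fc, show r < N + 1 by omega]]
    have tz : ∑ τ, sg τ * ((-1 : R) ^ 0 * c (fc 0 fun r => F (pv b τ r))) =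
        ∑ τ, sg τ * ((-1 : R) ^ N * Fr (b + Pi.single (τ (Fin.last N)) 1) τ) := by
      refine Eq.trans ?_ (Equiv.sum_comp (Equiv.mulRight (finRotate (N + 1)))
        (fun τ : Equiv.Perm (Fin (N + 1)) =>
          sg τ * ((-1 : R) ^ N * Fr (b + Pi.single (τ (Fin.last N)) 1) τ)))
      refine Finset.sum_congr rfl fun τ _ => ?_
      have e1 : Fr (b + Pi.single ((τ * finRotate (N + 1)) (Fin.last N)) 1) (τ * finRotate (N + 1))
          = c (fc 0 fun r => F (pv b τ r)) :=
        hcong _ _ fun r hr => by simp only [pv_rot b τ r hr]; simp [fc]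
      have e2 : sg (finRotate (N + 1)) = (-1) ^ N := by simp [sg]
      simp only [Equiv.coe_mulRight]
      rw [e1, sgm, e2]
      have u : (-1 : R) ^ N * (-1) ^ N = 1 := by rw [← mul_pow]; simp
      rw [pow_zero, one_mul, mul_assoc, ← mul_assoc ((-1 : R) ^ N), u, one_mul]
    rw [tl, tz] at t0
    have e : ∑ τ, sg τ * ((-1 : R) ^ N * Fr (b + Pi.single (τ (Fin.last N)) 1) τ) +
        ∑ τ, sg τ * ((-1 : R) ^ (N + 1) * Fr b τ) =
        (-1) ^ N * ∑ τ, sg τ * (Fr (b + Pi.single (τ (Fin.last N)) 1) τ - Fr b τ) := by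
      rw [Finset.mul_sum, ← Finset.sum_add_distrib]
      refine Finset.sum_congr rfl fun τ _ => ?_
      ring
    rw [e] at t0
    have u : (-1 : R) ^ N * (-1) ^ N = 1 := by rw [← mul_pow]; simp
    have := congrArg (fun r => (-1 : R) ^ N * r) t0
    simpa only [← mul_assoc, u, one_mul, mul_zero] using this
  have tot : ∑ τ, sg τ * ∑ b ∈ S, (Fr (b + Pi.single (τ (Fin.last N)) 1) τ - Fr b τ) = 0 := by
    simp only [Finset.mul_sum]
    rw [Finset.sum_comm]
    exact Finset.sum_eq_zero cube
  have ev : ∀ τ, ∑ b ∈ S, (Fr (b + Pi.single (τ (Fin.last N)) 1) τ - Fr b τ) =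
      if τ = 1 then - Fr bs 1 else 0 := by
    intro τ
    rw [tele m (τ (Fin.last N)) (fun b => Fr b τ) (fun b hb hb' => h1 τ b hb hb')]
    split_ifs with hτ
    · subst hτ
      rw [Finset.sum_eq_single bs]
      · intro b hb hne
        rw [Finset.mem_filter] at hb
        exact h0 1 b ((mS b).1 hb.1) hb.2 (Or.inr hne)
      · intro h
        exact absurd (Finset.mem_filter.2 ⟨(mS bs).2 hbs, hbs0⟩) h
    · rw [Finset.sum_eq_zero, neg_zero]
      intro b hb
      rw [Finset.mem_filter] at hb
      exact h0 τ b ((mS b).1 hb.1) hb.2 (Or.inl hτ)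
  simp only [ev] at tot
  rw [Finset.sum_eq_single 1] at tot
  · simpa [sg] using tot
  · intro τ _ h; simp [h]
  · simp
end Kuhn
end CAG
namespace CAG
open Set Function unitInterval Topology.Homotopy

section Coch
variable {n : ℕ} {B : ℕ → Finset ℕ} {R : Type*} [CommRing R]

noncomputable def uu (z : E n) : V n := (z.2.1)⁻¹ • z.2.2.2
noncomputable def eta (R : Type*) [CommRing R] (r : ℕ) (z : E n) : R :=
  open Classical in if z.2.1 / 2 < z.2.2.2 (Fin.ofNat (n + 1) r) then 1 else 0
noncomputable def th (x : ℕ → R) (i : ℕ) (z : E n) : R :=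
  open Classical in if ((i : ℝ) + 1 / 2) * z.2.1 < z.2.2.2 0 then x i else 0
noncomputable def kk (z : E n) : ℕ := ⌊z.1⌋₊ - 1
noncomputable def Ps (B : ℕ → Finset ℕ) (x : ℕ → R) (z : E n) : R :=
  open Classical in if sig (B (kk z)) (uu z) + z.2.2.1 < 2 * z.2.1 then ∑ i ∈ B (kk z), th x i z else 0
noncomputable def c1 (B : ℕ → Finset ℕ) (x : ℕ → R) (κ : ℝ) (z z' : E n) : R :=
  open Classical in if z.2.1 < κ then 0 else
    if 0 < z.2.2.1 ∧ 0 < z'.2.2.1 then Ps B x z' - Ps B x z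
    else th x ⌊uu z 0⌋₊ z' - th x ⌊uu z 0⌋₊ z

theorem kk_eq {z : E n} {k : ℕ} (h : z.1 = k + 1) : kk z = k := by
  have : ((k : ℝ) + 1) = ((k + 1 : ℕ) : ℝ) := by push_cast; rfl
  rw [kk, h, this, Nat.floor_natCast]; rfl

theorem uu_eq {z : E n} (h : 0 < z.2.1) {u : V n} (h' : z.2.2.2 = z.2.1 • u) : uu z = u := by
  rw [uu, h', smul_smul, inv_mul_cancel₀ h.ne', one_smul]
theorem uu_mul {z : E n} (h : 0 < z.2.1) (j) : z.2.2.2 j = z.2.1 * uu z j := by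
  simp [uu, h.ne']

theorem cell_facts {z : E n} {k : ℕ} {v : V n} {t : ℝ} (hv : 0 < bp v) (h0 : 0 < t) (h1 : t < 1)
    (h : z = Q B k v t) : z.1 = k + 1 ∧ 0 < z.2.1 ∧ 0 < z.2.2.1 ∧ z.2.2.1 = t * (1 - t) * bp v ∧
      z.2.1 = t * (sig (B k) (uu z) + z.2.2.1) ∧ uu z = usc k v ∧ kk z = k := by
  have hw : 0 < t * (1 - t) * bp v := mul_pos (mul_pos h0 (by linarith)) hv
  have hs := sig_nonneg (B k) (usc k v)
  have hl : 0 < t * (sig (B k) (usc k v) + t * (1 - t) * bp v) := mul_pos h0 (by linarith)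
  subst h
  have hu : uu (Q B k v t) = usc k v := uu_eq hl rfl
  refine ⟨rfl, hl, hw, rfl, ?_, hu, kk_eq rfl⟩
  rw [hu]; rfl

theorem cell_of (hB : ∀ k, ∀ i ∈ B k, i ≤ k) {z : E n} (hz : z ∈ TT B) (hw : 0 < z.2.2.1) :
    ∃ (k : ℕ) (v : V n) (t : ℝ), 0 < bp v ∧ 0 < t ∧ t < 1 ∧ z = Q B k v t := by
  rcases T_cases hB hz with ⟨h1, h2⟩ | ⟨i, s, v, h1, h2, h3⟩ | h
  · rw [h2] at hw; exact absurd hw (lt_irrefl _)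
  · rw [h3] at hw; exact absurd hw (lt_irrefl _)
  · exact h

theorem uu_contAt {z : E n} (h : 0 < z.2.1) : ContinuousAt (uu (n := n)) z := by
  unfold uu
  have c1 : ContinuousAt (fun y : E n => y.2.1) z := by fun_prop
  have c2 : ContinuousAt (fun y : E n => y.2.2.2) z := by fun_prop
  exact (c1.inv₀ h.ne').smul c2

theorem th_loc (x : ℕ → R) (i : ℕ) {z : E n} (h : z.2.2.2 0 ≠ ((i : ℝ) + 1 / 2) * z.2.1) :
    ∀ᶠ y in 𝓝 z, th x i y = th x i z := by
  have c1 : Continuous fun y : E n => ((i : ℝ) + 1 / 2) * y.2.1 := by fun_prop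
  have c2 : Continuous fun y : E n => y.2.2.2 0 := by fun_prop
  rcases lt_or_gt_of_ne h with h | h
  · filter_upwards [(isOpen_lt c2 c1).mem_nhds h] with y hy
    rw [th, th, if_neg (not_lt.2 (le_of_lt hy)), if_neg (not_lt.2 h.le)]
  · filter_upwards [(isOpen_lt c1 c2).mem_nhds h] with y hy
    rw [th, th, if_pos hy, if_pos h]

theorem eta_loc (r : ℕ) {z : E n} (h : z.2.2.2 (Fin.ofNat (n + 1) r) ≠ z.2.1 / 2) :
    ∀ᶠ y in 𝓝 z, eta R r y = eta R r z := by
  have c1 : Continuous fun y : E n => y.2.1 / 2 := by fun_prop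
  have c2 : Continuous fun y : E n => y.2.2.2 (Fin.ofNat (n + 1) r) := by fun_prop
  rcases lt_or_gt_of_ne h with h | h
  · filter_upwards [(isOpen_lt c2 c1).mem_nhds h] with y hy
    rw [eta, eta, if_neg (not_lt.2 (le_of_lt hy)), if_neg (not_lt.2 h.le)]
  · filter_upwards [(isOpen_lt c1 c2).mem_nhds h] with y hy
    rw [eta, eta, if_pos hy, if_pos h]

theorem bp_half {v : V n} (h : ∀ j, j ≠ 0 → v j = 1 / 2) :
    bp v = max 0 (v 0 * (1 - v 0)) * (1 / 4) ^ n := by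
  unfold bp
  rw [Fin.prod_univ_succ]
  congr 1
  rw [Finset.prod_congr rfl fun j _ => by rw [h j.succ (Fin.succ_ne_zero j)]]
  rw [Finset.prod_const]
  norm_num

theorem s_near {k k' : ℕ} (h : |((k : ℝ) + 1) - (k' + 1)| < 1) : k = k' := by
  rw [abs_lt] at h
  have a : (k : ℝ) < k' + 1 := by linarith [h.2]
  have b : (k' : ℝ) < k + 1 := by linarith [h.1]
  norm_cast at a b
  omega

/-- the set of pairs where `c1` is a coboundary -/
theorem loc_cell (hB : ∀ k, ∀ i ∈ B k, i ≤ k) {x : ℕ → R} (hx : ∀ k, ∑ i ∈ B k, x i = 0)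
    {M : ℝ} (hM : 1 ≤ M) {κ : ℝ} (hκ : κ = (1 / 4) ^ n / (64 * M)) {z : E n} (hz : z ∈ TT B)
    (hs : z.1 ≤ M) (hw : 0 < z.2.2.1) (hj : ∀ j, j ≠ 0 → uu z j = 1 / 2) :
    ∃ h : E n → R, ∃ U ∈ 𝓝 z, ∀ y ∈ U, ∀ y' ∈ U, y ∈ TT B → y' ∈ TT B →
      c1 B x κ y y' = h y' - h y := by
  have hM0 : 0 < M := by linarith
  have hp : (0 : ℝ) < (1 / 4) ^ n := by positivity
  have hκ1 : κ * 64 ≤ (1 / 4) ^ n := by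
    rw [hκ, div_mul_eq_mul_div, div_le_iff₀ (by positivity)]; nlinarith
  have hκ2 : κ * M * 64 = (1 / 4) ^ n := by rw [hκ]; field_simp
  have hκ0 : 0 < κ := by rw [hκ]; positivity
  obtain ⟨k, v, t, hv, ht0, ht1, hzd⟩ := cell_of hB hz hw
  obtain ⟨f1, f2, -, f4, f5, f6, f7⟩ := cell_facts hv ht0 ht1 hzd
  have cw : Continuous fun y : E n => y.2.2.1 := by fun_prop
  have cl : Continuous fun y : E n => y.2.1 := by fun_prop
  have W : ∀ᶠ y in 𝓝 z, 0 < y.2.2.1 := (isOpen_lt continuous_const cw).mem_nhds hw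
  by_cases hl : κ < z.2.1
  · have L : ∀ᶠ y in 𝓝 z, κ < y.2.1 := (isOpen_lt continuous_const cl).mem_nhds hl
    refine ⟨Ps B x, _, W.and L, ?_⟩
    rintro y ⟨h1, h2⟩ y' ⟨h3, -⟩ _ _
    rw [c1, if_neg (not_lt.2 h2.le), if_pos ⟨h1, h3⟩]
  rw [not_lt] at hl
  -- enough: `Ps` is locally constant
  suffices hS : ∃ C, ∀ᶠ y in 𝓝 z, y ∈ TT B → Ps B x y = C by
    obtain ⟨C, hC⟩ := hS
    refine ⟨fun _ => 0, _, W.and hC, ?_⟩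
    rintro y ⟨h1, h2⟩ y' ⟨h3, h4⟩ m1 m2
    rw [c1, if_pos (c := 0 < y.2.2.1 ∧ 0 < y'.2.2.1) ⟨h1, h3⟩, h2 m1, h4 m2]
    simp
  have K : ∀ᶠ y in 𝓝 z, y ∈ TT B → kk y = k := by
    have S : ∀ᶠ y : E n in 𝓝 z, |y.1 - ((k : ℝ) + 1)| < 1 := by
      have : Continuous fun y : E n => |y.1 - ((k : ℝ) + 1)| := by fun_prop
      refine (isOpen_lt this continuous_const).mem_nhds ?_
      simp [f1]
    filter_upwards [W, S] with y h1 h2 m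
    obtain ⟨k', v', t', hv', h0', h1', e⟩ := cell_of hB m h1
    obtain ⟨g1, -, -, -, -, -, g7⟩ := cell_facts hv' h0' h1' e
    rw [g7]; rw [g1] at h2
    exact s_near h2
  have CS : ContinuousAt (fun y : E n => sig (B k) (uu y) + y.2.2.1 - 2 * y.2.1) z := by
    refine ContinuousAt.sub (ContinuousAt.add ?_ cw.continuousAt) (by fun_prop)
    exact ContinuousAt.comp (g := sig (B k)) (sig_cont _).continuousAt (uu_contAt f2)
  have hsg := sig_nonneg (B k) (uu z)
  rcases lt_or_ge t (1 / 2) with ht | ht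
  · refine ⟨0, ?_⟩
    have : 0 < sig (B k) (uu z) + z.2.2.1 - 2 * z.2.1 := by rw [f5]; nlinarith
    filter_upwards [K, CS.eventually (lt_mem_nhds this)] with y h1 h2 m
    rw [Ps, h1 m, if_neg (by linarith)]
  -- `t ≥ 1/2`
  have T1 : ∀ i ∈ B k, ∀ᶠ y in 𝓝 z, th x i y = th x i z := by
    intro i hi
    refine th_loc x i fun hc => ?_
    rw [uu_mul f2, mul_comm] at hc
    have hc := mul_right_cancel₀ f2.ne' hc
    have : bp (uu z - Pi.single 0 (i : ℝ)) = max 0 ((1 / 2 : ℝ) * (1 - 1 / 2)) * (1 / 4) ^ n := by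
      rw [bp_half]
      · rw [Pi.sub_apply, hc]; simp
      · intro j hj0
        simp [hj j hj0, hj0]
    have h4 : max 0 ((1 / 2 : ℝ) * (1 - 1 / 2)) = 1 / 4 := by norm_num
    rw [h4] at this
    have h3 : sig (B k) (uu z) = _ := sig_eq (i := i) (by rw [this]; positivity)
    rw [if_pos hi, this] at h3
    nlinarith
  have T2 : ∀ᶠ y in 𝓝 z, ∀ i ∈ B k, th x i y = th x i z := by
    rw [Filter.eventually_all_finset]; exact T1
  rcases eq_or_lt_of_le ht with ht | ht
  · refine ⟨0, ?_⟩
    have S0 : ∑ i ∈ B k, th x i z = 0 := by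
      have hz0 : z.2.2.2 0 = z.2.1 * uu z 0 := uu_mul f2 0
      by_cases c1 : uu z 0 < 1 / 2
      · refine Finset.sum_eq_zero fun i hi => ?_
        rw [th, if_neg]
        rw [hz0, not_lt]
        have : (0 : ℝ) ≤ i := Nat.cast_nonneg i
        nlinarith
      by_cases c2 : (k : ℝ) + 1 / 2 < uu z 0
      · rw [← hx k]
        refine Finset.sum_congr rfl fun i hi => ?_
        rw [th, if_pos]
        rw [hz0]
        have : (i : ℝ) ≤ k := by exact_mod_cast hB k i hi
        nlinarith
      exfalso
      rw [not_lt] at c1 c2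
      rw [f6, usc_zero] at c1 c2
      have b1 := bp_half (v := v) (fun j hj0 => by rw [← usc_ne k v hj0, ← f6, hj j hj0])
      have hk1 : (k : ℝ) + 1 ≤ M := by rw [← f1]; exact hs
      have hk0 : (0 : ℝ) ≤ k := Nat.cast_nonneg k
      have v1 := (bp_pos.1 hv 0).1
      have v2 := (bp_pos.1 hv 0).2
      have b2 : max 0 (v 0 * (1 - v 0)) = v 0 * (1 - v 0) :=
        max_eq_right (mul_nonneg v1.le (by linarith))
      rw [b2] at b1
      have e1 : 1 / 4 ≤ ((k : ℝ) + 1) * (v 0 * (1 - v 0)) := by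
        rcases le_total (v 0) (1 / 2) with hh | hh
        · nlinarith
        · nlinarith
      have e2 : 1 / 4 ≤ M * (v 0 * (1 - v 0)) := by
        have : 0 ≤ v 0 * (1 - v 0) := mul_nonneg v1.le (by linarith)
        nlinarith
      have e3 : z.2.1 ≥ bp v / 8 := by
        rw [f5, f4, ← ht]; linarith
      have e4 : bp v / 8 ≤ κ := e3.le.trans hl
      have e5 : M * bp v ≥ 1 / 4 * (1 / 4) ^ n := by
        rw [b1]
        have := mul_le_mul_of_nonneg_right e2 hp.le
        linarith
      have e6 := mul_le_mul_of_nonneg_left e4 hM0.le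
      linarith
    filter_upwards [K, T2] with y h1 h2 m
    rw [Ps, h1 m, Finset.sum_congr rfl h2, S0]; simp
  · refine ⟨∑ i ∈ B k, th x i z, ?_⟩
    have : sig (B k) (uu z) + z.2.2.1 - 2 * z.2.1 < 0 := by rw [f5]; nlinarith
    filter_upwards [K, T2, CS.eventually (gt_mem_nhds this)] with y h1 h2 h3 m
    rw [Ps, h1 m, if_pos (by linarith), Finset.sum_congr rfl h2]
end Coch
end CAG
namespace CAG
open Set Function unitInterval Topology.Homotopy

section Coch2
variable {n : ℕ} {B : ℕ → Finset ℕ} {R : Type*} [CommRing R]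

theorem Ps_cell (hB : ∀ k, ∀ i ∈ B k, i ≤ k) (x : ℕ → R) {i : ℕ} {y : E n} (hy : y ∈ TT B)
    (hw : 0 < y.2.2.1) (h1 : (i : ℝ) < uu y 0) (h2 : uu y 0 < i + 1) (h3 : y.2.2.1 < y.2.1)
    (h4 : bp (uu y - Pi.single 0 (i : ℝ)) + y.2.2.1 < 2 * y.2.1) :
    Ps B x y = ∑ i' ∈ B (kk y), (if i' < i then x i' else 0) + th x i y := by
  obtain ⟨k, v, t, hv, ht0, ht1, e⟩ := cell_of hB hy hw
  obtain ⟨f1, f2, -, f4, f5, f6, f7⟩ := cell_facts hv ht0 ht1 e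
  have hsp : 0 < sig (B k) (uu y) := by
    by_contra hc
    have : sig (B k) (uu y) = 0 := le_antisymm (not_lt.1 hc) (sig_nonneg _ _)
    rw [this, zero_add] at f5
    nlinarith
  obtain ⟨i', hi', p1, p2⟩ := sig_pos hsp
  have : i' = i := by
    have q := bp_pos.1 p1 0
    simp only [Pi.sub_apply, Pi.single_eq_same] at q
    have a : (i' : ℝ) < i + 1 := by linarith [q.1]
    have b : (i : ℝ) < i' + 1 := by linarith [q.2]
    norm_cast at a b
    omega
  subst this
  rw [Ps, f7, p2, if_pos h4]
  have : ∀ l ∈ B k, th x l y = (if l < i' then x l else 0) + if l = i' then th x i' y else 0 := by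
    intro l _
    rcases lt_trichotomy l i' with h | h | h
    · have : (l : ℝ) + 1 ≤ i' := by exact_mod_cast h
      rw [if_pos h, if_neg h.ne, add_zero, th, if_pos]
      rw [uu_mul f2]; nlinarith
    · subst h; simp
    · have : (i' : ℝ) + 1 ≤ l := by exact_mod_cast h
      rw [if_neg h.not_gt, if_neg h.ne', add_zero, th, if_neg]
      rw [uu_mul f2]; nlinarith
  rw [Finset.sum_congr rfl this, Finset.sum_add_distrib, Finset.sum_ite_eq', if_pos hi']

theorem loc_sphere (hB : ∀ k, ∀ i ∈ B k, i ≤ k) {x : ℕ → R}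
    {M : ℝ} (hM : 1 ≤ M) {κ : ℝ} (hκ : κ = (1 / 4) ^ n / (64 * M)) {z : E n}
    {i : ℕ} {s : ℝ} {v : V n} (hv : 0 < bp v) (hzd : z = Sp i s v)
    (hj : ∀ j, j ≠ 0 → uu z j = 1 / 2) :
    ∃ h : E n → R, ∃ U ∈ 𝓝 z, ∀ y ∈ U, ∀ y' ∈ U, y ∈ TT B → y' ∈ TT B →
      c1 B x κ y y' = h y' - h y := by
  have hM0 : 0 < M := by linarith
  have hp : (0 : ℝ) < (1 / 4) ^ n := by positivity
  have hκ1 : κ * 64 ≤ (1 / 4) ^ n := by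
    rw [hκ, div_mul_eq_mul_div, div_le_iff₀ (by positivity)]; nlinarith
  have hκ0 : 0 < κ := by rw [hκ]; positivity
  have f2 : 0 < z.2.1 := by rw [hzd]; exact hv
  have fl : z.2.1 = bp v := by rw [hzd]; rfl
  have fw : z.2.2.1 = 0 := by rw [hzd]; rfl
  have fu : uu z = v + Pi.single 0 (i : ℝ) := uu_eq f2 (by rw [hzd]; rfl)
  have fv : uu z - Pi.single 0 (i : ℝ) = v := by rw [fu]; simp
  have v0 := bp_pos.1 hv 0
  have fu0 : uu z 0 = v 0 + i := by rw [fu]; simp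
  have cw : Continuous fun y : E n => y.2.2.1 := by fun_prop
  have cl : Continuous fun y : E n => y.2.1 := by fun_prop
  have cu := uu_contAt f2
  have cu0 : ContinuousAt (fun y : E n => uu y 0) z := (continuous_apply 0).continuousAt.comp cu
  have cb : ContinuousAt (fun y : E n => bp (uu y - Pi.single 0 (i : ℝ)) + y.2.2.1 - 2 * y.2.1) z := by
    refine ContinuousAt.sub (ContinuousAt.add ?_ cw.continuousAt) (by fun_prop)
    exact ContinuousAt.comp (g := bp) bp_cont.continuousAt (cu.sub continuousAt_const)
  have E0 : ∀ᶠ y : E n in 𝓝 z, 0 < y.2.1 := (isOpen_lt continuous_const cl).mem_nhds f2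
  have E1 : ∀ᶠ y : E n in 𝓝 z, (i : ℝ) < uu y 0 := cu0.eventually (lt_mem_nhds (by linarith))
  have E2 : ∀ᶠ y : E n in 𝓝 z, uu y 0 < (i : ℝ) + 1 := cu0.eventually (gt_mem_nhds (by linarith))
  have E3 : ∀ᶠ y : E n in 𝓝 z, y.2.2.1 < y.2.1 :=
    (isOpen_lt cw cl).mem_nhds (by change z.2.2.1 < z.2.1; rw [fw]; exact f2)
  have E4 : ∀ᶠ y : E n in 𝓝 z, bp (uu y - Pi.single 0 (i : ℝ)) + y.2.2.1 - 2 * y.2.1 < 0 :=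
    cb.eventually (gt_mem_nhds (by beta_reduce; rw [fv, fw, fl]; linarith))
  have E5 : ∀ᶠ y : E n in 𝓝 z, |y.1 - z.1| < 1 / 2 := by
    have : Continuous fun y : E n => |y.1 - z.1| := by fun_prop
    exact (isOpen_lt this continuous_const).mem_nhds (by simp)
  -- the key formula
  have key : ∃ U ∈ 𝓝 z, ∀ y ∈ U, ∀ y' ∈ U, y ∈ TT B → y' ∈ TT B →
      c1 B x κ y y' = if y.2.1 < κ then 0 else th x i y' - th x i y := by
    refine ⟨_, E1.and (E2.and (E3.and (E4.and E5))), ?_⟩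
    rintro y ⟨a1, a2, a3, a4, a5⟩ y' ⟨b1, b2, b3, b4, b5⟩ m m'
    rw [c1]
    split_ifs with q1 q2
    · rfl
    · rw [Ps_cell hB x m q2.1 a1 a2 a3 (by linarith), Ps_cell hB x m' q2.2 b1 b2 b3 (by linarith)]
      have : kk y = kk y' := by
        obtain ⟨k, v, t, hv, ht0, ht1, e⟩ := cell_of hB m q2.1
        obtain ⟨k', v', t', hv', ht0', ht1', e'⟩ := cell_of hB m' q2.2
        have g := cell_facts hv ht0 ht1 e
        have g' := cell_facts hv' ht0' ht1' e'
        rw [g.2.2.2.2.2.2, g'.2.2.2.2.2.2]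
        rw [g.1] at a5
        rw [g'.1] at b5
        refine s_near ?_
        rw [abs_lt] at *
        constructor <;> linarith [a5.1, a5.2, b5.1, b5.2]
      rw [this]; ring
    · have : ⌊uu y 0⌋₊ = i := by
        rw [Nat.floor_eq_iff (le_trans (Nat.cast_nonneg i) a1.le)]; exact ⟨a1.le, a2⟩
      rw [this]
  obtain ⟨U, hU, key⟩ := key
  by_cases hl : κ < z.2.1
  · refine ⟨th x i, ?_⟩
    have L : ∀ᶠ y : E n in 𝓝 z, κ < y.2.1 := (isOpen_lt continuous_const cl).mem_nhds hl
    refine ⟨_, Filter.inter_mem hU L, ?_⟩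
    rintro y ⟨h1, h2⟩ y' ⟨h3, -⟩ m m'
    rw [key y h1 y' h3 m m', if_neg (not_lt.2 (le_of_lt h2))]
  · refine ⟨fun _ => 0, ?_⟩
    have L : ∀ᶠ y : E n in 𝓝 z, th x i y = th x i z := by
      refine th_loc x i fun hc => ?_
      rw [uu_mul f2, mul_comm] at hc
      have hc := mul_right_cancel₀ f2.ne' hc
      have hv0 : v 0 = 1 / 2 := by rw [fu0] at hc; linarith
      have := bp_half (v := v) (fun j hj0 => by rw [← hj j hj0, fu]; simp [hj0])
      have h4 : max 0 ((1 / 2 : ℝ) * (1 - 1 / 2)) = 1 / 4 := by norm_num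
      rw [hv0, h4] at this
      rw [fl, this] at hl
      linarith
    refine ⟨_, Filter.inter_mem hU L, ?_⟩
    rintro y ⟨h1, h2⟩ y' ⟨h3, h4⟩ m m'
    rw [key y h1 y' h3 m m', show th x i y = _ from h2, show th x i y' = _ from h4]; simp

theorem loc (hB : ∀ k, ∀ i ∈ B k, i ≤ k) {x : ℕ → R} (hx : ∀ k, ∑ i ∈ B k, x i = 0)
    {M : ℝ} (hM : 1 ≤ M) {κ : ℝ} (hκ : κ = (1 / 4) ^ n / (64 * M)) {z : E n} (hz : z ∈ TT B)
    (hs : z.1 ≤ M) :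
    ∃ U ∈ 𝓝 z, (∃ h : E n → R, ∀ y ∈ U, ∀ y' ∈ U, y ∈ TT B → y' ∈ TT B →
      c1 B x κ y y' = h y' - h y) ∨ (∃ r < n, ∀ y ∈ U, eta R (r + 1) y = eta R (r + 1) z) := by
  have hκ0 : 0 < κ := by rw [hκ]; positivity
  by_cases hj : ∃ j : Fin (n + 1), j ≠ 0 ∧ z.2.2.2 j ≠ z.2.1 / 2
  · obtain ⟨j, hj0, hj⟩ := hj
    obtain ⟨j', rfl⟩ := Fin.exists_succ_eq.2 hj0
    have e : Fin.ofNat (n + 1) ((j' : ℕ) + 1) = j'.succ := by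
      apply Fin.ext; simp
    exact ⟨_, eta_loc (R := R) (j' + 1) (by rw [e]; exact hj), Or.inr ⟨j', j'.2, fun y hy => hy⟩⟩
  push Not at hj
  have hju : 0 < z.2.1 → ∀ j, j ≠ 0 → uu z j = 1 / 2 := fun h j hj0 => by
    have := hj j hj0
    rw [uu_mul h] at this
    have h2 : z.2.1 * uu z j = z.2.1 * (1 / 2) := by rw [this]; ring
    exact mul_left_cancel₀ h.ne' h2
  rcases T_cases hB hz with ⟨h1, h2⟩ | ⟨i, s, v, h1, h2, h3⟩ | ⟨k, v, t, h1, h2, h3, h4⟩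
  · have cl : Continuous fun y : E n => y.2.1 := by fun_prop
    refine ⟨{y | y.2.1 < κ}, (isOpen_lt cl continuous_const).mem_nhds ?_, Or.inl ⟨fun _ => 0, ?_⟩⟩
    · change z.2.1 < κ
      rw [h2]; exact hκ0
    · intro y hy y' _ _ _
      rw [mem_ofPred_eq] at hy
      rw [c1, if_pos hy]; simp
  · obtain ⟨h, U, hU, hh⟩ := loc_sphere (x := x) hB hM hκ h2 h3 (hju (by rw [h3]; exact h2))
    exact ⟨U, hU, Or.inl ⟨h, hh⟩⟩
  · have g := cell_facts h1 h2 h3 h4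
    obtain ⟨h, U, hU, hh⟩ := loc_cell hB hx hM hκ hz hs g.2.2.1 (hju g.2.1)
    exact ⟨U, hU, Or.inl ⟨h, hh⟩⟩
end Coch2
end CAG
namespace CAG
open Set Function unitInterval Topology.Homotopy

section Inj
variable {n : ℕ} {B : ℕ → Finset ℕ} {R : Type*} [CommRing R]

noncomputable def cC (B : ℕ → Finset ℕ) (x : ℕ → R) (κ : ℝ) (y : ℕ → E n) : R :=
  c1 B x κ (y 0) (y 1) *
    ∏ r ∈ Finset.range n, (eta R (r + 1) (y (r + 2)) - eta R (r + 1) (y (r + 1)))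

theorem cc_cocycle {x : ℕ → R} {κ : ℝ} {z : E n} {U : Set (E n)}
    (hU : (∃ h : E n → R, ∀ y ∈ U, ∀ y' ∈ U, y ∈ TT B → y' ∈ TT B →
      c1 B x κ y y' = h y' - h y) ∨ (∃ r < n, ∀ y ∈ U, eta R (r + 1) y = eta R (r + 1) z))
    {y : ℕ → E n} (hy : ∀ r, r ≤ n + 2 → y r ∈ U) (hT : ∀ r, y r ∈ TT B) :
    ∑ l ∈ Finset.range (n + 1 + 2), (-1 : R) ^ l * cC B x κ (fc l y) = 0 := by
  have hf : ∀ l r, r ≤ n + 1 → fc l y r ∈ U := fun l r hr => by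
    unfold fc; split_ifs
    · exact hy r (by omega)
    · exact hy (r + 1) (by omega)
  have hfT : ∀ l r, fc l y r ∈ TT B := fun l r => by
    unfold fc; split_ifs <;> exact hT _
  rcases hU with ⟨h, hh⟩ | ⟨r, hr, hh⟩
  · rw [← cup_cocycle (n + 1) (fun r => if r = 0 then h else eta R r) y]
    refine Finset.sum_congr rfl fun l _ => ?_
    congr 1
    rw [Finset.prod_range_succ', cC, hh _ (hf l 0 (by omega)) _ (hf l 1 (by omega)) (hfT l 0) (hfT l 1)]
    simp [mul_comm]
  · refine Finset.sum_eq_zero fun l _ => ?_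
    rw [cC, Finset.prod_eq_zero (Finset.mem_range.2 hr), mul_zero, mul_zero]
    rw [hh _ (hf l _ (by omega)), hh _ (hf l _ (by omega)), sub_self]

noncomputable def gI (m a : ℕ) : I := projIcc 0 1 zero_le_one ((a : ℝ) / m)
theorem gI_dist (m : ℕ) (a b : ℕ) (h : a ≤ b) (h' : b ≤ a + 1) : dist (gI m a) (gI m b) ≤ 1 / m := by
  rw [Subtype.dist_eq, Real.dist_eq]
  refine (abs_projIcc_sub_projIcc _).trans ?_
  rw [← sub_div, abs_div, Nat.abs_cast]
  gcongr
  have a1 : (a : ℝ) ≤ b := by exact_mod_cast h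
  have a2 : (b : ℝ) ≤ a + 1 := by exact_mod_cast h'
  rw [abs_le]; constructor <;> linarith
theorem gI_zero (m : ℕ) : gI m 0 = 0 := by
  apply Subtype.ext; simp [gI, coe_projIcc]
theorem gI_one {m : ℕ} (hm : 0 < m) : gI m m = 1 := by
  have : (m : ℝ) ≠ 0 := by positivity
  apply Subtype.ext; simp [gI, coe_projIcc, div_self this]
theorem gI_val {m a : ℕ} (hm : 0 < m) (h : a ≤ m) : (gI m a : ℝ) = a / m := by
  rw [gI, projIcc_of_mem]
  exact ⟨by positivity, by rw [div_le_one (by positivity)]; exact_mod_cast h⟩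
theorem gI_half {m' a : ℕ} (hm : 0 < m') (h : a ≤ 2 * m') : 1 / 2 < (gI (2 * m') a : ℝ) ↔ m' < a := by
  rw [gI_val (by omega) h, lt_div_iff₀ (by positivity)]
  push_cast
  rw [← Nat.cast_lt (α := ℝ)]
  constructor <;> intro h <;> linarith

noncomputable def grF {T : Type*} (H : I → Cb n → T) (m : ℕ) (p : Fin (n + 1 + 1) → ℕ) : T :=
  H (gI m (p (Fin.last _))) fun j => gI m (p j.castSucc)

theorem eL_val (i : ℕ) (x : Cb n) : (eL B i x : E n).2 = (Sp i 0 (mid x)).2 := rfl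

theorem eL_eta {i : ℕ} {y : Cb n} (h : 0 < (eL B i y : E n).2.1) (r : ℕ) (hr : r ≠ 0) (hrn : r ≤ n) :
    eta R r (eL B i y : E n) = open Classical in
      if 1 / 2 < (y (Fin.ofNat (n + 1) r) : ℝ) then 1 else 0 := by
  rw [eta, eL_val]
  rw [eL_val] at h
  change 0 < bp (mid y) at h
  refine if_congr ?_ rfl rfl
  have hj : Fin.ofNat (n + 1) r ≠ 0 := by
    intro hc
    have := congrArg Fin.val hc
    simp at this; rw [Nat.mod_eq_of_lt (by omega)] at this; exact hr this
  change bp (mid y) / 2 < bp (mid y) * (mid y + Pi.single 0 (i : ℝ) : V n) _ ↔ _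
  rw [Pi.add_apply, Pi.single_eq_of_ne hj, add_zero, div_eq_mul_inv, mul_lt_mul_iff_right₀ h, mid]
  constructor <;> intro h <;> linarith

theorem eL_th {i : ℕ} {y : Cb n} (x : ℕ → R) (h : 0 < (eL B i y : E n).2.1) :
    th x i (eL B i y : E n) = open Classical in if 1 / 2 < (y 0 : ℝ) then x i else 0 := by
  rw [th, eL_val]
  rw [eL_val] at h
  change 0 < bp (mid y) at h
  refine if_congr ?_ rfl rfl
  change ((i : ℝ) + 1 / 2) * bp (mid y) < bp (mid y) * (mid y + Pi.single 0 (i : ℝ) : V n) 0 ↔ _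
  rw [Pi.add_apply, Pi.single_eq_same, mul_comm, mul_lt_mul_iff_right₀ h, mid]
  constructor <;> intro h <;> linarith

theorem eL_c1 {i : ℕ} {y y' : Cb n} (x : ℕ → R) {κ : ℝ} (h : 0 < (eL B i y : E n).2.1) 
    (h2 : κ ≤ (eL B i y : E n).2.1) :
    c1 B x κ (eL B i y : E n) (eL B i y' : E n) =
      th x i (eL B i y' : E n) - th x i (eL B i y : E n) := by
  rw [c1, if_neg (not_lt.2 h2), if_neg (fun h => lt_irrefl (0 : ℝ) h.1)]
  have h' : 0 < bp (mid y) := h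
  have hu : uu (eL B i y : E n) = mid y + Pi.single 0 (i : ℝ) := uu_eq h rfl
  have : ⌊uu (eL B i y : E n) 0⌋₊ = i := by
    have a := bp_pos.1 h' 0
    rw [hu, Pi.add_apply, Pi.single_eq_same, Nat.floor_eq_iff (by linarith [(Nat.cast_nonneg i : (0 : ℝ) ≤ i)])]
    constructor <;> linarith
  rw [this]

/-- evaluation on the bottom face -/
theorem cc_bottom (x : ℕ → R) {κ : ℝ} (hκ : 0 < κ) (i : ℕ) {m' : ℕ} (hm : 0 < m')
    (p : ℕ → Fin (n + 1 + 1) → ℕ) (hp : ∀ r j, p r j ≤ 2 * m')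
    (Y : ℕ → Cb n) (hY : ∀ r j, Y r j = gI (2 * m') (p r j.castSucc))
    (h0 : κ ≤ (eL B i (Y 0) : E n).2.1) (h1 : ∀ r, r ≤ n + 1 → 0 < (eL B i (Y r) : E n).2.1) :
    cC B x κ (fun r => (eL B i (Y r) : E n)) = x i * ∏ j : Fin (n + 1),
      ((if m' < p (j + 1) j.castSucc then 1 else 0) - (if m' < p j j.castSucc then 1 else 0)) := by
  classical
  rw [cC, eL_c1 x (h1 0 (by omega)) h0, eL_th x (h1 0 (by omega)), eL_th x (h1 1 (by omega)),
    Fin.prod_univ_succ, ← mul_assoc]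
  congr 1
  · simp only [hY, gI_half hm (hp _ _)]
    rw [mul_sub]
    congr 1 <;> · rw [mul_ite, mul_one, mul_zero]; exact if_congr Iff.rfl rfl rfl
  · rw [Finset.prod_range]
    refine Finset.prod_congr rfl fun r _ => ?_
    have e : Fin.ofNat (n + 1) ((r : ℕ) + 1) = r.succ := by
      apply Fin.ext; simp
    rw [eL_eta (h1 _ (by omega)) _ (by omega) (by omega), eL_eta (h1 _ (by omega)) _ (by omega) (by omega)]
    simp only [hY, e, gI_half hm (hp _ _)]
    rfl

theorem inj (hB : ∀ k, ∀ i ∈ B k, i ≤ k) {x : ℕ → R} (hx : ∀ k, ∑ i ∈ B k, x i = 0) (i : ℕ)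
    (h : cl (eL (n := n) B i) = 1) : x i = 0 := by
  rw [cl_one] at h
  obtain ⟨H, Hc, H0, H1, Hb⟩ := htp_to (cl_exact h)
  have Hc' : Continuous fun q : I × Cb n => (H q.1 q.2 : E n) := continuous_subtype_val.comp Hc
  obtain ⟨M, hM1, hM⟩ : ∃ M : ℝ, 1 ≤ M ∧ ∀ q : I × Cb n, (H q.1 q.2 : E n).1 ≤ M := by
    have : Continuous fun q : I × Cb n => (H q.1 q.2 : E n).1 := by fun_prop
    obtain ⟨M, hM⟩ := (isCompact_range this).bddAbove
    exact ⟨max 1 M, le_max_left _ _, fun q => (hM (mem_range_self q)).trans (le_max_right _ _)⟩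
  obtain ⟨κ, hκ⟩ : ∃ κ : ℝ, κ = (1 / 4) ^ n / (64 * M) := ⟨_, rfl⟩
  have hκ0 : 0 < κ := by rw [hκ]; positivity
  have hκ1 : κ ≤ (1 / 4) ^ (n + 1) := by
    rw [hκ, div_le_iff₀ (by positivity), pow_succ]
    have : (0 : ℝ) < (1 / 4) ^ n := by positivity
    nlinarith
  choose U hUn hU using fun z : (TT B : Set (E n)) => fun hs : (z : E n).1 ≤ M =>
    loc hB hx hM1 hκ z.2 hs
  -- Lebesgue number
  let W : I × Cb n → Set (I × Cb n) := fun q => interior ({q' | (H q'.1 q'.2 : E n) ∈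
    U (H q.1 q.2) (hM q) ∧ |(H q'.1 q'.2 : E n).2.1 - (H q.1 q.2 : E n).2.1| < κ / 2})
  have hWm : ∀ q, q ∈ W q := fun q => by
    rw [mem_interior_iff_mem_nhds]
    refine Filter.inter_mem (Hc'.continuousAt.preimage_mem_nhds (hUn _ _)) ?_
    have : Continuous fun q' : I × Cb n => |(H q'.1 q'.2 : E n).2.1 - (H q.1 q.2 : E n).2.1| := by
      fun_prop
    exact (isOpen_lt this continuous_const).mem_nhds (by simpa using half_pos hκ0)
  obtain ⟨δ, hδ, hL⟩ := lebesgue_number_lemma_of_metric (c := W) (isCompact_univ)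
    (fun q => isOpen_interior) (fun q _ => mem_iUnion.2 ⟨q, hWm q⟩)
  obtain ⟨m', hm'⟩ := exists_nat_gt (1 / δ)
  have hm0 : 0 < m' := by
    have : (0 : ℝ) < m' := lt_trans (by positivity) hm'
    exact_mod_cast this
  set m := 2 * m' with hmd
  have hmδ : 1 / (m : ℝ) < δ := by
    rw [div_lt_comm₀ (by positivity) hδ]
    refine hm'.trans_le ?_
    rw [hmd]; push_cast; linarith [(Nat.cast_nonneg m' : (0 : ℝ) ≤ m')]
  set F : (Fin (n + 1 + 1) → ℕ) → E n := fun p => ((grF H m p : (TT B : Set (E n))) : E n) with hF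
  have hFT : ∀ p, F p ∈ TT B := fun p => (grF H m p).2
  have near : ∀ b (τ : Equiv.Perm (Fin (n + 1 + 1))), ∃ q, ∀ r, F (pv b τ r) ∈ U (H q.1 q.2) (hM q) ∧
      |(F (pv b τ r)).2.1 - (H q.1 q.2 : E n).2.1| < κ / 2 := by
    intro b τ
    obtain ⟨q, hq⟩ := hL (gI m (b (Fin.last _)), fun j => gI m (b j.castSucc)) (mem_univ _)
    refine ⟨q, fun r => ?_⟩
    have hd : ∀ j, dist (gI m (pv b τ r j)) (gI m (b j)) < δ := fun j => by
      rw [dist_comm]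
      refine (gI_dist m _ _ ?_ ?_).trans_lt hmδ
      · unfold pv; omega
      · unfold pv; split_ifs <;> omega
    have : (gI m (pv b τ r (Fin.last _)), fun j : Fin (n + 1) => gI m (pv b τ r j.castSucc)) ∈ W q := by
      refine hq ?_
      rw [Metric.mem_ball, Prod.dist_eq, max_lt_iff]
      refine ⟨hd _, ?_⟩
      rw [dist_pi_lt_iff hδ]
      exact fun j => hd _
    have h2 := interior_subset this
    exact h2
  -- base values
  have Fb : ∀ p, (∃ j : Fin (n + 1), p j.castSucc = 0 ∨ p j.castSucc = m) → F p = 0 := by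
    rintro p ⟨j, hj⟩
    have : grF H m p = b0 n B := Hb _ _ ⟨j, by
      rcases hj with h | h <;> simp only [h]
      · left; exact gI_zero m
      · right; exact gI_one (by omega)⟩
    simp only [hF, this]; rfl
  have Ft : ∀ p, p (Fin.last _) = m → F p = 0 := by
    intro p hp
    have : grF H m p = b0 n B := by
      rw [grF, hp, gI_one (by omega), H1]; rfl
    simp only [hF, this]; rfl
  have pvl : ∀ b (τ : Equiv.Perm (Fin (n + 1 + 1))) r, r ≤ n + 1 →
      pv b τ r (τ (Fin.last _)) = b (τ (Fin.last _)) := fun b τ r hr => by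
    simp [pv]; omega
  have c0 : ∀ y : ℕ → E n, y 0 = 0 → cC B x κ y = 0 := by
    intro y hy
    rw [cC, c1, if_pos, zero_mul]
    rw [hy]; exact hκ0
  have bot : ∀ (τ : Equiv.Perm (Fin (n + 1 + 1))) b, (∀ j, b j < m) → b (τ (Fin.last _)) = 0 →
      τ (Fin.last _) = Fin.last _ → κ ≤ (F b).2.1 →
      cC B x κ (fun r => F (pv b τ r)) = x i * ∏ j : Fin (n + 1),
        ((if m' < pv b τ (j + 1) j.castSucc then 1 else 0) -
          (if m' < pv b τ j j.castSucc then 1 else 0)) := by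
    intro τ b hb hbl hl hk
    have hpl : ∀ r, r ≤ n + 1 → pv b τ r (Fin.last _) = 0 := fun r hr => by
      have := pvl b τ r hr; rw [hl] at this; rw [this, ← hl]; exact hbl
    have hpm : ∀ r j, pv b τ r j ≤ m := fun r j => by
      have := hb j; unfold pv; split_ifs <;> omega
    have hFe : ∀ r, r ≤ n + 1 → F (pv b τ r) =
        (eL B i (fun j => gI m (pv b τ r j.castSucc)) : E n) := fun r hr => by
      simp only [hF, grF, hpl r hr, gI_zero, H0]
    have hp0 : pv b τ 0 = b := by funext j; simp [pv]
    obtain ⟨q, hq⟩ := near b τ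
    have hpos : ∀ r, r ≤ n + 1 → 0 < (F (pv b τ r)).2.1 := fun r hr => by
      have h1 := abs_lt.1 (hq r).2
      have h2 := abs_lt.1 (hq 0).2
      rw [hp0] at h2
      linarith [h1.1, h2.2]
    have hcc : cC B x κ (fun r => F (pv b τ r)) = cC B x κ (fun r =>
        (eL B i (fun j => gI m (pv b τ r j.castSucc)) : E n)) := by
      rw [cC, cC, hFe 0 (by omega), hFe 1 (by omega)]
      congr 1
      refine Finset.prod_congr rfl fun r hr => ?_
      rw [Finset.mem_range] at hr
      rw [hFe _ (by omega), hFe _ (by omega)]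
    rw [hcc]
    refine cc_bottom x hκ0 i hm0 (fun r => pv b τ r) hpm _ (fun r j => rfl) ?_ ?_
    · rw [← hFe 0 (by omega), hp0]; exact hk
    · intro r hr
      rw [← hFe r hr]; exact hpos r hr
  let bs : Fin (n + 1 + 1) → ℕ := Fin.snoc (fun _ : Fin (n + 1) => m') 0
  have bs1 : ∀ j : Fin (n + 1), bs j.castSucc = m' := fun j => by simp [bs]
  have bs0 : bs (Fin.last _) = 0 := by simp [bs]
  have bsm : ∀ j, bs j < m := fun j => by
    refine Fin.lastCases ?_ (fun j => ?_) j
    · rw [bs0]; omega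
    · rw [bs1]; omega
  have res := kuhn (N := n + 1) (cC B x κ) (fun y y' hy => by
      rw [cC, cC, hy 0 (by omega), hy 1 (by omega)]
      congr 1
      refine Finset.prod_congr rfl fun r hr => ?_
      rw [Finset.mem_range] at hr
      rw [hy _ (by omega), hy _ (by omega)]) F m (fun b hb τ => by
      obtain ⟨q, hq⟩ := near b τ
      exact cc_cocycle (hU _ _) (fun r _ => (hq r).1) (fun r => hFT _)) (fun τ b hb hb1 => by
      refine c0 _ ?_
      have h1 := pvl b τ 0 (by omega)
      rw [hb1] at h1
      refine Fin.lastCases (motive := fun j => τ (Fin.last _) = j → F (pv b τ 0) = 0) ?_ ?_ _ rfl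
      · intro h; rw [h] at h1; exact Ft _ h1
      · intro j h; rw [h] at h1; exact Fb _ ⟨j, Or.inr h1⟩) bs bsm bs0 (fun τ b hb hb0 hne => by
      have h1 := pvl b τ 0 (by omega)
      rw [hb0] at h1
      have hp0 : pv b τ 0 = b := by funext j; simp [pv]
      refine Fin.lastCases (motive := fun j => τ (Fin.last _) = j → _) ?_ ?_ _ rfl
      · intro hl
        by_cases hk : κ ≤ (F b).2.1
        · rw [bot τ b hb hb0 hl hk]
          by_contra hc
          have hall : ∀ j : Fin (n + 1), τ j.castSucc = j.castSucc ∧ b j.castSucc = m' := by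
            intro j
            by_contra hj
            refine hc ?_
            rw [Finset.prod_eq_zero (Finset.mem_univ j), mul_zero]
            by_cases hτ : τ.symm j.castSucc = j.castSucc
            · have hτ' : τ j.castSucc = j.castSucc := ((Equiv.symm_apply_eq _).1 hτ).symm
              have hb' : b j.castSucc ≠ m' := fun h => hj ⟨hτ', h⟩
              simp only [pv, hτ]
              simp
              split_ifs <;> first | (exfalso; omega) | simp
            · have hne' : ((τ.symm j.castSucc : Fin _) : ℕ) ≠ j := fun h => hτ (Fin.ext h)
              have : pv b τ (j + 1) j.castSucc = pv b τ j j.castSucc := by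
                unfold pv
                congr 1
                refine if_congr ?_ rfl rfl
                omega
              rw [this, sub_self]
          rcases hne with h | h
          · refine h (Equiv.ext fun j => ?_)
            refine Fin.lastCases ?_ (fun j => ?_) j
            · exact hl
            · exact (hall j).1
          · refine h (funext fun j => ?_)
            refine Fin.lastCases ?_ (fun j => ?_) j
            · rw [bs0, ← hl]; exact hb0
            · rw [bs1]; exact (hall j).2
        · rw [cC, c1, if_pos, zero_mul]
          rw [hp0]; exact not_le.1 hk
      · intro j h; rw [h] at h1; exact c0 _ (Fb _ ⟨j, Or.inl h1⟩))
  rw [bot 1 bs bsm bs0 rfl ?_] at res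
  · rw [Finset.prod_eq_one, mul_one] at res
    · exact res
    · intro j _
      have e1 : ((1 : Equiv.Perm (Fin (n + 1 + 1))).symm j.castSucc) = j.castSucc := rfl
      simp [pv, bs1, e1]
  · simp only [hF, grF, bs0, gI_zero, H0]
    refine hκ1.trans ?_
    change _ ≤ bp (mid _)
    have : mid (fun j : Fin (n + 1) => gI m (bs j.castSucc)) = fun _ => 1 / 2 := by
      funext j
      rw [mid, bs1, gI_val (by omega) (by omega), hmd]
      push_cast
      have : (m' : ℝ) ≠ 0 := by positivity
      field_simp
      norm_num
    rw [this, bp, Finset.prod_const]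
    norm_num
end Inj
end CAG
namespace CAG
open Set Function unitInterval Topology.Homotopy

section Lin
variable {n : ℕ} {B : ℕ → Finset ℕ}

/-- all loops with a given profile lie in `S` -/
def SG (S : Subgroup (PG n B)) (P : Cb n → Pr n) : Prop :=
  ∀ f : Lp n B, (∀ x, (f x : E n).2 = P x) → cl f ∈ S

def fl (F : Finset (Fin (n + 1))) (x : Cb n) : Cb n := fun j => if j ∈ F then σ (x j) else x j

theorem flips (hB : ∀ k, ∀ i ∈ B k, i ≤ k) {S : Subgroup (PG n B)} (hS : ∀ i, cl (eL B i) ∈ S)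
    (i : ℕ) (F : Finset (Fin (n + 1))) : SG S (fun x => (Sp i 0 (mid (fl F x))).2) := by
  induction F using Finset.induction_on with
  | empty =>
    intro f hf
    have : cl f = cl (eL B i) := adj hB (fun x => by
        have e : fl ∅ x = x := by funext l; simp [fl]
        rw [hf, eL_val]; beta_reduce; rw [e])
      (fun x => by rw [hf]; rfl)
    rw [this]; exact hS i
  | insert j F hj ih =>
    intro f hf
    have : cl (GenLoop.symmAt j f) ∈ S := ih _ fun x => by
      have e : fl (insert j F) (fun l => if l = j then σ (x j) else x l) = fl F x := by
        funext l
        by_cases hl : l = j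
        · subst hl; simp [fl, hj]
        · simp [fl, hl]
      rw [symmAt_apply, hf]; beta_reduce; rw [e]
    rw [← cl_inv] at this
    exact inv_mem_iff.1 this

noncomputable def hv (n : ℕ) : V n := fun _ => 1 / 2
noncomputable def lin (p : V n) (A : Matrix (Fin (n + 1)) (Fin (n + 1)) ℝ) (y : V n) : V n :=
  hv n + A.mulVec (y - p)

theorem lin_cont {Y : Type*} [TopologicalSpace Y] {p : Y → V n} (hp : Continuous p)
    {A : Y → Matrix (Fin (n + 1)) (Fin (n + 1)) ℝ} (hA : Continuous A) {y : Y → V n}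
    (hy : Continuous y) : Continuous (fun t => lin (p t) (A t) (y t)) := by
  unfold lin
  exact continuous_const.add (hA.matrix_mulVec (hy.sub hp))

theorem lin_htp (hB : ∀ k, ∀ i ∈ B k, i ≤ k) {S : Subgroup (PG n B)} (i : ℕ) {δ : ℝ} (hδ : 0 < δ)
    (p : I → V n) (hp : Continuous p) (A : I → Matrix (Fin (n + 1)) (Fin (n + 1)) ℝ)
    (hA : Continuous A) (h : ∀ t x, 0 < bp (lin (p t) (A t) (rl x)) → δ ≤ bp (rl x))
    (h1 : SG S (fun x => (Sp i 0 (lin (p 1) (A 1) (rl x))).2)) :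
    SG S (fun x => (Sp i 0 (lin (p 0) (A 0) (rl x))).2) := by
  intro f hf
  have hc : Continuous (fun q : I × Cb n => (Sp i 0 (lin (p q.1) (A q.1) (rl q.2))).2) :=
    Sp_cont' i (lin_cont (hp.comp continuous_fst) (hA.comp continuous_fst)
      (rl_cont.comp continuous_snd))
  have hok : ∀ t x, (Sp i 0 (lin (p t) (A t) (rl x))).2 = 0 ∨ (δ ≤ bp (rl x) ∧
      Pf i (Sp i 0 (lin (p t) (A t) (rl x))).2) := fun t x => Sp_ok le_rfl (h t x)
  rw [PL_htp hB hδ (fun t x => (Sp i 0 (lin (p t) (A t) (rl x))).2) hc hok hf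
    (g := PL δ hδ i _ (hc.comp (by fun_prop : Continuous fun x => ((1 : I), x))) (hok 1)) fun x => rfl]
  exact h1 _ fun x => rfl

theorem gl_bound (γ : I → Matrix (Fin (n + 1)) (Fin (n + 1)) ℝ) (hγ : Continuous γ)
    (hd : ∀ t, (γ t).det ≠ 0) : ∃ c > 0, ∀ t (v : V n), c * ‖v‖ ≤ ‖(γ t).mulVec v‖ := by
  have hc : Continuous fun q : I × V n => ‖(γ q.1).mulVec q.2‖ :=
    ((hγ.comp continuous_fst).matrix_mulVec continuous_snd).norm
  have hne : ((univ : Set I) ×ˢ Metric.sphere (0 : V n) 1).Nonempty :=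
    ⟨(0, fun _ => 1), mem_univ _, by simp [pi_norm_const]⟩
  obtain ⟨q, hq, hmin⟩ := (isCompact_univ.prod (isCompact_sphere (0 : V n) 1)).exists_isMinOn hne
    hc.continuousOn
  refine ⟨‖(γ q.1).mulVec q.2‖, ?_, fun t v => ?_⟩
  · rw [gt_iff_lt, norm_pos_iff]
    intro h0
    have := Matrix.eq_zero_of_mulVec_eq_zero (hd q.1) h0
    have h2 : q.2 ∈ Metric.sphere (0 : V n) 1 := hq.2
    rw [this] at h2; simp at h2
  · rcases eq_or_ne v 0 with rfl | hv0
    · simp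
    have hv1 : 0 < ‖v‖ := norm_pos_iff.2 hv0
    have := hmin (a := (t, ‖v‖⁻¹ • v)) ⟨mem_univ _, by simp [norm_smul, hv1.ne']⟩
    simp only [mem_ofPred_eq, Matrix.mulVec_smul, norm_smul, norm_inv, norm_norm] at this
    rwa [inv_mul_eq_div, le_div_iff₀ hv1] at this

theorem bp_hv {w : V n} (h : 0 < bp (hv n + w)) : ‖w‖ < 1 / 2 := by
  rw [pi_norm_lt_iff (by norm_num)]
  intro j
  have := bp_pos.1 h j
  simp only [hv, Pi.add_apply] at this
  rw [Real.norm_eq_abs, abs_lt]; constructor <;> linarith [this.1, this.2]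

theorem lin_supp {η c μ : ℝ} (hη : 0 < η) (hη1 : η ≤ 1 / 2) (hc : 0 < c) (hμ : 1 ≤ μ * c * η)
    {p : V n} (hp : ∀ j, η ≤ p j ∧ p j ≤ 1 - η)
    {A : Matrix (Fin (n + 1)) (Fin (n + 1)) ℝ} (hA : ∀ v : V n, c * ‖v‖ ≤ ‖A.mulVec v‖)
    {y : V n} (h : 0 < bp (lin p (μ • A) y)) : (η / 4) ^ (n + 1) ≤ bp y := by
  have hμ0 : 0 < μ := by
    by_contra hc'
    have h1 : μ * c * η ≤ 0 := by
      have : 0 < c * η := by positivity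
      nlinarith
    linarith
  have h1 := bp_hv h
  rw [Matrix.smul_mulVec, norm_smul, Real.norm_eq_abs, abs_of_pos hμ0] at h1
  have h2 := hA (y - p)
  have h3 : ‖y - p‖ ≤ η / 2 := by
    by_contra h4
    rw [not_le] at h4
    have h5 : μ * (c * (η / 2)) ≤ μ * ‖A.mulVec (y - p)‖ := by gcongr; nlinarith
    nlinarith
  rw [pi_norm_le_iff_of_nonneg (by linarith)] at h3
  unfold bp
  have : (η / 4) ^ (n + 1) = ∏ j : Fin (n + 1), (η / 4) := by rw [Finset.prod_const]; simp
  rw [this]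
  refine Finset.prod_le_prod (fun _ _ => by positivity) fun j _ => le_max_of_le_right ?_
  have h4 := abs_le.1 (h3 j)
  simp only [Pi.sub_apply] at h4
  have h5 := hp j
  have e1 : η / 2 ≤ y j := by linarith
  have e2 : η / 2 ≤ 1 - y j := by linarith
  rcases le_total (y j) (1 / 2) with h | h <;> nlinarith

theorem gl_path (A : Matrix (Fin (n + 1)) (Fin (n + 1)) ℝ) (hA : A.det ≠ 0) :
    ∃ γ : I → Matrix (Fin (n + 1)) (Fin (n + 1)) ℝ, Continuous γ ∧ (∀ t, (γ t).det ≠ 0) ∧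
      γ 0 = A ∧ ∃ D : Fin (n + 1) → ℝ, (∀ j, D j = 1 ∨ D j = -1) ∧ γ 1 = Matrix.diagonal D := by
  refine Matrix.diagonal_transvection_induction_of_det_ne_zero (fun A => ∃ γ : I → Matrix (Fin (n + 1)) (Fin (n + 1)) ℝ, Continuous γ ∧ (∀ t, (γ t).det ≠ 0) ∧
      γ 0 = A ∧ ∃ D : Fin (n + 1) → ℝ, (∀ j, D j = 1 ∨ D j = -1) ∧ γ 1 = Matrix.diagonal D) A hA ?_ ?_ ?_
  · intro D hD
    rw [Matrix.det_diagonal, Finset.prod_ne_zero_iff] at hD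
    refine ⟨fun t => Matrix.diagonal fun j => (1 - (t : ℝ)) * D j + t * (if 0 < D j then 1 else -1),
      ?_, fun t => ?_, ?_, fun j => if 0 < D j then 1 else -1, fun j => ?_, ?_⟩
    · exact Continuous.matrix_diagonal (by fun_prop)
    · rw [Matrix.det_diagonal, Finset.prod_ne_zero_iff]
      intro j _
      have h := hD j (Finset.mem_univ j)
      have t0 := t.2.1
      have t1 := t.2.2
      rcases lt_or_gt_of_ne h with h | h
      · rw [if_neg h.not_gt]
        refine ne_of_lt ?_
        rcases t0.eq_or_lt with h0 | h0
        · rw [← h0]; linarith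
        · nlinarith
      · rw [if_pos h]
        refine ne_of_gt ?_
        rcases t0.eq_or_lt with h0 | h0
        · rw [← h0]; linarith
        · nlinarith
    · simp
    · beta_reduce; split_ifs <;> simp
    · simp
  · intro t
    refine ⟨fun r => Matrix.transvection t.i t.j ((1 - (r : ℝ)) * t.c), ?_, fun r => ?_, ?_,
      fun _ => 1, fun _ => Or.inl rfl, ?_⟩
    · unfold Matrix.transvection
      refine continuous_const.add ?_
      refine continuous_matrix fun a b => ?_
      simp only [Matrix.single_apply]
      split_ifs <;> fun_prop
    · rw [Matrix.det_transvection_of_ne _ _ t.hij]; exact one_ne_zero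
    · simp [Matrix.TransvectionStruct.toMatrix]
    · simp
  · intro A C hA hC h1 h2
    obtain ⟨γ, a1, a2, a3, D, a4, a5⟩ := h1
    obtain ⟨γ', b1, b2, b3, D', b4, b5⟩ := h2
    refine ⟨fun t => γ t * γ' t, a1.matrix_mul b1, fun t => ?_, by beta_reduce; rw [a3, b3],
      fun j => D j * D' j, fun j => ?_, by beta_reduce; rw [a5, b5, Matrix.diagonal_mul_diagonal]⟩
    · rw [Matrix.det_mul]; exact mul_ne_zero (a2 t) (b2 t)
    · rcases a4 j with h | h <;> rcases b4 j with h' | h' <;> simp [h, h']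

theorem lin_mem (hB : ∀ k, ∀ i ∈ B k, i ≤ k) {S : Subgroup (PG n B)} (hS : ∀ i, cl (eL B i) ∈ S)
    (i : ℕ) {p : V n} (hp : 0 < bp p) {A : Matrix (Fin (n + 1)) (Fin (n + 1)) ℝ} (hA : A.det ≠ 0)
    {μ δ : ℝ} (hμ : 0 < μ) (hδ : 0 < δ)
    (hs : ∀ x : Cb n, 0 < bp (lin p (μ • A) (rl x)) → δ ≤ bp (rl x)) :
    SG S (fun x => (Sp i 0 (lin p (μ • A) (rl x))).2) := by
  obtain ⟨γ, a1, a2, a3, D, a4, a5⟩ := gl_path A hA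
  obtain ⟨c, hc, hcb⟩ := gl_bound γ a1 a2
  rw [bp_pos] at hp
  obtain ⟨η, hη, hη1, hηp⟩ : ∃ η : ℝ, 0 < η ∧ η ≤ 1 / 2 ∧ ∀ j, η ≤ p j ∧ p j ≤ 1 - η := by
    obtain ⟨j0, -, hj0⟩ := Finset.exists_min_image Finset.univ (fun j => min (p j) (1 - p j))
      ⟨0, Finset.mem_univ _⟩
    refine ⟨min (p j0) (1 - p j0), lt_min (hp j0).1 (by linarith [(hp j0).2]), ?_, fun j => ?_⟩
    · rcases le_total (p j0) (1 / 2) with h | h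
      · exact (min_le_left _ _).trans h
      · exact (min_le_right _ _).trans (by linarith)
    · have := hj0 j (Finset.mem_univ j)
      exact ⟨this.trans (min_le_left _ _), by linarith [this.trans (min_le_right _ _)]⟩
  obtain ⟨μ', hμ', hμ2⟩ : ∃ μ' : ℝ, max μ 2 ≤ μ' ∧ 1 ≤ μ' * c * η := by
    refine ⟨max (max μ 2) (1 / (c * η)), le_max_left _ _, ?_⟩
    have := le_max_right (max μ 2) (1 / (c * η))
    rw [div_le_iff₀ (by positivity)] at this
    linarith
  have m1 : μ ≤ μ' := (le_max_left _ _).trans hμ'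
  have m2 : 2 ≤ μ' := (le_max_right _ _).trans hμ'
  have hδ' : 0 < (η / 4) ^ (n + 1) := by positivity
  have hhv : ∀ j, η ≤ hv n j ∧ hv n j ≤ 1 - η := fun j => by
    simp only [hv]; constructor <;> linarith
  have dl : ∀ (ν : ℝ) (p : V n) (A : Matrix (Fin (n + 1)) (Fin (n + 1)) ℝ) (y : V n) (κ : ℝ), 
      lin p ((ν * κ) • A) y = dil ν (lin p (κ • A) y) := fun ν p A y κ => by
    funext j
    simp [lin, dil, hv, Matrix.smul_mulVec]; ring
  -- diagonal stage
  have s4 : SG S (fun x => (Sp i 0 (lin (hv n) ((2 : ℝ) • Matrix.diagonal D) (rl x))).2) := by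
    intro f hf
    refine flips hB hS i (Finset.univ.filter fun j => D j = -1) f fun x => ?_
    have e : lin (hv n) ((2 : ℝ) • Matrix.diagonal D) (rl x) =
        mid (fl (Finset.univ.filter fun j => D j = -1) x) := ?_
    · rw [hf]; beta_reduce; rw [e]
    funext j
    simp only [lin, Pi.add_apply, Matrix.smul_mulVec, Pi.smul_apply, Matrix.mulVec_diagonal, hv,
      Pi.sub_apply, rl, mid, fl, smul_eq_mul]
    rcases a4 j with h | h
    · rw [h, if_neg (by simp [h]; norm_num)]; ring
    · rw [h, if_pos (by simp [h]), coe_symm_eq]; ring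
  have s3 : SG S (fun x => (Sp i 0 (lin (hv n) (μ' • Matrix.diagonal D) (rl x))).2) := by
    have := lin_htp hB (S := S) i (δ := dn n) dn_pos (fun _ => hv n) continuous_const
      (fun t => ((1 - (t : ℝ)) * μ' + t * 2) • Matrix.diagonal D) (by fun_prop) ?_ (by simpa using s4)
    · simpa using this
    · intro t x hx
      have t0 := t.2.1
      have t1 := t.2.2
      have e : (1 - (t : ℝ)) * μ' + t * 2 = (((1 - (t : ℝ)) * μ' + t * 2) / 2) * 2 := by ring
      rw [e, dl] at hx
      have hx := bp_pos.1 (dil_bp (by nlinarith) hx)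
      refine dn_le fun j => ?_
      have := hx j
      simp only [lin, Pi.add_apply, Matrix.smul_mulVec, Pi.smul_apply, Matrix.mulVec_diagonal, hv,
        Pi.sub_apply, rl, smul_eq_mul] at this
      simp only [mid]
      rcases a4 j with h | h <;> rw [h] at this <;> constructor <;> linarith [this.1, this.2]
  have s2 : SG S (fun x => (Sp i 0 (lin (hv n) (μ' • A) (rl x))).2) := by
    have := lin_htp hB (S := S) i hδ' (fun _ => hv n) continuous_const
      (fun t => μ' • γ t) (by fun_prop) 
      (fun t x h => lin_supp hη hη1 hc hμ2 hhv (hcb t) h) (by rw [a5]; exact s3)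
    rwa [a3] at this
  have s1 : SG S (fun x => (Sp i 0 (lin p (μ' • A) (rl x))).2) := by
    have := lin_htp hB (S := S) i hδ' (fun t => (1 - (t : ℝ)) • p + (t : ℝ) • hv n) (by fun_prop)
      (fun t => μ' • A) (by fun_prop) ?_ (by simpa using s2)
    · simpa using this
    · intro t x h
      refine lin_supp hη hη1 hc hμ2 (fun j => ?_) (fun v => by rw [← a3]; exact hcb 0 v) h
      have t0 := t.2.1
      have t1 := t.2.2
      have q1 := hηp j
      have q2 := hhv j
      simp only [Pi.add_apply, Pi.smul_apply, smul_eq_mul]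
      constructor <;> nlinarith [q1.1, q1.2, q2.1, q2.2]
  have := lin_htp hB (S := S) i hδ (fun _ => p) continuous_const
    (fun t => ((1 - (t : ℝ)) * μ + t * μ') • A) (by fun_prop) ?_ (by simpa using s1)
  · simpa using this
  · intro t x hx
    have t0 := t.2.1
    have t1 := t.2.2
    have e : (1 - (t : ℝ)) * μ + t * μ' = (((1 - (t : ℝ)) * μ + t * μ') / μ) * μ := by field_simp
    rw [e, dl] at hx
    refine hs x (dil_bp ?_ hx)
    rw [le_div_iff₀ hμ]; nlinarith
end Lin
end CAG
namespace CAG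
open Set Function unitInterval Topology.Homotopy

section Split
variable {n : ℕ} {B : ℕ → Finset ℕ}

theorem SG_zero (hB : ∀ k, ∀ i ∈ B k, i ≤ k) (S : Subgroup (PG n B)) :
    SG S (fun _ => 0) := by
  intro f hf
  have : cl f = 1 := by
    rw [cl_one]
    exact adj hB (fun x => by rw [hf]; rfl) fun x => by rw [hf]; rfl
  rw [this]; exact one_mem S

theorem split_many (hB : ∀ k, ∀ i ∈ B k, i ≤ k) {S : Subgroup (PG n B)} {δ r : ℝ} (hδ : 0 < δ)
    (hr : 0 < r) {k : ℕ} (P : V n → Cb n → Pr n) (Sf : Finset (V n))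
    (hc : ∀ p ∈ Sf, Continuous (P p))
    (h : ∀ p ∈ Sf, ∀ x, P p x = 0 ∨ (‖rl x - p‖ ≤ r ∧ δ ≤ bp (rl x) ∧ Pf k (P p x)))
    (hsep : ∀ p ∈ Sf, ∀ q ∈ Sf, ∀ j, p j = q j ∨ 4 * r < |p j - q j|)
    (hin : ∀ p ∈ Sf, ∀ j, 0 < p j ∧ p j < 1)
    (hm : ∀ p ∈ Sf, SG S (P p)) : SG S (fun x => ∑ p ∈ Sf, P p x) := by
  induction Sf using Finset.strongInduction with
  | H Sf ih =>
  by_cases hcard : ∃ p ∈ Sf, ∃ q ∈ Sf, ∃ j, p j < q j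
  swap
  · have hsub : ∀ p ∈ Sf, ∀ q ∈ Sf, p = q := fun p hp q hq => by
      by_contra hne
      obtain ⟨j, hj⟩ := Function.ne_iff.1 hne
      rcases lt_or_gt_of_ne hj with h | h
      · exact hcard ⟨p, hp, q, hq, j, h⟩
      · exact hcard ⟨q, hq, p, hp, j, h⟩
    rcases Sf.eq_empty_or_nonempty with rfl | ⟨p, hp⟩
    · simpa using SG_zero hB S
    · have : Sf = {p} := Finset.eq_singleton_iff_unique_mem.2 ⟨hp, fun q hq => hsub q hq p hp⟩
      subst this
      simpa using hm p hp
  obtain ⟨p, hp, q, hq, j, hpq⟩ := hcard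
  have h4 : 4 * r < q j - p j := by
    rcases hsep p hp q hq j with h | h
    · exact absurd h hpq.ne
    · rwa [abs_sub_comm, abs_of_pos (by linarith)] at h
  set c := p j + 2 * r with hcdef
  have near : ∀ p' ∈ Sf, ∀ x, P p' x ≠ 0 → |(x j : ℝ) - p' j| ≤ r := fun p' hp' x hx => by
    rcases h p' hp' x with h | ⟨h, _⟩
    · exact absurd h hx
    · exact (norm_le_pi_norm (rl x - p') j).trans h
  have far : ∀ p' ∈ Sf, p' j ≤ p j ∨ p j + 4 * r < p' j := fun p' hp' => by
    rcases hsep p' hp' p hp j with h | h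
    · exact Or.inl h.le
    · rcases le_total (p' j) (p j) with h' | h'
      · exact Or.inl h'
      · rw [abs_of_nonneg (by linarith)] at h; exact Or.inr (by linarith)
  have lo : ∀ p' ∈ Sf, p' j ≤ c → ∀ x, P p' x ≠ 0 → (x j : ℝ) ≤ c - r := fun p' hp' hpc x hx => by
    have a := abs_le.1 (near p' hp' x hx)
    rcases far p' hp' with h | h <;> linarith [a.1, a.2]
  have hi : ∀ p' ∈ Sf, ¬ p' j ≤ c → ∀ x, P p' x ≠ 0 → c + r ≤ (x j : ℝ) := fun p' hp' hpc x hx => by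
    have a := abs_le.1 (near p' hp' x hx)
    rw [not_le] at hpc
    rcases far p' hp' with h | h <;> linarith [a.1, a.2]
  have sum_eq : ∀ x, ∀ p' ∈ Sf, P p' x ≠ 0 → ∀ F ⊆ Sf, p' ∈ F → ∑ p ∈ F, P p x = P p' x := by
    intro x p' hp' hx F hF hpF
    refine Finset.sum_eq_single_of_mem _ hpF fun q' hq' hne => ?_
    by_contra hx'
    refine hne ?_
    rcases h p' hp' x with h1 | ⟨h1, _⟩
    · exact absurd h1 hx
    rcases h q' (hF hq') x with h2 | ⟨h2, _⟩
    · exact absurd h2 hx'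
    funext l
    rcases hsep q' (hF hq') p' hp' l with h3 | h3
    · exact h3
    have a := abs_le.1 ((norm_le_pi_norm (rl x - p') l).trans h1)
    have b := abs_le.1 ((norm_le_pi_norm (rl x - q') l).trans h2)
    simp only [Pi.sub_apply] at a b
    exfalso
    rcases lt_abs.1 h3 with h3 | h3 <;> linarith [a.1, a.2, b.1, b.2]
  have sum_ok : ∀ F ⊆ Sf, ∀ x, ∑ p ∈ F, P p x = 0 ∨
      ∃ p' ∈ F, P p' x ≠ 0 ∧ ∑ p ∈ F, P p x = P p' x := by
    intro F hF x
    by_cases h0 : ∃ p' ∈ F, P p' x ≠ 0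
    · obtain ⟨p', hp', hx⟩ := h0
      exact Or.inr ⟨p', hp', hx, sum_eq x p' (hF hp') hx F hF hp'⟩
    · push Not at h0
      exact Or.inl (Finset.sum_eq_zero h0)
  have sum_pf : ∀ F ⊆ Sf, ∀ x, ∑ p ∈ F, P p x = 0 ∨ (δ ≤ bp (rl x) ∧ Pf k (∑ p ∈ F, P p x)) := by
    intro F hF x
    rcases sum_ok F hF x with h0 | ⟨p', hp', hx, e⟩
    · exact Or.inl h0
    · rw [e]; exact (h p' (hF hp') x).imp id fun h => h.2
  have scont : ∀ F ⊆ Sf, Continuous fun x => ∑ p ∈ F, P p x := fun F hF =>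
    continuous_finsetSum _ fun p hp => hc p (hF hp)
  set Sm := Sf.filter fun p' => p' j ≤ c
  set Sp := Sf.filter fun p' => ¬ p' j ≤ c
  have em : Sm ⊂ Sf := Finset.filter_ssubset.2 ⟨q, hq, by linarith⟩
  have ep : Sp ⊂ Sf := Finset.filter_ssubset.2 ⟨p, hp, fun hh => hh (by linarith)⟩
  intro f hf
  have key := split_pf (k := k) hB (lt_min hδ hr) (scont Sf subset_rfl) j c (by linarith [(hin p hp j).1]) 
    (by linarith [(hin q hq j).2]) ?_ hf
    (fm := PL δ hδ k _ (scont Sm em.1) (sum_pf Sm em.1))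
    (fp := PL δ hδ k _ (scont Sp ep.1) (sum_pf Sp ep.1)) ?_ ?_
  · rw [key]
    have hs : ∀ F ⊂ Sf, SG S (fun x => ∑ p ∈ F, P p x) := fun F hF =>
      ih F hF (fun p hp => hc p (hF.1 hp)) (fun p hp => h p (hF.1 hp))
        (fun p hp q hq => hsep p (hF.1 hp) q (hF.1 hq)) (fun p hp => hin p (hF.1 hp))
        (fun p hp => hm p (hF.1 hp))
    exact mul_mem (hs Sp ep _ fun x => rfl) (hs Sm em _ fun x => rfl)
  · intro x
    rcases sum_ok Sf subset_rfl x with h0 | ⟨p', hp', hx, e⟩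
    · exact Or.inl h0
    · rw [e]
      refine (h p' hp' x).imp id fun ⟨_, h1, h2⟩ => ⟨(min_le_left _ _).trans h1, 
        (min_le_right _ _).trans ?_, h2⟩
      by_cases hpc : p' j ≤ c
      · have := lo p' hp' hpc x hx
        rw [abs_sub_comm]; exact le_trans (by linarith) (le_abs_self _)
      · have := hi p' hp' hpc x hx
        exact le_trans (by linarith) (le_abs_self _)
  · intro x
    show ∑ p ∈ Sm, P p x = if (x j : ℝ) ≤ c then ∑ p ∈ Sf, P p x else 0
    split_ifs with hxc
    · refine Finset.sum_subset em.1 fun p' hp' hn => ?_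
      by_contra hx
      have := hi p' hp' (fun hh => hn (Finset.mem_filter.2 ⟨hp', hh⟩)) x hx
      linarith
    · refine Finset.sum_eq_zero fun p' hp' => ?_
      by_contra hx
      have := lo p' (em.1 hp') (Finset.mem_filter.1 hp').2 x hx
      linarith
  · intro x
    show ∑ p ∈ Sp, P p x = if c ≤ (x j : ℝ) then ∑ p ∈ Sf, P p x else 0
    split_ifs with hxc
    · refine Finset.sum_subset ep.1 fun p' hp' hn => ?_
      by_contra hx
      have := lo p' hp' (by_contra fun hh => hn (Finset.mem_filter.2 ⟨hp', hh⟩)) x hx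
      linarith
    · refine Finset.sum_eq_zero fun p' hp' => ?_
      by_contra hx
      have := hi p' (ep.1 hp') (Finset.mem_filter.1 hp').2 x hx
      linarith

/-- piece of a profile near `p` -/
noncomputable def pc (i : ℕ) (p : V n) (r : ℝ) (g : V n) (x : Cb n) : Pr n :=
  if ‖rl x - p‖ ≤ r then (Sp i 0 g).2 else 0

theorem pc_cont {Y : Type*} [TopologicalSpace Y] (i : ℕ) (p : V n) (r : ℝ) {g : Y → V n}
    (hg : Continuous g) {x : Y → Cb n} (hx : Continuous x) 
    (h : ∀ y, ‖rl (x y) - p‖ = r → ¬ 0 < bp (g y)) : Continuous fun y => pc i p r (g y) (x y) := by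
  unfold pc
  refine Continuous.if_le (Sp_cont' i hg) continuous_const 
    ((rl_cont.comp hx).sub continuous_const).norm continuous_const fun y hy => Sp_snd0 (h y hy)

theorem pc_ok {i k : ℕ} (hik : i ≤ k) {p : V n} {r δ : ℝ} (hδ : ∀ x : Cb n, ‖rl x - p‖ ≤ r → δ ≤ bp (rl x))
    (g : V n) (x : Cb n) : pc i p r g x = 0 ∨ (‖rl x - p‖ ≤ r ∧ δ ≤ bp (rl x) ∧ Pf k (pc i p r g x)) := by
  unfold pc
  split_ifs with h
  · exact Or.inr ⟨h, hδ x h, i, hik, g, rfl⟩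
  · exact Or.inl rfl

theorem dil_eq (μ : ℝ) (v : V n) : dil μ v = hv n + μ • (v - hv n) := by
  funext j; simp [dil, hv]

theorem dil_far {μ c : ℝ} (hμ : 0 ≤ μ) (h1 : 1 ≤ μ * c) {v : V n} (h : c ≤ ‖v - hv n‖) :
    ¬ 0 < bp (dil μ v) := fun hp => by
  rw [dil_eq] at hp
  have := bp_hv hp
  rw [norm_smul, Real.norm_eq_abs, abs_of_nonneg hμ] at this
  nlinarith

theorem piece_mem (hB : ∀ k, ∀ i ∈ B k, i ≤ k) {S : Subgroup (PG n B)} (hS : ∀ i, cl (eL B i) ∈ S)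
    (i : ℕ) {p : V n} (hp : 0 < bp p) {A : Matrix (Fin (n + 1)) (Fin (n + 1)) ℝ} (hA : A.det ≠ 0)
    {μ δ κ r : ℝ} (hμ : 0 < μ) (hδ : 0 < δ) (hκ : 0 < κ) (hr : 0 < r) (hμr : 1 ≤ μ * (κ * r))
    {W : V n → V n} (hW : Continuous W) 
    (hl : ∀ y, ‖y - p‖ ≤ r → ‖W y - hv n - A.mulVec (y - p)‖ ≤ κ * ‖y - p‖)
    (hA2 : ∀ v : V n, 2 * κ * ‖v‖ ≤ ‖A.mulVec v‖)
    (hs : ∀ x : Cb n, ‖rl x - p‖ ≤ r → δ ≤ bp (rl x)) :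
    Continuous (fun x => pc i p r (dil μ (W (rl x))) x) ∧
    SG S (fun x => pc i p r (dil μ (W (rl x))) x) := by
  have hrl := rl_cont (n := n)
  let Wt : I → V n → V n := fun t y => (1 - (t : ℝ)) • W y + (t : ℝ) • (hv n + A.mulVec (y - p))
  have hmc : Continuous fun v : V n => A.mulVec v := continuous_const.matrix_mulVec continuous_id
  have hWc : Continuous fun q : I × Cb n => dil μ (Wt q.1 (rl q.2)) := by
    refine dil_cont.comp (Continuous.prodMk continuous_const ?_)
    have h1 : Continuous fun q : I × Cb n => A.mulVec (rl q.2 - p) := hmc.comp (by fun_prop)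
    fun_prop
  have hfar : ∀ t : I, ∀ y, ‖y - p‖ = r → κ * r ≤ ‖Wt t y - hv n‖ := by
    intro t y hy
    have e : A.mulVec (y - p) = (Wt t y - hv n) - (1 - (t : ℝ)) • (W y - hv n - A.mulVec (y - p)) := by
      simp only [Wt]; module
    have h1 := hA2 (y - p)
    have h2 := hl y hy.le
    have t0 := t.2.1
    have t1 := t.2.2
    have h3 : ‖(1 - (t : ℝ)) • (W y - hv n - A.mulVec (y - p))‖ ≤ κ * r := by
      rw [norm_smul, Real.norm_eq_abs, abs_of_nonneg (by linarith), ← hy]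
      nlinarith [norm_nonneg (W y - hv n - A.mulVec (y - p))]
    have h4 := norm_sub_le (Wt t y - hv n) ((1 - (t : ℝ)) • (W y - hv n - A.mulVec (y - p)))
    rw [← e] at h4
    rw [hy] at h1
    linarith
  have hcon : Continuous fun q : I × Cb n => pc i p r (dil μ (Wt q.1 (rl q.2))) q.2 :=
    pc_cont i p r hWc continuous_snd fun q hq => dil_far hμ.le hμr (hfar q.1 _ hq)
  have e0 : ∀ y, Wt 0 y = W y := fun y => by simp [Wt]
  have hok : ∀ t x, pc i p r (dil μ (Wt t (rl x))) x = 0 ∨ (δ ≤ bp (rl x) ∧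
    Pf i (pc i p r (dil μ (Wt t (rl x))) x)) := fun t x => (pc_ok le_rfl hs _ x).imp id fun h => h.2
  have hsec : ∀ t : I, Continuous fun x : Cb n => (t, x) := fun t => by fun_prop
  refine ⟨by simpa [Function.comp_def, e0] using hcon.comp (hsec 0), fun f hf => ?_⟩
  rw [PL_htp hB hδ (fun t x => pc i p r (dil μ (Wt t (rl x))) x) hcon hok (fun x => by rw [hf, e0])
    (g := PL δ hδ i _ (hcon.comp (hsec 1)) (hok 1)) fun x => rfl]
  have e1 : ∀ y, dil μ (Wt 1 y) = lin p (μ • A) y := fun y => by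
    rw [dil_eq]; simp [Wt, lin, Matrix.smul_mulVec]
  have hout : ∀ x : Cb n, 0 < bp (lin p (μ • A) (rl x)) → ‖rl x - p‖ ≤ r := fun x hx => by
    by_contra hn
    rw [not_le] at hn
    rw [← e1] at hx
    refine dil_far hμ.le hμr ?_ hx
    simp only [Wt, Icc.coe_one, sub_self, zero_smul, one_smul, zero_add, add_sub_cancel_left]
    have := hA2 (rl x - p)
    have : κ * r ≤ κ * ‖rl x - p‖ := by gcongr
    nlinarith
  refine lin_mem hB hS i hp hA hμ hδ (fun x hx => hs x (hout x hx)) _ fun x => ?_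
  show pc i p r (dil μ (Wt 1 (rl x))) x = _
  rw [e1]
  unfold pc
  split_ifs with h
  · rfl
  · exact (Sp_snd0 fun hx => h (hout x hx)).symm
end Split
end CAG
namespace CAG
open Set Function unitInterval Topology.Homotopy

section Reg
variable {n : ℕ} {B : ℕ → Finset ℕ}

noncomputable def ii (z : E n) : ℕ := ⌊uu z 0⌋₊
noncomputable def vv (z : E n) : V n := uu z - Pi.single 0 (ii z : ℝ)

theorem sp_facts (hB : ∀ k, ∀ i ∈ B k, i ≤ k) {z : E n} (hz : z ∈ TT B) (hl : 0 < z.2.1)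
    (hw : z.2.2.1 = 0) : (ii z : ℝ) + 1 ≤ z.1 ∧ 0 < bp (vv z) ∧ z.2.1 = bp (vv z) ∧
      z.2 = (Sp (ii z) 0 (vv z)).2 := by
  rcases T_cases hB hz with ⟨h1, h2⟩ | ⟨i, s, v, h1, h2, h3⟩ | ⟨k, v', t', g1, g2, g3, g4⟩
  · rw [h2] at hl; exact absurd hl (lt_irrefl _)
  · have e1 : uu z = v + Pi.single 0 (i : ℝ) := uu_eq hl (by rw [h3]; rfl)
    have hv0 := bp_pos.1 h2 0
    have e2 : ii z = i := by
      rw [ii, e1, Nat.floor_eq_iff]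
      · simp; constructor <;> linarith [hv0.1, hv0.2]
      · simp; linarith [hv0.1, (Nat.cast_nonneg i : (0 : ℝ) ≤ i)]
    have e3 : vv z = v := by rw [vv, e2, e1]; simp
    rw [e2, e3, h3]
    exact ⟨h1, h2, rfl, rfl⟩
  · have := cell_facts g1 g2 g3 g4; linarith [this.2.2.1]

theorem ii_near (hB : ∀ k, ∀ i ∈ B k, i ≤ k) {z : E n} (hz : z ∈ TT B) (hl : 0 < z.2.1)
    (hw : z.2.2.1 = 0) : ∀ᶠ y in 𝓝 z, ii y = ii z := by
  have h1 := bp_pos.1 (sp_facts hB hz hl hw).2.1 0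
  simp only [vv, Pi.sub_apply, Pi.single_eq_same] at h1
  have c : ContinuousAt (fun y => uu y 0) z := (continuous_apply 0).continuousAt.comp (uu_contAt hl)
  filter_upwards [c.eventually (Ioo_mem_nhds (show (ii z : ℝ) < uu z 0 by linarith [h1.1]) 
    (show uu z 0 < ii z + 1 by linarith [h1.2]))] with y hy
  have : ⌊uu y 0⌋₊ = ii z := by
    rw [Nat.floor_eq_iff ((Nat.cast_nonneg (ii z)).trans hy.1.le)]
    exact ⟨hy.1.le, hy.2⟩
  exact this

theorem vv_contAt (hB : ∀ k, ∀ i ∈ B k, i ≤ k) {z : E n} (hz : z ∈ TT B) (hl : 0 < z.2.1)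
    (hw : z.2.2.1 = 0) : ContinuousAt vv z := by
  have : ContinuousAt (fun y => uu y - Pi.single 0 (ii z : ℝ)) z :=
    (uu_contAt hl).sub continuousAt_const
  refine this.congr ?_
  filter_upwards [ii_near hB hz hl hw] with y hy
  rw [vv, hy]

theorem Sp_norm {i : ℕ} {v : V n} : ‖(Sp i 0 v).2‖ ≤ bp v * (2 + i) := by
  have hi : (0 : ℝ) ≤ i := Nat.cast_nonneg i
  by_cases hv : 0 < bp v
  · have h1 : ‖v + Pi.single 0 (i : ℝ)‖ ≤ 2 + i := by
      refine (norm_add_le _ _).trans ?_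
      have := norm_V zero_le_one fun j => ⟨(bp_pos.1 hv j).1.le, (bp_pos.1 hv j).2.le⟩
      rw [Pi.norm_single, Real.norm_of_nonneg hi]; linarith
    simp only [Sp]
    rw [Prod.norm_mk, Prod.norm_mk, norm_smul, Real.norm_of_nonneg hv.le, norm_zero]
    refine max_le ?_ (max_le (by positivity) (by gcongr))
    nlinarith
  · rw [Sp_snd0 hv, norm_zero]; exact mul_nonneg (bp_nonneg _) (by linarith)

theorem sp_htp (hB : ∀ k, ∀ i ∈ B k, i ≤ k) (f : Lp n B) (hw : ∀ x, (f x : E n).2.2.1 = 0)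
    (v : I → Cb n → V n) {C : ℝ} (hC : 0 ≤ C)
    (hc : ∀ t x, 0 < (f x : E n).2.1 → ContinuousAt (uncurry v) (t, x))
    (hb : ∀ t x, 0 < (f x : E n).2.1 → bp (v t x) ≤ C * (f x : E n).2.1)
    (h0 : ∀ x, 0 < (f x : E n).2.1 → v 0 x = vv (f x : E n)) : ∃ g : Lp n B, cl f = cl g ∧
      ∀ x, (g x : E n).2 = if 0 < (f x : E n).2.1 then (Sp (ii (f x : E n)) 0 (v 1 x)).2 else 0 := by
  have hf := L_cont f
  let H : I → Cb n → E n := fun t x => ((f x : E n).1, 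
    if 0 < (f x : E n).2.1 then (Sp (ii (f x : E n)) 0 (v t x)).2 else 0)
  have hHc : Continuous (uncurry H) := by
    refine Continuous.prodMk (by fun_prop : Continuous fun q : I × Cb n => (f q.2 : E n).1) ?_
    rw [continuous_iff_continuousAt]
    rintro ⟨t, x⟩
    have hlc : Continuous fun q : I × Cb n => (f q.2 : E n).2.1 := by fun_prop
    by_cases hx : 0 < (f x : E n).2.1
    · have h1 : ContinuousAt (fun q : I × Cb n => (Sp (ii (f x : E n)) 0 (uncurry v q)).2) (t, x) :=
        ContinuousAt.comp (g := fun w => (Sp (ii (f x : E n)) 0 w).2) 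
          (Sp_cont' _ continuous_id).continuousAt (hc t x hx)
      refine h1.congr ?_
      have h2 : ∀ᶠ q : I × Cb n in 𝓝 (t, x), ii (f q.2 : E n) = ii (f x : E n) :=
        (show Filter.Tendsto (fun q : I × Cb n => (f q.2 : E n)) (𝓝 (t, x)) (𝓝 (f x : E n)) from
          (hf.comp continuous_snd).tendsto (t, x)).eventually (ii_near hB (f x).2 hx (hw x))
      filter_upwards [h2, hlc.continuousAt.eventually (lt_mem_nhds hx)] with q h3 h4
      rw [if_pos h4, h3]; rfl
    · have hx0 : (f x : E n).2.1 = 0 := le_antisymm (not_lt.1 hx) (T_bd hB (f x).2).2.1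
      rw [ContinuousAt, if_neg hx]
      refine squeeze_zero_norm (a := fun q : I × Cb n => C * (f q.2 : E n).2.1 * (2 + (f q.2 : E n).1)) 
        (fun q => ?_) ?_
      · have t1 := T_bd hB (f q.2).2
        split_ifs with h
        · refine Sp_norm.trans ?_
          have s1 := (sp_facts hB (f q.2).2 h (hw _)).1
          have := hb q.1 q.2 h
          gcongr
          linarith
        · rw [norm_zero]; exact mul_nonneg (mul_nonneg hC t1.2.1) (by linarith [t1.1])
      · have : Continuous fun q : I × Cb n => C * (f q.2 : E n).2.1 * (2 + (f q.2 : E n).1) := by 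
          fun_prop
        have := this.tendsto (t, x)
        simpa [hx0] using this
  have hm : ∀ t x, H t x ∈ TT B := fun t x => by
    simp only [H]
    split_ifs with h
    · exact Sp_mem' _ (sp_facts hB (f x).2 h (hw _)).1
    · exact base_mem (T_bd hB (f x).2).1
  have hbd : ∀ t, ∀ x ∈ Cube.boundary (Fin (n + 1)), H t x = 0 := fun t x hx => by
    simp only [H]
    rw [L_bd f hx]; simp
  refine ⟨mkL (H 1) (hHc.comp (by fun_prop : Continuous fun x => ((1 : I), x))) (hm 1) (hbd 1),
    mk_htp H hHc hm (fun x => ?_) (fun x => rfl) hbd, fun x => rfl⟩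
  simp only [H]
  refine Prod.ext rfl ?_
  split_ifs with h
  · rw [h0 x h]; exact (sp_facts hB (f x).2 h (hw _)).2.2.2.symm
  · have hx0 : (f x : E n).2.1 = 0 := le_antisymm (not_lt.1 h) (T_bd hB (f x).2).2.1
    rcases T_cases hB (f x).2 with ⟨h1, h2⟩ | ⟨i, s, v, h1, h2, h3⟩ | ⟨k, v', t', g1, g2, g3, g4⟩
    · rw [h2]
    · rw [h3] at hx0; simp only [Sp] at hx0; linarith
    · have := cell_facts g1 g2 g3 g4; linarith [this.2.1]

theorem bp_near {v : V n} (h : ‖v - hv n‖ ≤ 1 / 4) : dn n ≤ bp v := by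
  unfold bp dn
  have : ((3 : ℝ) / 16) ^ (n + 1) = ∏ j : Fin (n + 1), (3 / 16 : ℝ) := by rw [Finset.prod_const]; simp
  rw [this]
  refine Finset.prod_le_prod (fun _ _ => by norm_num) fun j _ => le_max_of_le_right ?_
  have h1 := abs_le.1 ((norm_le_pi_norm (v - hv n) j).trans h)
  simp only [Pi.sub_apply, hv] at h1
  nlinarith [h1.1, h1.2]

theorem dil_bp_le {μ : ℝ} (hμ : 1 ≤ μ) (v : V n) : bp (dil μ v) ≤ bp v := by
  unfold bp
  refine Finset.prod_le_prod (fun _ _ => le_max_left _ _) fun j _ => max_le_max_left _ ?_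
  simp only [dil]
  nlinarith [mul_nonneg (show 0 ≤ μ - 1 by linarith) (mul_self_nonneg (v j - 1 / 2)), 
    mul_nonneg (mul_nonneg (show 0 ≤ μ - 1 by linarith) (show 0 ≤ μ - 1 by linarith)) (mul_self_nonneg (v j - 1 / 2))]

theorem bp_bound (f : Lp n B) {ε : ℝ} (hε : 0 < ε) : ∃ δ > 0, ∀ x, ε ≤ (f x : E n).2.1 → δ ≤ bp (rl x) := by
  have hf := L_cont f
  have hK : IsCompact {x : Cb n | ε ≤ (f x : E n).2.1} :=
    (isClosed_le continuous_const (by fun_prop)).isCompact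
  rcases eq_empty_or_nonempty {x : Cb n | ε ≤ (f x : E n).2.1} with h | h
  · exact ⟨1, one_pos, fun x hx => absurd (show x ∈ {x : Cb n | ε ≤ (f x : E n).2.1} from hx) (by rw [h]; simp)⟩
  · obtain ⟨x, hx, hm⟩ := hK.exists_isMinOn h (bp_cont.comp rl_cont).continuousOn
    refine ⟨bp (rl x), (bp_nonneg _).lt_of_ne' fun h0 => ?_, fun y hy => hm hy⟩
    have hb : x ∈ Cube.boundary (Fin (n + 1)) := by
      by_contra hb
      have : 0 < bp (rl x) := bp_pos.2 fun j => by
        have h1 : ¬ (x j = 0 ∨ x j = 1) := fun h => hb ⟨j, h⟩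
        push Not at h1
        exact ⟨unitInterval.pos_iff_ne_zero.2 h1.1, unitInterval.lt_one_iff_ne_one.2 h1.2⟩
      linarith
    have : ε ≤ (f x : E n).2.1 := hx
    rw [L_bd f hb] at this
    exact absurd this (not_le.2 hε)

theorem rl_dist (x y : Cb n) : dist x y = ‖rl x - rl y‖ := by
  rw [← dist_eq_norm]; rfl
end Reg
end CAG
namespace CAG
open Set Function unitInterval Topology.Homotopy

section Reg2
variable {n : ℕ} {B : ℕ → Finset ℕ}

theorem reg_loc (hB : ∀ k, ∀ i ∈ B k, i ≤ k) (f : Lp n B) (hw : ∀ x, (f x : E n).2.2.1 = 0)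
    {W : V n → V n} {x₀ : Cb n} (hl : 0 < (f x₀ : E n).2.1) (hx0 : vv (f x₀ : E n) = hv n)
    (hW0 : W (rl x₀) = hv n) {L : V n →L[ℝ] V n} (hW : HasFDerivAt W L (rl x₀)) (hL : L.det ≠ 0) :
    ∃ (i : ℕ) (A : Matrix (Fin (n + 1)) (Fin (n + 1)) ℝ) (κ r : ℝ), 0 < κ ∧ 0 < r ∧ A.det ≠ 0 ∧
      (∀ v : V n, 2 * κ * ‖v‖ ≤ ‖A.mulVec v‖) ∧
      (∀ y, ‖y - rl x₀‖ ≤ r → ‖W y - hv n - A.mulVec (y - rl x₀)‖ ≤ κ * ‖y - rl x₀‖) ∧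
      ∀ x : Cb n, ‖rl x - rl x₀‖ ≤ r → 0 < (f x : E n).2.1 ∧ ii (f x : E n) = i ∧
        ‖vv (f x : E n) - hv n‖ < 1 / 16 := by
  have hf := L_cont f
  set A := LinearMap.toMatrix' (L : V n →ₗ[ℝ] V n) with hAdef
  have hAm : ∀ v, A.mulVec v = L v := fun v => by
    rw [hAdef, ← Matrix.toLin'_apply, Matrix.toLin'_toMatrix']; rfl
  have hA : A.det ≠ 0 := by rw [hAdef, LinearMap.det_toMatrix']; exact hL
  obtain ⟨c, hc, hcb⟩ := gl_bound (fun _ => A) continuous_const fun _ => hA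
  have h1 := hW.isLittleO.def (show 0 < c / 2 by positivity)
  rw [Metric.eventually_nhds_iff_ball] at h1
  obtain ⟨r1, hr1, h1⟩ := h1
  have hfx : Filter.Tendsto (fun x => (f x : E n)) (𝓝 x₀) (𝓝 (f x₀ : E n)) := hf.tendsto x₀
  have h2 := hfx.eventually (ii_near hB (f x₀).2 hl (hw _))
  have h3 : ∀ᶠ x in 𝓝 x₀, 0 < (f x : E n).2.1 :=
    (by fun_prop : Continuous fun x => (f x : E n).2.1).continuousAt.eventually (lt_mem_nhds hl)
  have h4 : ∀ᶠ x in 𝓝 x₀, ‖vv (f x : E n) - hv n‖ < 1 / 16 := by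
    have c4 : ContinuousAt (fun z : E n => ‖vv z - hv n‖) (f x₀) :=
      ((vv_contAt hB (f x₀).2 hl (hw _)).sub continuousAt_const).norm
    exact hfx.eventually (c4.eventually (gt_mem_nhds (by beta_reduce; rw [hx0]; simp)))
  obtain ⟨r2, hr2, h5⟩ := Metric.eventually_nhds_iff.1 ((h2.and h3).and h4)
  refine ⟨ii (f x₀ : E n), A, c / 2, min r1 r2 / 2, by positivity, by positivity, hA, fun v => ?_,
    fun y hy => ?_, fun x hx => ?_⟩
  · have := hcb 0 v; linarith
  · have hm := min_le_left r1 r2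
    have := h1 y (by rw [mem_ball_iff_norm]; have := lt_min hr1 hr2; linarith)
    rw [hAm, ← hW0]; exact this
  · have hm := min_le_right r1 r2
    have := h5 (show dist x x₀ < r2 by rw [rl_dist]; have := lt_min hr1 hr2; linarith)
    exact ⟨this.1.2, this.1.1, this.2⟩

theorem reg_mem (hB : ∀ k, ∀ i ∈ B k, i ≤ k) {S : Subgroup (PG n B)} (hS : ∀ i, cl (eL B i) ∈ S)
    (f : Lp n B) (hw : ∀ x, (f x : E n).2.2.1 = 0)
    {W : V n → V n} (hW : ContDiff ℝ 1 W) (hreg : ∀ y, W y = hv n → (fderiv ℝ W y).det ≠ 0)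
    (hfW : ∀ x, 0 < (f x : E n).2.1 → ‖vv (f x : E n) - hv n‖ < 1 / 16 → vv (f x : E n) = W (rl x)) :
    cl f ∈ S := by
  have hf := L_cont f
  have hrl := rl_cont (n := n)
  have hdn := dn_pos (n := n)
  let S0 : Set (Cb n) := {x | 0 < (f x : E n).2.1 ∧ vv (f x : E n) = hv n}
  let LK : Set (Cb n) := {x | dn n ≤ (f x : E n).2.1}
  have hLK : IsClosed LK := isClosed_le continuous_const (by fun_prop)
  have hvc : ContinuousOn (fun x => vv (f x : E n)) LK := fun x hx =>
    (ContinuousAt.comp (f := fun x => (f x : E n)) (vv_contAt hB (f x).2 (hdn.trans_le hx) (hw _)) 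
      hf.continuousAt).continuousWithinAt
  have hin : ∀ x, 0 < (f x : E n).2.1 → ‖vv (f x : E n) - hv n‖ ≤ 1 / 4 → x ∈ LK := fun x h1 h2 => by
    show dn n ≤ (f x : E n).2.1
    rw [(sp_facts hB (f x).2 h1 (hw _)).2.2.1]; exact bp_near h2
  have hS0 : IsCompact S0 := by
    have : S0 = LK ∩ (fun x => vv (f x : E n)) ⁻¹' {hv n} := by
      ext x
      refine ⟨fun h => ⟨hin x h.1 ?_, h.2⟩, fun h => ⟨hdn.trans_le h.1, h.2⟩⟩
      rw [h.2]; simp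
    rw [this]
    exact (hvc.preimage_isClosed_of_isClosed hLK isClosed_singleton).isCompact
  have hWS : ∀ x ∈ S0, W (rl x) = hv n := fun x hx => by
    rw [← hfW x hx.1 (by rw [hx.2]; simp)]; exact hx.2
  have hloc : ∀ p ∈ rl '' S0, ∃ (i : ℕ) (A : Matrix (Fin (n + 1)) (Fin (n + 1)) ℝ) (κ r : ℝ),
      0 < κ ∧ 0 < r ∧ A.det ≠ 0 ∧ (∀ v : V n, 2 * κ * ‖v‖ ≤ ‖A.mulVec v‖) ∧
      (∀ y, ‖y - p‖ ≤ r → ‖W y - hv n - A.mulVec (y - p)‖ ≤ κ * ‖y - p‖) ∧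
      ∀ x : Cb n, ‖rl x - p‖ ≤ r → 0 < (f x : E n).2.1 ∧ ii (f x : E n) = i ∧
        ‖vv (f x : E n) - hv n‖ < 1 / 16 := by
    rintro _ ⟨x, hx, rfl⟩
    exact reg_loc hB f hw hx.1 hx.2 (hWS x hx) ((hW.differentiable one_ne_zero) _).hasFDerivAt 
      (hreg _ (hWS x hx))
  choose! i A κ r hκ hr hA hA2 hl hloc using hloc
  have hfin : (rl '' S0).Finite := by
    obtain ⟨t, ht, hcov⟩ := (hS0.image hrl).elim_nhds_subcover (fun p => Metric.ball p (r p)) 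
      fun p hp => Metric.ball_mem_nhds p (hr p hp)
    refine t.finite_toSet.subset fun q hq => ?_
    obtain ⟨p, hpt, hqp⟩ := mem_iUnion₂.1 (hcov hq)
    obtain ⟨x, hx, rfl⟩ := hq
    have h1 : ‖rl x - p‖ ≤ r p := (mem_ball_iff_norm.1 hqp).le
    have h2 := hl p (ht p hpt) _ h1
    rw [hWS x hx, sub_self, zero_sub, norm_neg] at h2
    have h3 := hA2 p (ht p hpt) (rl x - p)
    have h4 := hκ p (ht p hpt)
    have h5 : ‖rl x - p‖ = 0 := le_antisymm (by nlinarith) (norm_nonneg _)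
    rw [sub_eq_zero.1 (norm_eq_zero.1 h5)]; exact hpt
  set Sf := hfin.toFinset with hSf
  have hmem : ∀ {p}, p ∈ Sf ↔ p ∈ rl '' S0 := fun {p} => hfin.mem_toFinset
  obtain ⟨ρ, ⟨hρr, hρs⟩, hρ⟩ : ∃ ρ : ℝ, ((∀ p ∈ Sf, ρ < r p) ∧ ∀ p ∈ Sf, ∀ q ∈ Sf, ∀ j, p j = q j ∨
      4 * ρ < |p j - q j|) ∧ 0 < ρ := by
    have h1 : ∀ᶠ ρ : ℝ in 𝓝[>] 0, ∀ p ∈ Sf, ρ < r p := (Filter.eventually_all_finset _).2 fun p hp =>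
      nhdsWithin_le_nhds (gt_mem_nhds (hr p (hmem.1 hp)))
    have h2 : ∀ᶠ ρ : ℝ in 𝓝[>] 0, ∀ p ∈ Sf, ∀ q ∈ Sf, ∀ j, p j = q j ∨ 4 * ρ < |p j - q j| := by
      refine (Filter.eventually_all_finset _).2 fun p hp => (Filter.eventually_all_finset _).2 fun q hq =>
        Filter.eventually_all.2 fun j => ?_
      by_cases h : p j = q j
      · exact Filter.Eventually.of_forall fun _ => Or.inl h
      · have : 0 < |p j - q j| / 4 := by have := abs_pos.2 (sub_ne_zero.2 h); positivity
        filter_upwards [nhdsWithin_le_nhds (gt_mem_nhds this)] with ρ h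
        right; linarith
    exact ((h1.and h2).and (eventually_mem_nhdsWithin)).exists
  let KE : Set (Cb n) := LK ∩ {x | ∀ p ∈ Sf, ρ ≤ ‖rl x - p‖}
  have hKE : IsCompact KE := by
    refine (hLK.inter ?_).isCompact
    simp only [ofPred_forall]
    exact isClosed_biInter fun p _ => isClosed_le continuous_const (by fun_prop)
  obtain ⟨ε, hε, hεK⟩ : ∃ ε > 0, ∀ x ∈ KE, ε ≤ ‖vv (f x : E n) - hv n‖ := by
    rcases KE.eq_empty_or_nonempty with h | h
    · exact ⟨1, one_pos, fun x hx => by rw [h] at hx; exact absurd hx (notMem_empty _)⟩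
    · obtain ⟨x, hx, hm⟩ := hKE.exists_isMinOn h ((hvc.mono inter_subset_left).sub continuousOn_const).norm
      refine ⟨_, norm_pos_iff.2 fun h0 => ?_, fun y hy => hm hy⟩
      have := hx.2 (rl x) (hmem.2 ⟨x, ⟨hdn.trans_le hx.1, sub_eq_zero.1 h0⟩, rfl⟩)
      rw [sub_self, norm_zero] at this; linarith
  obtain ⟨μ, ⟨hμκ, hμε⟩, hμ⟩ : ∃ μ : ℝ, ((∀ p ∈ Sf, 1 ≤ μ * (κ p * ρ)) ∧ 1 ≤ μ * ε) ∧ 16 ≤ μ := by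
    have big : ∀ a : ℝ, 0 < a → ∀ᶠ μ : ℝ in Filter.atTop, 1 ≤ μ * a := fun a ha => 
      (Filter.tendsto_id.atTop_mul_const ha).eventually_ge_atTop 1
    exact ((((Filter.eventually_all_finset _).2 fun p hp => 
      big _ (mul_pos (hκ p (hmem.1 hp)) hρ)).and (big ε hε)).and (Filter.eventually_ge_atTop 16)).exists
  obtain ⟨δ, hδ, hδb⟩ := bp_bound f hdn
  have hball : ∀ p ∈ Sf, ∀ x : Cb n, ‖rl x - p‖ ≤ ρ → 0 < (f x : E n).2.1 ∧ ii (f x : E n) = i p ∧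
      vv (f x : E n) = W (rl x) ∧ δ ≤ bp (rl x) := fun p hp x hx => by
    obtain ⟨h1, h2, h3⟩ := hloc p (hmem.1 hp) x (hx.trans (hρr p hp).le)
    exact ⟨h1, h2, hfW x h1 h3, hδb x (hin x h1 (by linarith))⟩
  -- dilate
  obtain ⟨g, hfg, hg⟩ := sp_htp hB f hw (fun t x => dil (1 + (t : ℝ) * (μ - 1)) (vv (f x : E n))) zero_le_one
    (fun t x hx => by
      refine dil_cont.continuousAt.comp (f := fun q : I × Cb n => ((1 + (q.1 : ℝ) * (μ - 1)), vv (f q.2 : E n)))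
        (ContinuousAt.prodMk (by fun_prop) ?_)
      exact ContinuousAt.comp (f := fun q : I × Cb n => (f q.2 : E n)) (g := vv)
        (vv_contAt hB (f x).2 hx (hw _)) (hf.comp continuous_snd).continuousAt)
    (fun t x hx => by
      rw [(sp_facts hB (f x).2 hx (hw _)).2.2.1, one_mul]
      exact dil_bp_le (by nlinarith [t.2.1]) _) (fun x _ => by simp [dil_one])
  rw [hfg]
  obtain ⟨k, hk⟩ : ∃ k, ∀ p ∈ Sf, i p ≤ k := ⟨Sf.sup i, fun p hp => Finset.le_sup hp⟩
  have hpm : ∀ p ∈ Sf, _ := fun p hp => piece_mem hB hS (i p) (p := p) (A := A p) (μ := μ) (δ := δ) (κ := κ p) 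
    (r := ρ) (W := W) (by
      obtain ⟨x, hx, rfl⟩ := hmem.1 hp
      exact hδ.trans_le (hball _ hp x (by rw [sub_self, norm_zero]; exact hρ.le)).2.2.2) 
    (hA p (hmem.1 hp)) (by linarith) hδ (hκ p (hmem.1 hp)) hρ (hμκ p hp) hW.continuous
    (fun y hy => hl p (hmem.1 hp) y (hy.trans (hρr p hp).le)) (hA2 p (hmem.1 hp))
    (fun x hx => (hball p hp x hx).2.2.2)
  refine split_many hB hδ hρ (k := k) (fun p x => pc (i p) p ρ (dil μ (W (rl x))) x) Sf 
    (fun p hp => (hpm p hp).1) (fun p hp x => pc_ok (hk p hp) (fun x hx => (hball p hp x hx).2.2.2) _ x)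
    hρs (fun p hp => ?_) (fun p hp => (hpm p hp).2) g fun x => ?_
  · obtain ⟨x, hx, rfl⟩ := hmem.1 hp
    exact bp_pos.1 (hδ.trans_le (hball _ hp x (by rw [sub_self, norm_zero]; exact hρ.le)).2.2.2)
  · rw [hg]
    have eμ : 1 + ((1 : I) : ℝ) * (μ - 1) = μ := by simp
    beta_reduce
    rw [eμ]
    by_cases hex : ∃ p ∈ Sf, ‖rl x - p‖ ≤ ρ
    · obtain ⟨p, hp, hx⟩ := hex
      obtain ⟨h1, h2, h3, h4⟩ := hball p hp x hx
      rw [if_pos h1, h2, h3, Finset.sum_eq_single_of_mem p hp]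
      · rw [pc, if_pos hx]
      · intro q hq hne
        rw [pc, if_neg]
        intro hx'
        refine hne (funext fun l => ?_)
        rcases hρs q hq p hp l with h | h
        · exact h
        have a := abs_le.1 ((norm_le_pi_norm (rl x - p) l).trans hx)
        have b := abs_le.1 ((norm_le_pi_norm (rl x - q) l).trans hx')
        simp only [Pi.sub_apply] at a b
        exfalso
        rcases lt_abs.1 h with h | h <;> linarith [a.1, a.2, b.1, b.2]
    · push Not at hex
      rw [Finset.sum_eq_zero fun p hp => by rw [pc, if_neg (not_le.2 (hex p hp))]]
      split_ifs with h1
      · refine Sp_snd0 fun hd => ?_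
        have h2 : ‖vv (f x : E n) - hv n‖ ≤ 1 / 4 := by
          by_contra h2
          exact dil_far (by linarith) (by linarith) (not_le.1 h2).le hd
        exact dil_far (by linarith) hμε (hεK x ⟨hin x h1 h2, fun p hp => (hex p hp).le⟩) hd
      · rfl
end Reg2
end CAG
namespace CAG
open Set Function unitInterval Topology.Homotopy

section Approx
variable {n : ℕ} {B : ℕ → Finset ℕ}

theorem approx {F : Type} [NormedAddCommGroup F] [NormedSpace ℝ F] [TietzeExtension.{0} F]
    {A : Set (Cb n)} (hA : IsClosed A) {c : Cb n → F} (hc : ContinuousOn c A) :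
    ∃ W : V n → F, ContDiff ℝ 1 W ∧ ∀ x ∈ A, ‖W (rl x) - c x‖ < 1 / 64 := by
  obtain ⟨g, hg⟩ := ContinuousMap.exists_restrict_eq hA (⟨A.restrict c, hc.restrict⟩ : C(A, F))
  let pr : V n → Cb n := fun y j => projIcc 0 1 zero_le_one (y j)
  have hpr : Continuous pr := continuous_pi fun j => continuous_projIcc.comp (continuous_apply j)
  obtain ⟨W, hW, hWd, -⟩ := (g.continuous.comp hpr).exists_contDiff_approx (ε := fun _ => 1 / 64) 1
    continuous_const (fun _ => by norm_num)
  refine ⟨W, by exact_mod_cast hW, fun x hx => ?_⟩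
  have h1 := hWd (rl x)
  have h2 : pr (rl x) = x := funext fun j => projIcc_val _ _
  have h3 : g x = c x := congrArg (fun h : C(A, F) => h ⟨x, hx⟩) hg
  rw [dist_eq_norm] at h1
  simpa only [Function.comp_apply, h2, h3] using h1

noncomputable def chi {F : Type} [NormedAddCommGroup F] (c : F) : ℝ := max 0 (min 1 (2 - 8 * ‖c‖))
theorem chi_cont {F : Type} [NormedAddCommGroup F] : Continuous (chi (F := F)) := by
  unfold chi; fun_prop
theorem chi_0 {F : Type} [NormedAddCommGroup F] {c : F} (h : 1 / 4 ≤ ‖c‖) : chi c = 0 :=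
  max_eq_left ((min_le_right _ _).trans (by linarith))
theorem chi_1 {F : Type} [NormedAddCommGroup F] {c : F} (h : ‖c‖ ≤ 1 / 8) : chi c = 1 := by
  rw [chi, min_eq_left (by linarith), max_eq_right zero_le_one]
theorem chi_nn {F : Type} [NormedAddCommGroup F] (c : F) : 0 ≤ chi c := le_max_left _ _
theorem chi_le {F : Type} [NormedAddCommGroup F] (c : F) : chi c ≤ 1 :=
  max_le zero_le_one (min_le_left _ _)

/-- moving `c` towards `w` near `h` -/
noncomputable def mvp {F : Type} [NormedAddCommGroup F] [NormedSpace ℝ F] (h : F) (t : ℝ) (c w : F) : F :=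
  c + (t * chi (c - h)) • (w - c)

theorem mvp_far {F : Type} [NormedAddCommGroup F] [NormedSpace ℝ F] {h : F} {t : ℝ} {c w : F}
    (hc : 1 / 4 ≤ ‖c - h‖) : mvp h t c w = c := by rw [mvp, chi_0 hc]; simp

theorem mvp_near {F : Type} [NormedAddCommGroup F] [NormedSpace ℝ F] {h : F} {t : ℝ} (t0 : 0 ≤ t) (t1 : t ≤ 1)
    {c w : F} (hw : ‖c - h‖ ≤ 1 / 4 → ‖w - c‖ ≤ 1 / 32) : ‖mvp h t c w - c‖ ≤ 1 / 32 := by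
  rw [mvp, add_sub_cancel_left, norm_smul, Real.norm_of_nonneg (mul_nonneg t0 (chi_nn _))]
  rcases le_total ‖c - h‖ (1 / 4) with h1 | h1
  · have := hw h1
    have h2 : t * chi (c - h) ≤ 1 := mul_le_one₀ t1 (chi_nn _) (chi_le _)
    calc _ ≤ 1 * ‖w - c‖ := by gcongr
      _ ≤ _ := by linarith
  · rw [chi_0 h1]; simp

theorem mvp_eq {F : Type} [NormedAddCommGroup F] [NormedSpace ℝ F] {h c w : F}
    (hw : ‖c - h‖ ≤ 1 / 4 → ‖w - c‖ ≤ 1 / 32) (hm : ‖mvp h 1 c w - h‖ < 1 / 16) : mvp h 1 c w = w := by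
  have h1 := mvp_near zero_le_one le_rfl hw
  have h2 : ‖c - h‖ ≤ 1 / 8 := by
    have := norm_sub_le (mvp h 1 c w - h) (mvp h 1 c w - c)
    rw [sub_sub_sub_cancel_left] at this
    linarith
  rw [mvp, chi_1 h2]; simp

theorem mvp_contAt {F Y : Type} [NormedAddCommGroup F] [NormedSpace ℝ F] [TopologicalSpace Y] {h : F} 
    {t : Y → ℝ} {c w : Y → F} {y : Y} (ht : ContinuousAt t y) (hc : ContinuousAt c y) (hw : ContinuousAt w y) :
    ContinuousAt (fun y => mvp h (t y) (c y) (w y)) y := by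
  unfold mvp
  have := (chi_cont (F := F)).continuousAt.comp (hc.sub (continuousAt_const (y := h)))
  exact hc.add ((ht.mul this).smul (hw.sub hc))

theorem vv_of {z : E n} {i : ℕ} {v : V n} (hv0 : 0 < bp v) (h : z.2 = (Sp i 0 v).2) : vv z = v := by
  have hl : z.2.1 = bp v := by rw [h]; rfl
  have e1 : uu z = v + Pi.single 0 (i : ℝ) := uu_eq (by rw [hl]; exact hv0) (by rw [hl, h]; rfl)
  have h0 := bp_pos.1 hv0 0
  have e2 : ii z = i := by
    rw [ii, e1, Nat.floor_eq_iff]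
    · simp; constructor <;> linarith [h0.1, h0.2]
    · simp; linarith [h0.1, (Nat.cast_nonneg i : (0 : ℝ) ≤ i)]
  rw [vv, e2, e1]; simp

theorem sard {W : V n → V n} (hW : ContDiff ℝ 1 W) :
    ∃ b : V n, ‖b‖ < 1 / 64 ∧ ∀ y, W y + b = hv n → (fderiv ℝ W y).det ≠ 0 := by
  have h0 : MeasureTheory.volume (W '' {y | (fderiv ℝ W y).det = 0}) = 0 :=
    MeasureTheory.addHaar_image_eq_zero_of_det_fderivWithin_eq_zero _
      (fun x _ => ((hW.differentiable one_ne_zero) x).hasFDerivAt.hasFDerivWithinAt) fun x hx => hx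
  have hd : Dense {q | q ∉ W '' {y | (fderiv ℝ W y).det = 0}} :=
    MeasureTheory.Measure.dense_of_ae (MeasureTheory.measure_eq_zero_iff_ae_notMem.1 h0)
  obtain ⟨q, hq, hqd⟩ := hd.exists_dist_lt (hv n) (show (0 : ℝ) < 1 / 64 by norm_num)
  refine ⟨hv n - q, by rwa [← dist_eq_norm], fun y hy h => hq ⟨y, h, ?_⟩⟩
  rw [add_sub_left_comm] at hy
  exact sub_eq_zero.1 (by simpa using hy)

theorem c1_mem (hB : ∀ k, ∀ i ∈ B k, i ≤ k) {S : Subgroup (PG n B)} (hS : ∀ i, cl (eL B i) ∈ S)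
    (f : Lp n B) (hw : ∀ x, (f x : E n).2.2.1 = 0) : cl f ∈ S := by
  have hf := L_cont f
  have hdn := dn_pos (n := n)
  have hLK : IsClosed {x : Cb n | dn n ≤ (f x : E n).2.1} := isClosed_le continuous_const (by fun_prop)
  have hvc : ∀ x, 0 < (f x : E n).2.1 → ContinuousAt (fun x => vv (f x : E n)) x := fun x hx =>
    ContinuousAt.comp (f := fun x => (f x : E n)) (vv_contAt hB (f x).2 hx (hw _)) hf.continuousAt
  obtain ⟨W₀, hW₀, hWc⟩ := approx hLK (c := fun x => vv (f x : E n)) fun x hx =>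
    (hvc x (hdn.trans_le hx)).continuousWithinAt
  obtain ⟨b, hb, hreg⟩ := sard hW₀
  set W : V n → V n := fun y => W₀ y + b with hWdef
  have hW : ContDiff ℝ 1 W := hW₀.add contDiff_const
  have hin : ∀ x, 0 < (f x : E n).2.1 → ‖vv (f x : E n) - hv n‖ ≤ 1 / 4 → dn n ≤ (f x : E n).2.1 := 
    fun x h1 h2 => by rw [(sp_facts hB (f x).2 h1 (hw _)).2.2.1]; exact bp_near h2
  have hclose : ∀ x, 0 < (f x : E n).2.1 → ‖vv (f x : E n) - hv n‖ ≤ 1 / 4 → 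
      ‖W (rl x) - vv (f x : E n)‖ ≤ 1 / 32 := fun x h1 h2 => by
    have h3 := hWc x (hin x h1 h2)
    have h4 := norm_add_le (W₀ (rl x) - vv (f x : E n)) b
    have e : W (rl x) - vv (f x : E n) = W₀ (rl x) - vv (f x : E n) + b := by simp only [W]; abel
    rw [e]; linarith
  obtain ⟨g, hfg, hg⟩ := sp_htp hB f hw (fun t x => mvp (hv n) t (vv (f x : E n)) (W (rl x)))
    (C := 1 + 1 / dn n) (by positivity)
    (fun t x hx => mvp_contAt (Y := I × Cb n) (by fun_prop) 
      (ContinuousAt.comp (f := fun q : I × Cb n => q.2) (g := fun x => vv (f x : E n)) (hvc x hx) continuousAt_snd) 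
      ((hW.continuous.comp rl_cont).comp continuous_snd).continuousAt)
    (fun t x hx => by
      rcases le_total (1 / 4) ‖vv (f x : E n) - hv n‖ with h | h
      · rw [mvp_far h, ← (sp_facts hB (f x).2 hx (hw _)).2.2.1]
        have : 0 ≤ 1 / dn n := by positivity
        nlinarith
      · have h1 := hin x hx h
        have h2 : 1 ≤ 1 / dn n * (f x : E n).2.1 := by
          rw [one_div_mul_eq_div, one_le_div hdn]; exact h1
        linarith [bp_le (mvp (hv n) t (vv (f x : E n)) (W (rl x)))])
    (fun x _ => by simp [mvp])
  rw [hfg]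
  have key : ∀ x, 0 < (g x : E n).2.1 → 0 < (f x : E n).2.1 ∧
      vv (g x : E n) = mvp (hv n) 1 (vv (f x : E n)) (W (rl x)) := fun x hx => by
    have h1 := hg x
    by_cases h2 : 0 < (f x : E n).2.1
    · rw [if_pos h2] at h1
      refine ⟨h2, vv_of ?_ h1⟩
      rw [h1] at hx; exact hx
    · rw [if_neg h2] at h1
      rw [h1] at hx; exact absurd hx (lt_irrefl _)
  refine reg_mem hB hS g (fun x => ?_) hW (fun y hy => ?_) fun x h1 h2 => ?_
  · rw [hg]; split_ifs <;> rfl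
  · rw [hWdef, fderiv_add_const]; exact hreg y hy
  · obtain ⟨h3, h4⟩ := key x h1
    rw [h4] at h2 ⊢
    exact mvp_eq (hclose x h3) h2
end Approx
end CAG
namespace CAG
open Set Function unitInterval Topology.Homotopy

section Cell
variable {n : ℕ} {B : ℕ → Finset ℕ}

noncomputable def qk (B : ℕ → Finset ℕ) (k : ℕ) (z : E n) : V n × ℝ :=
  (Function.update (uu z) 0 (uu z 0 / (k + 1)), z.2.1 / (sig (B k) (uu z) + z.2.2.1))
noncomputable def qc (B : ℕ → Finset ℕ) (z : E n) : V n × ℝ := qk B (kk z) z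

theorem qc_of {z : E n} {k : ℕ} {y : V n × ℝ} (hv : 0 < bp y.1) (h0 : 0 < y.2) (h1 : y.2 < 1)
    (h : z = Q B k y.1 y.2) : qc B z = y := by
  obtain ⟨-, a2, a3, a4, a5, a6, a7⟩ := cell_facts hv h0 h1 h
  have hk : (k : ℝ) + 1 ≠ 0 := by positivity
  unfold qc qk
  rw [a7]
  refine Prod.ext ?_ ?_
  · simp only [a6]
    funext j
    by_cases hj : j = 0
    · subst hj; simp [usc, hk]
    · simp [usc, hj]
  · show z.2.1 / (sig (B k) (uu z) + z.2.2.1) = y.2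
    have : 0 < sig (B k) (uu z) + z.2.2.1 := by linarith [sig_nonneg (B k) (uu z)]
    rw [div_eq_iff this.ne']; exact a5

theorem qc_facts (hB : ∀ k, ∀ i ∈ B k, i ≤ k) {z : E n} (hz : z ∈ TT B) (hw : 0 < z.2.2.1) :
    z = Q B (kk z) (qc B z).1 (qc B z).2 ∧ 0 < bp (qc B z).1 ∧ 0 < (qc B z).2 ∧ (qc B z).2 < 1 ∧
      z.1 = kk z + 1 := by
  obtain ⟨k, v, t, h1, h2, h3, h4⟩ := cell_of hB hz hw
  have e : qc B z = (v, t) := qc_of (y := (v, t)) h1 h2 h3 h4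
  obtain ⟨a1, -, -, -, -, -, a7⟩ := cell_facts h1 h2 h3 h4
  rw [e, a7]
  exact ⟨h4, h1, h2, h3, a1⟩

theorem kk_near (hB : ∀ k, ∀ i ∈ B k, i ≤ k) (f : Lp n B) {x : Cb n} (hw : 0 < (f x : E n).2.2.1) :
    ∀ᶠ x' in 𝓝 x, 0 < (f x' : E n).2.2.1 ∧ kk (f x' : E n) = kk (f x : E n) := by
  have hf := L_cont f
  have c1 : Continuous fun x => (f x : E n).2.2.1 := by fun_prop
  have c2 : Continuous fun x' => |(f x' : E n).1 - (f x : E n).1| := by fun_prop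
  filter_upwards [c1.continuousAt.eventually (lt_mem_nhds hw),
    c2.continuousAt.eventually (gt_mem_nhds (show |(f x : E n).1 - (f x : E n).1| < 1 by simp))] with x' h1 h2
  refine ⟨h1, s_near ?_⟩
  rw [← (qc_facts hB (f x').2 h1).2.2.2.2, ← (qc_facts hB (f x).2 hw).2.2.2.2]; exact h2

theorem qc_contAt (hB : ∀ k, ∀ i ∈ B k, i ≤ k) (f : Lp n B) {x : Cb n} (hw : 0 < (f x : E n).2.2.1) :
    ContinuousAt (fun x => qc B (f x : E n)) x := by
  have hf := L_cont f
  obtain ⟨k, v, t, h1, h2, h3, h4⟩ := cell_of hB (f x).2 hw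
  obtain ⟨-, a2, a3, a4, a5, a6, a7⟩ := cell_facts h1 h2 h3 h4
  have hz : ContinuousAt (qk (n := n) B k) (f x) := by
    have cu := uu_contAt a2
    have cu0 : ContinuousAt (fun y => uu y 0) (f x : E n) := (continuous_apply 0).continuousAt.comp cu
    have cs : ContinuousAt (fun y => sig (B k) (uu y)) (f x : E n) := (sig_cont (B k)).continuousAt.comp cu
    have cl1 : ContinuousAt (fun y : E n => y.2.1) (f x : E n) := by fun_prop
    have cw : ContinuousAt (fun y : E n => y.2.2.1) (f x : E n) := by fun_prop
    refine ContinuousAt.prodMk (cu.update 0 (cu0.div_const _)) (cl1.div (cs.add cw) ?_)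
    have := sig_nonneg (B k) (uu (f x : E n)); linarith
  refine (ContinuousAt.comp (f := fun x => (f x : E n)) hz hf.continuousAt).congr ?_
  filter_upwards [kk_near hB f hw] with x' hx'
  show qk B k _ = qk B _ _
  rw [hx'.2, a7]

theorem cell_htp (hB : ∀ k, ∀ i ∈ B k, i ≤ k) (f : Lp n B) (y : I → Cb n → V n × ℝ)
    (hc : ∀ t x, 0 < (f x : E n).2.2.1 → ContinuousAt (uncurry y) (t, x))
    (hy : ∀ t x, 0 < (f x : E n).2.2.1 → (y t x).2 ∈ Icc (0 : ℝ) 1)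
    (hn : ∀ ε > 0, ∃ η > 0, ∀ t x, 0 < (f x : E n).2.2.1 → (f x : E n).2.2.1 < η →
      dist (Q B (kk (f x : E n)) (y t x).1 (y t x).2) (f x : E n) < ε)
    (h0 : ∀ x, 0 < (f x : E n).2.2.1 → y 0 x = qc B (f x : E n)) : ∃ g : Lp n B, cl f = cl g ∧
      ∀ x, (g x : E n) = if 0 < (f x : E n).2.2.1 then 
        Q B (kk (f x : E n)) (y 1 x).1 (y 1 x).2 else (f x : E n) := by
  have hf := L_cont f
  let H : I → Cb n → E n := fun t x => if 0 < (f x : E n).2.2.1 then 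
    Q B (kk (f x : E n)) (y t x).1 (y t x).2 else (f x : E n)
  have hHc : Continuous (uncurry H) := by
    rw [continuous_iff_continuousAt]
    rintro ⟨t, x⟩
    have hwc : Continuous fun q : I × Cb n => (f q.2 : E n).2.2.1 := by fun_prop
    have hfc : Continuous fun q : I × Cb n => (f q.2 : E n) := by fun_prop
    by_cases hx : 0 < (f x : E n).2.2.1
    · have h1 : ContinuousAt (fun q : I × Cb n => Q B (kk (f x : E n)) (uncurry y q).1 (uncurry y q).2) (t, x) :=
        ContinuousAt.comp (g := fun w : V n × ℝ => Q B (kk (f x : E n)) w.1 w.2) 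
          (Q_cont B _).continuousAt (hc t x hx)
      refine h1.congr ?_
      filter_upwards [(continuous_snd.tendsto (t, x)).eventually (kk_near hB f hx)] with q h2
      simp only [uncurry, H]
      rw [if_pos h2.1, h2.2]
    · rw [Metric.continuousAt_iff']
      intro ε hε
      obtain ⟨η, hη, hd⟩ := hn (ε / 2) (by positivity)
      have hx0 : (f x : E n).2.2.1 < η := (not_lt.1 hx).trans_lt hη
      have e0 : uncurry H (t, x) = f x := by simp only [uncurry, H]; rw [if_neg hx]
      rw [e0]
      filter_upwards [hwc.continuousAt.eventually (gt_mem_nhds hx0),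
        Metric.continuousAt_iff'.1 hfc.continuousAt (ε / 2) (by positivity)] with q h1 h2
      simp only [uncurry, H]
      split_ifs with h3
      · have := hd q.1 q.2 h3 h1
        exact (dist_triangle _ _ _).trans_lt (by linarith)
      · linarith
  have hm : ∀ t x, H t x ∈ TT B := fun t x => by
    simp only [H]
    split_ifs with h
    · exact Q_mem' hB _ (hy t x h)
    · exact (f x).2
  have hbd : ∀ t, ∀ x ∈ Cube.boundary (Fin (n + 1)), H t x = 0 := fun t x hx => by
    simp only [H]
    rw [L_bd f hx]; simp
  refine ⟨mkL (H 1) (hHc.comp (by fun_prop : Continuous fun x => ((1 : I), x))) (hm 1) (hbd 1),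
    mk_htp H hHc hm (fun x => ?_) (fun x => rfl) hbd, fun x => rfl⟩
  simp only [H]
  split_ifs with h
  · rw [h0 x h]; exact (qc_facts hB (f x).2 h).1.symm
  · rfl

noncomputable def hh (n : ℕ) : V n × ℝ := (hv n, 1 / 2)
noncomputable def en (n : ℕ) : ℝ := 3 / 16 * dn n
theorem en_pos : 0 < en n := by have := dn_pos (n := n); unfold en; positivity
noncomputable def wq (y : V n × ℝ) : ℝ := y.2 * (1 - y.2) * bp y.1

theorem wq_near {y : V n × ℝ} (h : ‖y - hh n‖ ≤ 1 / 4) : en n ≤ wq y := by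
  have h1 := bp_near ((norm_fst_le (y - hh n)).trans h)
  have h2 := abs_le.1 ((norm_snd_le (y - hh n)).trans h)
  simp only [hh, Prod.snd_sub] at h2
  have h3 := dn_pos (n := n)
  unfold en wq
  refine mul_le_mul ?_ h1 h3.le ?_ <;> nlinarith [h2.1, h2.2]

theorem box {y : V n × ℝ} (hv : 0 < bp y.1) (h0 : 0 < y.2) (h1 : y.2 < 1) : ‖y - hh n‖ ≤ 1 / 2 := by
  rw [Prod.norm_def]
  refine max_le ((pi_norm_le_iff_of_nonneg (by norm_num)).2 fun j => ?_) ?_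
  · have := bp_pos.1 hv j
    simp only [Prod.fst_sub, hh, Pi.sub_apply, CAG.hv]
    rw [Real.norm_eq_abs, abs_le]; constructor <;> linarith [this.1, this.2]
  · simp only [Prod.snd_sub, hh]
    rw [Real.norm_eq_abs, abs_le]; constructor <;> linarith

theorem box2 {y : V n × ℝ} (h : ‖y - hh n‖ ≤ 1 / 2) : y.2 ∈ Icc (0 : ℝ) 1 := by
  have h2 := abs_le.1 ((norm_snd_le (y - hh n)).trans h)
  simp only [hh, Prod.snd_sub] at h2
  constructor <;> linarith [h2.1, h2.2]

theorem wq_box {y : V n × ℝ} (h : ‖y - hh n‖ ≤ 1 / 2) : 0 ≤ wq y :=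
  mul_nonneg (mul_nonneg (box2 h).1 (by linarith [(box2 h).2])) (bp_nonneg _)

theorem wq_zero {y : V n × ℝ} (h : ‖y - hh n‖ ≤ 1 / 2) : wq y = 0 ↔ ‖y - hh n‖ = 1 / 2 := by
  have b := box2 h
  constructor
  · intro h0
    refine le_antisymm h (not_lt.1 fun hlt => ?_)
    have h1 := bp_pos.2 fun j => (by
      have := abs_lt.1 ((norm_le_pi_norm (y.1 - hv n) j).trans_lt ((norm_fst_le (y - hh n)).trans_lt hlt))
      simp only [hv, Pi.sub_apply] at this
      constructor <;> linarith [this.1, this.2] : 0 < y.1 j ∧ y.1 j < 1)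
    have h2 := abs_lt.1 ((norm_snd_le (y - hh n)).trans_lt hlt)
    simp only [hh, Prod.snd_sub] at h2
    have : 0 < wq y := mul_pos (mul_pos (by linarith) (by linarith)) h1
    linarith
  · intro he
    by_contra hne
    have hp : 0 < wq y := (wq_box h).lt_of_ne' hne
    unfold wq at hp
    have h1 : 0 < bp y.1 := (bp_nonneg _).lt_of_ne' fun h => by rw [h, mul_zero] at hp; exact lt_irrefl _ hp
    have h2 : 0 < y.2 * (1 - y.2) := pos_of_mul_pos_left hp h1.le
    have h3 : 0 < y.2 ∧ y.2 < 1 := by constructor <;> nlinarith [b.1, b.2]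
    have : ‖y - hh n‖ < 1 / 2 := by
      rw [Prod.norm_def]
      refine max_lt ((pi_norm_lt_iff (by norm_num)).2 fun j => ?_) ?_
      · have := bp_pos.1 h1 j
        simp only [Prod.fst_sub, hh, Pi.sub_apply, hv]
        rw [Real.norm_eq_abs, abs_lt]; constructor <;> linarith [this.1, this.2]
      · simp only [Prod.snd_sub, hh]
        rw [Real.norm_eq_abs, abs_lt]; constructor <;> linarith
    linarith

/-- stretching away from the centre -/
noncomputable def str (ρ : ℝ) (y : V n × ℝ) : V n × ℝ :=
  hh n + (max (2 * ‖y - hh n‖) ρ)⁻¹ • (y - hh n)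

theorem str_norm {ρ : ℝ} (hρ : 0 < ρ) (y : V n × ℝ) : ‖str ρ y - hh n‖ = ‖y - hh n‖ / max (2 * ‖y - hh n‖) ρ := by
  have : 0 < max (2 * ‖y - hh n‖) ρ := lt_max_of_lt_right hρ
  rw [str, add_sub_cancel_left, norm_smul, norm_inv, Real.norm_of_nonneg this.le, inv_mul_eq_div]

theorem str_box {ρ : ℝ} (hρ : 0 < ρ) (y : V n × ℝ) : ‖str ρ y - hh n‖ ≤ 1 / 2 := by
  rw [str_norm hρ, div_le_iff₀ (lt_max_of_lt_right hρ)]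
  linarith [le_max_left (2 * ‖y - hh n‖) ρ]

theorem str_bd {ρ : ℝ} (hρ : 0 < ρ) {y : V n × ℝ} (h : ρ ≤ 2 * ‖y - hh n‖) : wq (str ρ y) = 0 := by
  rw [wq_zero (str_box hρ y), str_norm hρ, max_eq_left h]
  have : 0 < ‖y - hh n‖ := by linarith
  field_simp

theorem str_id {ρ : ℝ} {y : V n × ℝ} (h : max (2 * ‖y - hh n‖) ρ = 1) : str ρ y = y := by
  rw [str, h]; simp

theorem str_contAt {Y : Type*} [TopologicalSpace Y] {ρ : Y → ℝ} {y : Y → V n × ℝ} {q : Y} 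
    (hρ : 0 < ρ q) (h1 : ContinuousAt ρ q) (h2 : ContinuousAt y q) : ContinuousAt (fun q => str (ρ q) (y q)) q := by
  unfold str
  have h3 : ContinuousAt (fun q => y q - hh n) q := h2.sub continuousAt_const
  exact continuousAt_const.add ((((h3.norm.const_mul 2).max h1).inv₀ (lt_max_of_lt_right hρ).ne').smul h3)

theorem str_near {ρ₀ : ℝ} (hρ : 0 < ρ₀) (k : ℕ) {ε : ℝ} (hε : 0 < ε) : ∃ η > 0, ∀ ρ ∈ Icc ρ₀ 1, 
    ∀ y : V n × ℝ, ‖y - hh n‖ ≤ 1 / 2 → wq y < η → 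
      dist (Q B k (str ρ y).1 (str ρ y).2) (Q B k y.1 y.2) < ε := by
  have hQ := Q_cont (n := n) B k
  have hb := bp_cont (n := n)
  let K : Set (ℝ × (V n × ℝ)) := Icc ρ₀ 1 ×ˢ Metric.closedBall (hh n) (1 / 2)
  have hK : IsCompact K := isCompact_Icc.prod (isCompact_closedBall _ _)
  have hcont : ContinuousOn (fun q : ℝ × (V n × ℝ) => dist (Q B k (str q.1 q.2).1 (str q.1 q.2).2) (Q B k q.2.1 q.2.2)) K := by
    intro q hq
    refine ContinuousAt.continuousWithinAt ?_
    have h1 : ContinuousAt (fun q : ℝ × (V n × ℝ) => str q.1 q.2) q :=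
      str_contAt (hρ.trans_le hq.1.1) continuousAt_fst continuousAt_snd
    exact (ContinuousAt.comp (g := fun w : V n × ℝ => Q B k w.1 w.2) hQ.continuousAt h1).dist
      (hQ.comp continuous_snd).continuousAt
  have hK2 : IsCompact (K ∩ (fun q : ℝ × (V n × ℝ) => dist (Q B k (str q.1 q.2).1 (str q.1 q.2).2) 
      (Q B k q.2.1 q.2.2)) ⁻¹' Ici ε) :=
    hK.of_isClosed_subset (hcont.preimage_isClosed_of_isClosed hK.isClosed isClosed_Ici) inter_subset_left
  have hwc : Continuous fun q : ℝ × (V n × ℝ) => wq q.2 := by unfold wq; fun_prop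
  rcases eq_empty_or_nonempty (K ∩ (fun q : ℝ × (V n × ℝ) => dist (Q B k (str q.1 q.2).1 (str q.1 q.2).2) 
      (Q B k q.2.1 q.2.2)) ⁻¹' Ici ε) with h | h
  · refine ⟨1, one_pos, fun ρ hr y hy _ => not_le.1 fun hle => ?_⟩
    have : (ρ, y) ∈ (∅ : Set _) := h ▸ ⟨⟨hr, mem_closedBall_iff_norm.2 hy⟩, hle⟩
    exact this
  · obtain ⟨q, hq, hmin⟩ := hK2.exists_isMinOn h hwc.continuousOn
    have hq2 := mem_closedBall_iff_norm.1 hq.1.2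
    refine ⟨wq q.2, (wq_box hq2).lt_of_ne' fun h0 => ?_, fun ρ hr y hy hlt => not_le.1 fun hle => ?_⟩
    · have h1 := (wq_zero hq2).1 h0
      have h2 : ε ≤ dist (Q B k (str q.1 q.2).1 (str q.1 q.2).2) (Q B k q.2.1 q.2.2) := hq.2
      rw [str_id, dist_self] at h2
      · linarith
      · rw [h1, max_eq_left]
        · norm_num
        · linarith [hq.1.1.2]
    · have : wq q.2 ≤ wq y := hmin (a := (ρ, y)) ⟨⟨hr, mem_closedBall_iff_norm.2 hy⟩, hle⟩
      linarith

theorem gen (hB : ∀ k, ∀ i ∈ B k, i ≤ k) {S : Subgroup (PG n B)} (hS : ∀ i, cl (eL B i) ∈ S)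
    (f : Lp n B) : cl f ∈ S := by
  have hf := L_cont f
  have hen := en_pos (n := n)
  have hwq : ∀ (f : Lp n B) x, 0 < (f x : E n).2.2.1 → (f x : E n).2.2.1 = wq (qc B (f x : E n)) := 
    fun f x h => by
      have := congrArg (fun z : E n => z.2.2.1) (qc_facts hB (f x).2 h).1
      exact this
  have hbox : ∀ (f : Lp n B) x, 0 < (f x : E n).2.2.1 → ‖qc B (f x : E n) - hh n‖ ≤ 1 / 2 := 
    fun f x h => by
      obtain ⟨-, a, b, c, -⟩ := qc_facts hB (f x).2 h
      exact box a b c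
  have hLK : ∀ f : Lp n B, IsClosed {x : Cb n | en n ≤ (f x : E n).2.2.1} := fun f => by
    have hf := L_cont f
    exact isClosed_le continuous_const (by fun_prop)
  obtain ⟨W₀, hW₀, hWc⟩ := approx (hLK f) (c := fun x => qc B (f x : E n)) fun x hx =>
    (qc_contAt hB f (hen.trans_le hx)).continuousWithinAt
  obtain ⟨q, hq, hqd⟩ := (hW₀.dense_compl_range_of_finrank_lt_finrank (by simp)).exists_dist_lt (hh n) 
    (show (0 : ℝ) < 1 / 64 by norm_num)
  set W : V n → V n × ℝ := fun y => W₀ y + (hh n - q) with hWdef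
  have hW : Continuous W := hW₀.continuous.add continuous_const
  have hWne : ∀ y, W y ≠ hh n := fun y hy => hq ⟨y, by
    have h : W₀ y + (hh n - q) = hh n := hy
    rw [add_sub_left_comm] at h
    exact sub_eq_zero.1 (by simpa using h)⟩
  have hclose : ∀ x, 0 < (f x : E n).2.2.1 → ‖qc B (f x : E n) - hh n‖ ≤ 1 / 4 → 
      ‖W (rl x) - qc B (f x : E n)‖ ≤ 1 / 32 := fun x h1 h2 => by
    have h3 := hWc x (show en n ≤ _ by rw [hwq f x h1]; exact wq_near h2)
    have h4 := norm_add_le (W₀ (rl x) - qc B (f x : E n)) (hh n - q)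
    rw [dist_eq_norm] at hqd
    have e : W (rl x) - qc B (f x : E n) = W₀ (rl x) - qc B (f x : E n) + (hh n - q) := by simp only [W]; abel
    rw [e]; linarith
  have hmb : ∀ (t : I) x, 0 < (f x : E n).2.2.1 → 
      ‖mvp (hh n) t (qc B (f x : E n)) (W (rl x)) - hh n‖ ≤ 1 / 2 := fun t x hx => by
    rcases le_total (1 / 4) ‖qc B (f x : E n) - hh n‖ with h | h
    · rw [mvp_far h]; exact hbox f x hx
    · have h1 := mvp_near t.2.1 t.2.2 (hclose x hx)
      have h2 := norm_sub_le_norm_sub_add_norm_sub (mvp (hh n) t (qc B (f x : E n)) (W (rl x))) (qc B (f x : E n)) (hh n)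
      linarith
  obtain ⟨g, hfg, hg⟩ := cell_htp hB f (fun t x => mvp (hh n) t (qc B (f x : E n)) (W (rl x)))
    (fun t x hx => mvp_contAt (Y := I × Cb n) (by fun_prop) 
      (ContinuousAt.comp (f := fun q : I × Cb n => q.2) (g := fun x => qc B (f x : E n)) (qc_contAt hB f hx) continuousAt_snd) 
      ((hW.comp rl_cont).comp continuous_snd).continuousAt)
    (fun t x hx => box2 (hmb t x hx))
    (fun ε hε => ⟨en n, hen, fun t x h1 h2 => by
      have h3 : 1 / 4 ≤ ‖qc B (f x : E n) - hh n‖ := by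
        by_contra h3
        have := wq_near (not_le.1 h3).le
        rw [← hwq f x h1] at this; linarith
      beta_reduce
      rw [mvp_far h3, ← (qc_facts hB (f x).2 h1).1, dist_self]; exact hε⟩)
    (fun x _ => by simp [mvp])
  rw [hfg]
  have hgne : ∀ x, 0 < (g x : E n).2.2.1 → qc B (g x : E n) ≠ hh n := fun x hx he => by
    have h1 := hg x
    by_cases h2 : 0 < (f x : E n).2.2.1
    · rw [if_pos h2] at h1
      set y := mvp (hh n) ((1 : I) : ℝ) (qc B (f x : E n)) (W (rl x)) with hy
      have hb := hmb 1 x h2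
      rw [← hy] at hb
      have h3 : 0 < wq y := by rw [h1] at hx; exact hx
      have h4 : 0 < bp y.1 := (bp_nonneg _).lt_of_ne' fun h => by rw [wq, h, mul_zero] at h3; exact lt_irrefl _ h3
      have h5 : 0 < y.2 * (1 - y.2) := pos_of_mul_pos_left h3 h4.le
      have b2 := box2 hb
      have e : qc B (g x : E n) = y := qc_of h4 (by nlinarith [b2.1, b2.2]) (by nlinarith [b2.1, b2.2]) h1
      rw [he] at e
      have e1 := mvp_eq (hclose x h2) (h := hh n) (w := W (rl x)) (by
        show ‖y - hh n‖ < 1 / 16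
        rw [← e]; simp)
      refine hWne (rl x) (e1.symm.trans e.symm)
    · rw [if_neg h2] at h1
      rw [h1] at hx; exact h2 hx
  have hgc := L_cont g
  obtain ⟨ρ, hρ, hρ1, hρg⟩ : ∃ ρ : ℝ, 0 < ρ ∧ ρ ≤ 1 / 4 ∧ ∀ x, 0 < (g x : E n).2.2.1 → 
      ρ ≤ ‖qc B (g x : E n) - hh n‖ := by
    have near : ∀ x, 0 < (g x : E n).2.2.1 → ‖qc B (g x : E n) - hh n‖ ≤ 1 / 4 → 
        x ∈ {x : Cb n | en n ≤ (g x : E n).2.2.1} := fun x h1 h2 => by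
      show en n ≤ _; rw [hwq g x h1]; exact wq_near h2
    rcases eq_empty_or_nonempty {x : Cb n | en n ≤ (g x : E n).2.2.1} with h | h
    · refine ⟨1 / 4, by norm_num, le_rfl, fun x h1 => not_lt.1 fun h2 => ?_⟩
      have := near x h1 h2.le
      rw [h] at this; exact this
    · obtain ⟨x, hx, hm⟩ := (hLK g).isCompact.exists_isMinOn h (f := fun x => ‖qc B (g x : E n) - hh n‖)
        fun x hx => ((qc_contAt hB g (hen.trans_le hx)).sub continuousAt_const).norm.continuousWithinAt
      refine ⟨min (1 / 4) ‖qc B (g x : E n) - hh n‖, lt_min (by norm_num) 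
        (norm_pos_iff.2 (sub_ne_zero.2 (hgne x (hen.trans_le hx)))), min_le_left _ _, fun y hy => ?_⟩
      rcases le_total (1 / 4) ‖qc B (g y : E n) - hh n‖ with h1 | h1
      · exact (min_le_left _ _).trans h1
      · exact (min_le_right _ _).trans (hm (near y hy h1))
  have hr : ∀ t : I, 1 + (t : ℝ) * (ρ - 1) ∈ Icc ρ 1 := fun t => by
    have := t.2.1; have := t.2.2
    constructor <;> nlinarith
  have hr0 : ∀ t : I, 0 < 1 + (t : ℝ) * (ρ - 1) := fun t => hρ.trans_le (hr t).1
  obtain ⟨M, hM⟩ : ∃ M : ℕ, ∀ x, 0 < (g x : E n).2.2.1 → kk (g x : E n) ≤ M := by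
    obtain ⟨M, hM⟩ := (isCompact_univ.image (by fun_prop : Continuous fun x => (g x : E n).1)).bddAbove
    obtain ⟨m, hm⟩ := exists_nat_ge M
    refine ⟨m, fun x hx => ?_⟩
    have h1 := (qc_facts hB (g x).2 hx).2.2.2.2
    have h2 := hM ⟨x, mem_univ _, rfl⟩
    simp only at h2
    have : (kk (g x : E n) : ℝ) ≤ m := by linarith
    exact_mod_cast this
  obtain ⟨g', hgg, hg'⟩ := cell_htp hB g (fun t x => str (1 + (t : ℝ) * (ρ - 1)) (qc B (g x : E n)))
    (fun t x hx => str_contAt (Y := I × Cb n) (q := (t, x)) (ρ := fun q => 1 + (q.1 : ℝ) * (ρ - 1)) (hr0 t) (by fun_prop)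
      (ContinuousAt.comp (f := fun q : I × Cb n => q.2) (g := fun x => qc B (g x : E n)) (qc_contAt hB g hx) continuousAt_snd))
    (fun t x hx => box2 (str_box (hr0 t) _))
    (fun ε hε => by
      choose η hη hs using fun k => str_near (n := n) (B := B) hρ k hε
      refine ⟨(Finset.range (M + 1)).inf' ⟨0, by simp⟩ η, (Finset.lt_inf'_iff _).2 fun k _ => hη k, fun t x h1 h2 => ?_⟩
      have h3 := hs (kk (g x : E n)) _ (hr t) (qc B (g x : E n)) (hbox g x h1) (by
        rw [← hwq g x h1]
        exact h2.trans_le (Finset.inf'_le _ (Finset.mem_range.2 (by have := hM x h1; omega))))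
      rwa [← (qc_facts hB (g x).2 h1).1] at h3)
    (fun x hx => str_id (by
      have := hbox g x hx
      simp only [Icc.coe_zero, zero_mul, add_zero]
      exact max_eq_right (by linarith)))
  rw [hgg]
  refine c1_mem hB hS g' fun x => ?_
  rw [hg']
  split_ifs with h
  · refine str_bd (hr0 1) ?_
    have := hρg x h
    simp only [Icc.coe_one, one_mul, add_sub_cancel]
    linarith
  · exact le_antisymm (not_lt.1 h) (T_bd hB (g x).2).2.2.2.1
end Cell
end CAG
namespace CAG
open Set Function unitInterval Topology.Homotopy

theorem exists_seq (G : Type) [CommGroup G] [Countable G] :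
    ∃ x : ℕ → G, ∀ g m, ∃ i, m < i ∧ x i = g := by
  obtain ⟨s, hs⟩ := exists_surjective_nat G
  refine ⟨fun i => s (Nat.unpair i).1, fun g m => ?_⟩
  obtain ⟨a, ha⟩ := hs g
  refine ⟨Nat.pair a (m+1), ?_, by simp [ha]⟩
  exact lt_of_lt_of_le (Nat.lt_succ_self m) (Nat.right_le_pair a (m+1))

open Classical in
theorem exists_B {G : Type} [CommGroup G] (x : ℕ → G) :
    ∃ B : ℕ → Finset ℕ, (∀ k, ∀ i ∈ B k, i ≤ k) ∧ (∀ k, ∏ i ∈ B k, x i = 1) ∧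
      ∀ F : Finset ℕ, ∏ i ∈ F, x i = 1 → ∃ k, B k = F := by
  obtain ⟨s, hs⟩ := exists_surjective_nat (Finset ℕ)
  refine ⟨fun k => if (∀ i ∈ s (Nat.unpair k).1, i ≤ k) ∧ ∏ i ∈ s (Nat.unpair k).1, x i = 1
    then s (Nat.unpair k).1 else ∅, fun k i hi => ?_, fun k => ?_, fun F hF => ?_⟩
  · dsimp only at hi
    split_ifs at hi with h
    · exact h.1 i hi
    · simp at hi
  · dsimp only
    split_ifs with h
    · exact h.2
    · simp
  · obtain ⟨a, ha⟩ := hs F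
    refine ⟨Nat.pair a (F.sup id), ?_⟩
    dsimp only
    rw [if_pos]
    · simp [ha]
    · simp only [Nat.unpair_pair, ha]
      exact ⟨fun i hi => (Finset.le_sup (f := id) hi).trans (Nat.right_le_pair a _), hF⟩

theorem exists_ring (A : Type) [AddCommGroup A] :
    ∃ (R : Type) (_ : CommRing R) (f : A →+ R), Function.Injective f := by
  letI : Module ℤᵐᵒᵖ A := Module.compHom A ((RingHom.id ℤ).fromOpposite (fun a b => mul_comm a b))
  haveI : IsCentralScalar ℤ A := ⟨fun m a => rfl⟩
  exact ⟨TrivSqZeroExt ℤ A, inferInstance,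
    { toFun := TrivSqZeroExt.inr, map_zero' := TrivSqZeroExt.inr_zero ℤ,
      map_add' := TrivSqZeroExt.inr_add ℤ }, TrivSqZeroExt.inr_injective⟩

theorem final (n : ℕ) (G : Type) [CommGroup G] [Countable G] :
    ∃ K : Set (Fin (n + 1 + 3) → ℝ), IsCompact K ∧ IsPathConnected K ∧
      ∀ x : ↥K, Nonempty ((π_ (n + 1) ↥K x) ≃* G) := by
  obtain ⟨x, hx⟩ := exists_seq G
  obtain ⟨B, hB, h1, hF⟩ := exists_B x
  obtain ⟨e, he⟩ := eHom (n := n) hB x hx hF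
  obtain ⟨R, _, f, hf⟩ := exists_ring (Additive G)
  have hinj : Function.Injective e := by
    rw [injective_iff_map_eq_one]
    intro g hg
    obtain ⟨i, -, rfl⟩ := hx g 0
    rw [he] at hg
    have h2 : ∀ k, ∑ i ∈ B k, f (Additive.ofMul (x i)) = 0 := by
      intro k
      rw [← map_sum, ← ofMul_prod, h1, ofMul_one, map_zero]
    have h3 := inj hB (x := fun i => f (Additive.ofMul (x i))) h2 i hg
    have h4 : Additive.ofMul (x i) = 0 := hf (by rw [map_zero]; exact h3)
    exact h4
  have hsurj : Function.Surjective e := by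
    intro p
    obtain ⟨l, rfl⟩ := cl_surj p
    exact gen hB (S := e.range) (fun i => ⟨x i, he i⟩) l
  exact wild (T_WH hB) G ⟨(MulEquiv.ofBijective e ⟨hinj, hsurj⟩).symm⟩

end CAG
/-- For every positive integer `n` (written `n + 1` below) and every countable abelian group
`G` there is a compact path connected subset `K ⊆ ℝ^{n+3}` with `πₙ(K) ≅ G`. -/
theorem countable_abelian_group_is_pin_of_compact_subset
    (n : ℕ) (G : Type) [CommGroup G] [Countable G] :
    ∃ K : Set (Fin (n + 1 + 3) → ℝ), IsCompact K ∧ IsPathConnected K ∧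
      ∀ x : ↥K, Nonempty ((π_ (n + 1) ↥K x) ≃* G) := by
  exact CAG.final n G
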